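/- arXiv:0912.1702 — 5 statements merged into one kernel-verified Lean document; each statement's English description precedes it below -/
import Mathlib

section
/- Let F_q be a finite field and n ≥ 1. For every monic polynomial g ∈ F_q[t] of degree n, the number N_g of ordered pairs (f, b), where f ∈ 𝓕 (the family of bivariate polynomials f(x,t) ∈ F_q[x,t] of total degree n such that f(t+b,t) is a monic polynomial of degree n in t for every b ∈ F_q), b ∈ F_q, and f(t+b,t) = g(t), equals q^(binomial(n+2,2) − n). -/
open Polynomial

theorem natCard_finsupp_fin_two_sum_le (n : ℕ) :
    Nat.card {s : Fin 2 →₀ ℕ | (s.sum fun _ e => e) ≤ n} = (n + 2).choose 2 := by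
  let e : {s : Fin 2 →₀ ℕ | (s.sum fun _ e => e) ≤ n} ≃
      (Finset.range (n + 1)).sigma Finset.HasAntidiagonal.antidiagonal :=
    { toFun := fun s => ⟨⟨s.1 0 + s.1 1, (s.1 0, s.1 1)⟩, by
        have h := s.2
        simp only [Set.mem_ofPred_eq, Finsupp.sum_fintype, Fin.sum_univ_two, implies_true] at h
        simp only [Finset.mem_sigma, Finset.mem_range,
          Finset.HasAntidiagonal.mem_antidiagonal, and_true]
        lia⟩
      invFun := fun p => ⟨(finTwoArrowEquiv' ℕ).symm p.1.2, by
        have h := p.2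
        simp only [Finset.mem_sigma, Finset.mem_range, Finset.HasAntidiagonal.mem_antidiagonal] at h
        rw [Set.mem_ofPred_eq, finTwoArrowEquiv'_sum_eq]
        lia⟩
      left_inv := fun s => Subtype.ext ((finTwoArrowEquiv' ℕ).symm_apply_apply s.1)
      right_inv := by
        rintro ⟨⟨k, i, j⟩, h⟩
        simp only [Finset.mem_sigma, Finset.mem_range, Finset.HasAntidiagonal.mem_antidiagonal] at h
        obtain ⟨_, rfl⟩ := h
        rfl }
  rw [Nat.card_congr e, Nat.card_eq_fintype_card, Fintype.card_coe, Finset.card_sigma]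
  simp only [Finset.Nat.card_antidiagonal]
  clear e
  induction n with
  | zero => rfl
  | succ n ih =>
    rw [Finset.sum_range_succ, ih, Nat.choose_succ_succ' (n + 2) 1, Nat.choose_one_right]
    lia

theorem Polynomial.mem_degreeLT_succ_iff {R : Type*} [Semiring R] {n : ℕ} {f : R[X]} :
    f ∈ degreeLT R (n + 1) ↔ f.natDegree ≤ n := by
  rw [degreeLT_succ_eq_degreeLE, mem_degreeLE, natDegree_le_iff_degree_le]

namespace MvPolynomial

theorem finrank_restrictTotalDegree_fin_two (F : Type*) [Field F] (n : ℕ) :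
    Module.finrank F (restrictTotalDegree (Fin 2) F n) = (n + 2).choose 2 := by
  rw [← natCard_finsupp_fin_two_sum_le]
  exact Module.finrank_eq_nat_card_basis (basisRestrictSupport F _)

variable {R : Type*} [CommRing R]

theorem natDegree_aeval_X_add_C_le {n : ℕ} (b : R) {f : MvPolynomial (Fin 2) R}
    (hf : f.totalDegree ≤ n) :
    (aeval ![Polynomial.X + Polynomial.C b, Polynomial.X] f : R[X]).natDegree ≤ n := by
  simpa using aeval_natDegree_le (m := n) (n := 1) f hf
    ![Polynomial.X + Polynomial.C b, Polynomial.X] (by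
      intro i
      fin_cases i
      · exact Polynomial.natDegree_add_C.trans_le Polynomial.natDegree_X_le
      · exact Polynomial.natDegree_X_le)

theorem coeff_aeval_X_add_C {n : ℕ} (b : R) {f : MvPolynomial (Fin 2) R}
    (hf : f.totalDegree ≤ n) :
    (aeval ![Polynomial.X + Polynomial.C b, Polynomial.X] f : R[X]).coeff n =
      ∑ s ∈ f.support, f.coeff s * if s 0 + s 1 = n then 1 else 0 := by
  rw [aeval_def, eval₂_eq', Polynomial.finsetSum_coeff]
  refine Finset.sum_congr rfl fun s hs => ?_
  have hle : s 0 + s 1 ≤ n := by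
    simpa [Finsupp.sum_fintype] using (le_totalDegree hs).trans hf
  rw [← Polynomial.C_eq_algebraMap, Polynomial.coeff_C_mul]
  simp only [Fin.prod_univ_two, Matrix.cons_val_zero, Matrix.cons_val_one]
  rw [Polynomial.coeff_mul_X_pow', if_pos (by lia)]
  nontriviality R
  congr 1
  split_ifs with h
  · have hm := (Polynomial.monic_X_add_C b).pow (s 0)
    have hd : ((Polynomial.X + Polynomial.C b) ^ s 0).natDegree = n - s 1 := by
      rw [(Polynomial.monic_X_add_C b).natDegree_pow, Polynomial.natDegree_X_add_C]
      lia
    rw [← hd]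
    exact hm.coeff_natDegree
  · refine Polynomial.coeff_eq_zero_of_natDegree_lt ?_
    rw [(Polynomial.monic_X_add_C b).natDegree_pow, Polynomial.natDegree_X_add_C]
    lia

theorem totalDegree_aeval_X_le {σ : Type*} [Nontrivial R] (i : σ) (g : R[X]) :
    (Polynomial.aeval (X i : MvPolynomial σ R) g).totalDegree ≤ g.natDegree := by
  rw [Polynomial.aeval_eq_sum_range]
  refine totalDegree_finsetSum_le fun k hk => ?_
  refine (totalDegree_smul_le _ _).trans ?_
  rw [totalDegree_X_pow]
  exact Nat.lt_succ_iff.mp (Finset.mem_range.mp hk)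

/-- Restriction of polynomials of total degree at most `n` to the line `x = t + b`. -/
noncomputable def restrictLine (n : ℕ) (b : R) :
    restrictTotalDegree (Fin 2) R n →ₗ[R] Polynomial.degreeLT R (n + 1) :=
  (aeval ![Polynomial.X + Polynomial.C b, Polynomial.X] :
      MvPolynomial (Fin 2) R →ₐ[R] R[X]).toLinearMap.restrict
    (p := restrictTotalDegree (Fin 2) R n) fun _ hf => Polynomial.mem_degreeLT_succ_iff.mpr <|
      natDegree_aeval_X_add_C_le b ((mem_restrictTotalDegree _ _ _).mp hf)

theorem restrictLine_surjective [Nontrivial R] (n : ℕ) (b : R) :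
    Function.Surjective (restrictLine n b) := by
  rintro ⟨g, hg⟩
  refine ⟨⟨Polynomial.aeval (X 1) g, ?_⟩, Subtype.ext ?_⟩
  · rw [mem_restrictTotalDegree]
    refine (totalDegree_aeval_X_le 1 g).trans ?_
    exact Polynomial.mem_degreeLT_succ_iff.mp hg
  · change aeval _ (Polynomial.aeval (X 1) g) = g
    rw [← Polynomial.aeval_algHom_apply]
    simp

theorem natCard_restrictLine_fiber {F : Type*} [Field F] [Fintype F] (n : ℕ) (b : F)
    (g : Polynomial.degreeLT F (n + 1)) :
    Nat.card (restrictLine n b ⁻¹' {g}) =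
      Fintype.card F ^ ((n + 2).choose 2 - (n + 1)) := by
  have hs := restrictLine_surjective n b
  have e := AddMonoidHom.fiberEquivKerOfSurjective (f := (restrictLine n b).toAddMonoidHom) hs g
  have h : Nat.card (restrictLine n b ⁻¹' {g}) = Nat.card (LinearMap.ker (restrictLine n b)) :=
    Nat.card_congr e
  rw [h, Module.natCard_eq_pow_finrank (K := F), Nat.card_eq_fintype_card]
  have hr := (restrictLine n b).finrank_range_add_finrank_ker
  rw [LinearMap.range_eq_top.mpr hs, finrank_top, finrank_restrictTotalDegree_fin_two,
    (Polynomial.degreeLTEquiv F (n + 1)).finrank_eq, Module.finrank_fin_fun] at hr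
  congr 1
  lia

end MvPolynomial

open Polynomial

/-- **Lemma 4.**  Let `F_q` be a finite field and `n ≥ 1`.  For every monic `g ∈ F_q[t]` of
degree `n`, the number `N_g` of pairs `(f, b)` with `f ∈ 𝓕` (bivariate polynomials of
total degree `n` such that `f(t+b,t)` is monic of degree `n` for every `b ∈ F_q`),
`b ∈ F_q`, and `f(t+b,t) = g`, equals `q^(C(n+2,2) − n)`. -/
theorem count_pairs_deg_n (Fq : Type) [Field Fq] [Fintype Fq] (n : ℕ) (hn : 1 ≤ n)
    (g : Polynomial Fq) (hg : g.Monic) (hgdeg : g.natDegree = n) :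
    Nat.card {p : MvPolynomial (Fin 2) Fq × Fq //
        p.1.totalDegree = n ∧
        (∀ b : Fq,
          (MvPolynomial.aeval ![Polynomial.X + Polynomial.C b, Polynomial.X] p.1 :
              Polynomial Fq).Monic ∧
          (MvPolynomial.aeval ![Polynomial.X + Polynomial.C b, Polynomial.X] p.1 :
              Polynomial Fq).natDegree = n) ∧
        (MvPolynomial.aeval ![Polynomial.X + Polynomial.C p.2, Polynomial.X] p.1 :
            Polynomial Fq) = g}
      = Fintype.card Fq ^ (Nat.choose (n + 2) 2 - n) := by
  have hgmem : g ∈ degreeLT Fq (n + 1) := mem_degreeLT_succ_iff.mpr hgdeg.le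
  have : Finite (MvPolynomial.restrictTotalDegree (Fin 2) Fq n) := Module.finite_of_finite Fq
  rw [Nat.card_congr (β := Σ b : Fq, MvPolynomial.restrictLine n b ⁻¹' {⟨g, hgmem⟩})
    { toFun := fun p => ⟨p.1.2, ⟨p.1.1, (MvPolynomial.mem_restrictTotalDegree _ _ _).mpr
        p.2.1.le⟩, Subtype.ext p.2.2.2⟩
      invFun := fun p => ⟨(p.2.1.1, p.1), by
        obtain ⟨b, ⟨f, hf⟩, h⟩ := p
        rw [MvPolynomial.mem_restrictTotalDegree] at hf
        have h : MvPolynomial.aeval ![X + C b, X] f = g := congrArg Subtype.val h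
        have hcoeff : ∀ c : Fq,
            (MvPolynomial.aeval ![X + C c, X] f : Fq[X]).coeff n = 1 := fun c => by
          rw [MvPolynomial.coeff_aeval_X_add_C c hf, ← MvPolynomial.coeff_aeval_X_add_C b hf,
            h, ← hgdeg]
          exact hg.coeff_natDegree
        refine ⟨hf.antisymm ?_, fun c => ?_, h⟩
        · have := MvPolynomial.natDegree_aeval_X_add_C_le b le_rfl (f := f)
          rwa [h, hgdeg] at this
        · have hle := MvPolynomial.natDegree_aeval_X_add_C_le c hf
          exact ⟨monic_of_natDegree_le_of_coeff_eq_one n hle (hcoeff c),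
            natDegree_eq_of_le_of_coeff_ne_zero hle (by simp [hcoeff c])⟩⟩
      left_inv := fun _ => rfl
      right_inv := fun _ => rfl }, Nat.card_sigma]
  simp only [MvPolynomial.natCard_restrictLine_fiber, Finset.sum_const, Finset.card_univ,
    smul_eq_mul]
  rw [← pow_succ']
  congr 1
  have : n + 1 ≤ (n + 2).choose 2 := by
    rw [Nat.choose_succ_succ' (n + 1) 1, Nat.choose_one_right]
    lia
  lia
end

section
/- Let F_q be a finite field of odd order q, let F ∈ F_q[t] be monic of degree n ≥ 2, and set I := binomial(n+1,2) − 1 and N := (n−1)!·n!. Let 𝓡 be the set of monic irreducible g ∈ F_q[t] of degree n−1 such that F − g is monic irreducible. Then there exist absolute constants C₁, C₂ > 0 such that |Σ_{g ∈ 𝓡} N_g − q^(I+1)/(n(n−1))| ≤ C₁·N·q^(I+1/2) + C₂·n·2^(binomial(n+2,2))·q^I. -/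
open Polynomial

open UniqueFactorizationMonoid

section Stepanov

variable {F : Type*} [Field F]

theorem pow_sub_dvd_hasseDeriv_pow_mul (f : F[X]) (N k : ℕ) (h : F[X]) :
    f ^ (N - k) ∣ hasseDeriv k (f ^ N * h) := by
  induction N generalizing k with
  | zero => simp
  | succ N ih =>
    rw [pow_succ', mul_assoc, hasseDeriv_mul]
    refine Finset.dvd_sum fun x hx => ?_
    rw [Finset.HasAntidiagonal.mem_antidiagonal] at hx
    rcases Nat.eq_zero_or_pos x.1 with h0 | h0
    · rw [h0, hasseDeriv_zero']
      refine dvd_trans (pow_dvd_pow f (?_ : _ ≤ N - x.2 + 1)) ?_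
      · omega
      · rw [pow_succ']; exact mul_dvd_mul_left _ (ih _)
    · exact dvd_mul_of_dvd_right (dvd_trans (pow_dvd_pow f (by omega)) (ih x.2)) _

theorem exists_linearMap_hasseDeriv_pow_mul {f : F[X]} (hf : f ≠ 0) {N k : ℕ} (hk : k ≤ N) :
    ∃ E : F[X] →ₗ[F] F[X], ∀ h, hasseDeriv k (f ^ N * h) = f ^ (N - k) * E h ∧
      (E h).natDegree ≤ h.natDegree + k * f.natDegree := by
  choose u hu using fun i => pow_sub_dvd_hasseDeriv_pow_mul f N i 1
  let E : F[X] →ₗ[F] F[X] := ∑ x ∈ Finset.HasAntidiagonal.antidiagonal k,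
    (LinearMap.mulLeft F (f ^ (k - x.1) * u x.1)) ∘ₗ hasseDeriv x.2
  have hE : ∀ h, hasseDeriv k (f ^ N * h) = f ^ (N - k) * E h := by
    intro h
    simp only [E, LinearMap.sum_apply, LinearMap.comp_apply, LinearMap.mulLeft_apply,
      Finset.mul_sum]
    rw [hasseDeriv_mul]
    refine Finset.sum_congr rfl fun x hx => ?_
    rw [Finset.HasAntidiagonal.mem_antidiagonal] at hx
    have := hu x.1
    rw [mul_one] at this
    rw [this, ← mul_assoc, ← mul_assoc, ← pow_add]
    congr 4
    omega
  refine ⟨E, fun h => ⟨hE h, ?_⟩⟩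
  by_cases h0 : E h = 0
  · simp [h0]
  have h1 : (f ^ (N - k) * E h).natDegree ≤ (f ^ N * h).natDegree := by
    rw [← hE h]; exact (natDegree_hasseDeriv_le _ _).trans (Nat.sub_le _ _)
  rw [natDegree_mul (pow_ne_zero _ hf) h0, natDegree_pow] at h1
  have h2 := (natDegree_mul_le (p := f ^ N) (q := h))
  rw [natDegree_pow] at h2
  have : N * f.natDegree = (N - k) * f.natDegree + k * f.natDegree := by
    rw [← add_mul]; congr 1; omega
  omega

theorem X_sub_C_pow_dvd_of_hasseDeriv {r : F[X]} {x : F} {l : ℕ}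
    (h : ∀ k < l, (hasseDeriv k r).eval x = 0) : (X - C x) ^ l ∣ r := by
  have h1 : X ^ l ∣ taylor x r := by
    rw [X_pow_dvd_iff]
    intro d hd
    rw [taylor_coeff]; exact h d hd
  obtain ⟨u, hu⟩ := h1
  have h2 := congrArg (taylor (-x)) hu
  rw [taylor_taylor, neg_add_cancel, taylor_zero, taylor_mul, taylor_pow, taylor_X] at h2
  exact ⟨_, by rw [h2, C_neg, sub_eq_add_neg]⟩

variable [Fintype F]

theorem X_sub_C_pow_dvd_X_pow_sub_C (x : F) {l : ℕ} (hl : l ≤ Fintype.card F) (j : ℕ) :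
    (X - C x) ^ l ∣ X ^ (j * Fintype.card F) - C (x ^ j) := by
  obtain ⟨p, hp⟩ := CharP.exists F
  have := hp
  obtain ⟨n, hprime, hn⟩ := FiniteField.card F p
  have := Fact.mk hprime
  have h1 : (X - C x) ^ Fintype.card F = X ^ Fintype.card F - C x := by
    conv_rhs => rw [← FiniteField.pow_card x, C_pow]
    rw [hn, sub_pow_char_pow]
  refine (pow_dvd_pow _ hl).trans ?_
  rw [h1, mul_comm, pow_mul, C_pow]
  exact sub_dvd_pow_sub_pow _ _ _

theorem X_pow_card_dvd_pow_card_sub_C (f : F[X]) :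
    X ^ Fintype.card F ∣ f ^ Fintype.card F - C (f.eval 0) := by
  obtain ⟨p, hp⟩ := CharP.exists F
  have := hp
  obtain ⟨n, hprime, hn⟩ := FiniteField.card F p
  have := Fact.mk hprime
  have h1 : f ^ Fintype.card F - C (f.eval 0) = (f - C (f.eval 0)) ^ Fintype.card F := by
    conv_lhs => rw [← FiniteField.pow_card (f.eval 0), C_pow]
    rw [hn, sub_pow_char_pow]
  rw [h1]
  refine pow_dvd_pow_of_dvd ?_ _
  rw [X_dvd_iff, coeff_sub, coeff_C_zero, coeff_zero_eq_eval_zero, sub_self]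

/-- Nonvanishing of Stepanov's auxiliary polynomial. -/
theorem stepanov_aux_ne_zero {f : F[X]} (hodd : Odd f.natDegree) (h0 : f.eval 0 ≠ 0)
    {c B J : ℕ} (hc : Fintype.card F = 2 * c + 1) (hB : 2 * (B - 1) + f.natDegree < Fintype.card F)
    (r s : Fin J → F[X]) (hr : ∀ j, (r j).natDegree ≤ B - 1) (hs : ∀ j, (s j).natDegree ≤ B - 1)
    (hne : ∃ j, r j ≠ 0 ∨ s j ≠ 0) :
    ∑ j : Fin J, (r j + f ^ c * s j) * X ^ ((j : ℕ) * Fintype.card F) ≠ 0 := by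
  classical
  intro hsum
  have hf : f ≠ 0 := by rintro rfl; simp at h0
  obtain ⟨j0, hj0, hmin⟩ := WellFounded.has_min (wellFounded_lt (α := Fin J))
    {j | r j ≠ 0 ∨ s j ≠ 0} hne
  set q := Fintype.card F
  have hdvd : X ^ q ∣ r j0 + f ^ c * s j0 := by
    have h1 : X ^ (j0 * q) * X ^ q ∣ X ^ (j0 * q) * (r j0 + f ^ c * s j0) := by
      have h2 : X ^ (j0 * q) * (r j0 + f ^ c * s j0) =
          - ∑ j ∈ Finset.univ.erase j0, (r j + f ^ c * s j) * X ^ ((j : ℕ) * q) := by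
        rw [← Finset.add_sum_erase _ _ (Finset.mem_univ j0)] at hsum
        linear_combination hsum
      rw [h2, dvd_neg]
      refine Finset.dvd_sum fun j hj => ?_
      rcases lt_trichotomy j j0 with h | h | h
      · have := hmin j
        have h3 : ¬ (r j ≠ 0 ∨ s j ≠ 0) := fun h' => this h' h
        push Not at h3
        simp [h3.1, h3.2]
      · exact absurd h (Finset.ne_of_mem_erase hj)
      · refine dvd_mul_of_dvd_right ?_ _
        rw [← pow_add]
        refine pow_dvd_pow _ ?_
        have : (j0 : ℕ) + 1 ≤ j := h
        nlinarith
    exact (mul_dvd_mul_iff_left (pow_ne_zero _ X_ne_zero)).1 h1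
  have h3 : X ^ q ∣ (r j0) ^ 2 * f - C (f.eval 0) * (s j0) ^ 2 := by
    have h4 : (r j0) ^ 2 * f - C (f.eval 0) * (s j0) ^ 2 =
        (r j0 + f ^ c * s j0) * ((r j0 - f ^ c * s j0) * f)
          + (f ^ q - C (f.eval 0)) * (s j0) ^ 2 := by
      rw [hc]; ring
    rw [h4]
    exact dvd_add (dvd_mul_of_dvd_left hdvd _)
      (dvd_mul_of_dvd_left (X_pow_card_dvd_pow_card_sub_C f) _)
  have h5 : (r j0) ^ 2 * f - C (f.eval 0) * (s j0) ^ 2 = 0 := by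
    by_contra hne
    have := natDegree_le_of_dvd h3 hne
    rw [natDegree_X_pow] at this
    have h6 := natDegree_sub_le ((r j0) ^ 2 * f) (C (f.eval 0) * (s j0) ^ 2)
    have h7 : ((r j0) ^ 2 * f).natDegree ≤ 2 * (B - 1) + f.natDegree := by
      refine natDegree_mul_le.trans ?_
      have := natDegree_pow_le (p := r j0) (n := 2)
      have := hr j0
      omega
    have h8 : (C (f.eval 0) * (s j0) ^ 2).natDegree ≤ 2 * (B - 1) := by
      refine (natDegree_C_mul_le _ _).trans ?_
      have := natDegree_pow_le (p := s j0) (n := 2)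
      have := hs j0
      omega
    have := max_le_iff.2 ⟨h7, h8.trans (Nat.le_add_right _ f.natDegree)⟩
    omega
  have h9 : (r j0) ^ 2 * f = C (f.eval 0) * (s j0) ^ 2 := sub_eq_zero.1 h5
  by_cases hr0 : r j0 = 0
  · rw [hr0] at h9
    have : s j0 = 0 := by
      by_contra hs0
      have : C (f.eval 0) * (s j0) ^ 2 ≠ 0 :=
        mul_ne_zero (by simpa using h0) (pow_ne_zero _ hs0)
      exact this (by rw [← h9]; ring)
    exact hj0.elim (fun h => h hr0) (fun h => h this)
  · have := congrArg natDegree h9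
    rw [natDegree_mul (pow_ne_zero _ hr0) hf, natDegree_C_mul h0, natDegree_pow, natDegree_pow]
      at this
    obtain ⟨t, ht⟩ := hodd
    omega

omit [Fintype F] in
/-- Existence of Stepanov's coefficients by counting linear conditions. -/
theorem exists_stepanov_coeffs {f : F[X]} (hf : f ≠ 0) (a : F) {c B J l : ℕ} (hB : 0 < B)
    (hdim : l * (B + J + l * f.natDegree) < 2 * (J * B)) :
    ∃ r s : Fin J → F[X], (∀ j, (r j).natDegree ≤ B - 1) ∧ (∀ j, (s j).natDegree ≤ B - 1) ∧
      (∃ j, r j ≠ 0 ∨ s j ≠ 0) ∧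
      ∀ x : F, f.eval x ^ c = a →
        (X - C x) ^ l ∣ f ^ l * ∑ j : Fin J, C (x ^ (j : ℕ)) * r j + f ^ (l + c) * ∑ j : Fin J, C (x ^ (j : ℕ)) * s j := by
  classical
  choose E hE hEd using fun k : Fin l =>
    (by
      obtain ⟨E, hE⟩ := exists_linearMap_hasseDeriv_pow_mul hf k.2.le
      exact ⟨E, fun h => (hE h).1, fun h => (hE h).2⟩ : ∃ E : F[X] →ₗ[F] F[X],
        (∀ h, hasseDeriv k (f ^ l * h) = f ^ (l - k) * E h) ∧
        ∀ h, (E h).natDegree ≤ h.natDegree + k * f.natDegree)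
  choose E' hE' hEd' using fun k : Fin l =>
    (by
      obtain ⟨E, hE⟩ := exists_linearMap_hasseDeriv_pow_mul hf (k.2.le.trans (Nat.le_add_right l c))
      exact ⟨E, fun h => (hE h).1, fun h => (hE h).2⟩ : ∃ E : F[X] →ₗ[F] F[X],
        (∀ h, hasseDeriv k (f ^ (l + c) * h) = f ^ (l + c - k) * E h) ∧
        ∀ h, (E h).natDegree ≤ h.natDegree + k * f.natDegree)
  set D := B + J + l * f.natDegree with hD
  let T : (Fin J → degreeLT F B) × (Fin J → degreeLT F B) → Fin l → F[X] := fun v k =>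
    ∑ j : Fin J, X ^ (j : ℕ) * (E k (v.1 j : F[X]) + C a * E' k (v.2 j : F[X]))
  have hnd : ∀ h : degreeLT F B, (h : F[X]).natDegree ≤ B - 1 := by
    intro h
    have := mem_degreeLT.1 h.2
    by_cases h0 : (h : F[X]) = 0
    · simp [h0]
    · rw [degree_eq_natDegree h0] at this
      have : (h : F[X]).natDegree < B := by exact_mod_cast this
      omega
  have hTd : ∀ v k, (T v k).natDegree < D := by
    intro v k
    refine Nat.lt_of_le_of_lt (natDegree_sum_le_of_forall_le (n := D - 1) _ _ fun j _ => ?_)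
      (by omega)
    refine natDegree_mul_le.trans ?_
    rw [natDegree_X_pow]
    have hk : (k : ℕ) * f.natDegree ≤ l * f.natDegree := Nat.mul_le_mul_right _ k.2.le
    have h1 : (E k (v.1 j : F[X])).natDegree ≤ B - 1 + l * f.natDegree :=
      (hEd k _).trans (add_le_add (hnd _) hk)
    have h2 : (C a * E' k (v.2 j : F[X])).natDegree ≤ B - 1 + l * f.natDegree :=
      (natDegree_C_mul_le _ _).trans ((hEd' k _).trans (add_le_add (hnd _) hk))
    have h3 := natDegree_add_le_of_degree_le h1 h2
    have := j.2
    omega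
  let L : (Fin J → degreeLT F B) × (Fin J → degreeLT F B) →ₗ[F] (Fin l → Fin D → F) :=
    { toFun := fun v k i => (T v k).coeff i
      map_add' := by
        intro v w
        funext k i
        simp only [T, Prod.fst_add, Prod.snd_add, Pi.add_apply, Submodule.coe_add, map_add]
        rw [← coeff_add, ← Finset.sum_add_distrib]
        congr 1
        refine Finset.sum_congr rfl fun j _ => ?_
        ring
      map_smul' := by
        intro t v
        funext k i
        simp only [T, Prod.smul_fst, Prod.smul_snd, Pi.smul_apply, Submodule.coe_smul, map_smul,
          RingHom.id_apply]
        rw [← coeff_smul, Finset.smul_sum]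
        congr 1
        refine Finset.sum_congr rfl fun j _ => ?_
        simp only [smul_eq_C_mul]
        ring }
  have hker : LinearMap.ker L ≠ ⊥ := by
    apply LinearMap.ker_ne_bot_of_finrank_lt
    have e : Module.finrank F (degreeLT F B) = B := by
      rw [(degreeLTEquiv F B).finrank_eq]; simp
    have : Module.Finite F (degreeLT F B) := Module.Finite.equiv (degreeLTEquiv F B).symm
    have e2 : Module.finrank F (Fin J → degreeLT F B) = J * B := by
      rw [Module.finrank_pi_fintype]; simp [e]
    have e3 : Module.finrank F (Fin l → Fin D → F) = l * D := by
      rw [Module.finrank_pi_fintype]; simp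
    rw [Module.finrank_prod, e2, e3]
    omega
  obtain ⟨v, hv, hv0⟩ := (Submodule.ne_bot_iff _).1 hker
  have hT0 : ∀ k, T v k = 0 := by
    intro k
    ext i
    by_cases hi : i < D
    · have := congrFun (congrFun (LinearMap.mem_ker.1 hv) k) ⟨i, hi⟩
      simpa [L] using this
    · rw [coeff_eq_zero_of_natDegree_lt (lt_of_lt_of_le (hTd v k) (not_lt.1 hi)), coeff_zero]
  refine ⟨fun j => v.1 j, fun j => v.2 j, fun j => hnd _, fun j => hnd _, ?_, ?_⟩
  · by_contra hcon
    push Not at hcon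
    apply hv0
    ext j : 2
    · exact Subtype.ext (hcon j).1
    · exact Subtype.ext (hcon j).2
  · intro x hx
    apply X_sub_C_pow_dvd_of_hasseDeriv
    intro k hk
    have e1 := hE ⟨k, hk⟩
    have e2 := hE' ⟨k, hk⟩
    simp only at e1 e2
    rw [map_add, e1, e2, map_sum, map_sum]
    have h1 : l + c - k = (l - k) + c := by omega
    rw [h1, pow_add, mul_assoc, ← mul_add, eval_mul]
    have h2 := congrArg (eval x) (hT0 ⟨k, hk⟩)
    simp only [T, eval_finsetSum, eval_mul, eval_add, eval_pow, eval_X, eval_C, eval_zero] at h2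
    have h3 : eval x (∑ j : Fin J, E ⟨k, hk⟩ (C (x ^ (j : ℕ)) * (v.1 j : F[X])) +
        f ^ c * ∑ j : Fin J, E' ⟨k, hk⟩ (C (x ^ (j : ℕ)) * (v.2 j : F[X]))) = 0 := by
      simp only [← smul_eq_C_mul, map_smul]
      simp only [eval_add, eval_mul, eval_pow, hx, eval_finsetSum, eval_smul, smul_eq_mul]
      rw [Finset.mul_sum, ← Finset.sum_add_distrib, ← h2]
      refine Finset.sum_congr rfl fun j _ => ?_
      ring
    rw [h3, mul_zero]

/-- Stepanov's bound for the number of `x` with `f(x)^c = a`. -/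
theorem card_eval_pow_eq_mul_le {f : F[X]} (hodd : Odd f.natDegree) (h0 : f.eval 0 ≠ 0) (a : F)
    {c B J l : ℕ} (hc : Fintype.card F = 2 * c + 1) (hB0 : 0 < B)
    (hB : 2 * (B - 1) + f.natDegree < Fintype.card F) (hl : l ≤ Fintype.card F)
    (hdim : l * (B + J + l * f.natDegree) < 2 * (J * B)) [DecidableEq F] :
    l * (Finset.univ.filter fun x : F => f.eval x ^ c = a).card ≤
      (l + c) * f.natDegree + (B - 1) + (J - 1) * Fintype.card F := by
  have hf : f ≠ 0 := by rintro rfl; simp at h0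
  obtain ⟨r, s, hr, hs, hne, hdvd⟩ := exists_stepanov_coeffs (c := c) hf a hB0 hdim
  have hne' := stepanov_aux_ne_zero hodd h0 hc hB r s hr hs hne
  set q := Fintype.card F
  set R : F[X] := ∑ j : Fin J, (r j + f ^ c * s j) * X ^ ((j : ℕ) * q)
  have hR : f ^ l * R ≠ 0 := mul_ne_zero (pow_ne_zero _ hf) hne'
  have hRe : f ^ l * R = f ^ l * ∑ j : Fin J, X ^ ((j : ℕ) * q) * r j +
      f ^ (l + c) * ∑ j : Fin J, X ^ ((j : ℕ) * q) * s j := by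
    simp only [R, Finset.mul_sum]
    rw [← Finset.sum_add_distrib]
    refine Finset.sum_congr rfl fun j _ => ?_
    ring
  have hdvd' : ∀ x ∈ Finset.univ.filter (fun x : F => f.eval x ^ c = a),
      (X - C x) ^ l ∣ f ^ l * R := by
    intro x hx
    have hx' : f.eval x ^ c = a := by simpa using hx
    have h1 := hdvd x hx'
    have h2 : ∀ u : Fin J → F[X], (X - C x) ^ l ∣
        ∑ j : Fin J, X ^ ((j : ℕ) * q) * u j - ∑ j : Fin J, C (x ^ (j : ℕ)) * u j := by
      intro u
      rw [← Finset.sum_sub_distrib]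
      refine Finset.dvd_sum fun j _ => ?_
      rw [← sub_mul]
      exact dvd_mul_of_dvd_left (X_sub_C_pow_dvd_X_pow_sub_C x hl j) _
    have h3 : f ^ l * R = (f ^ l * ∑ j : Fin J, C (x ^ (j : ℕ)) * r j +
        f ^ (l + c) * ∑ j : Fin J, C (x ^ (j : ℕ)) * s j) +
        (f ^ l * (∑ j : Fin J, X ^ ((j : ℕ) * q) * r j - ∑ j : Fin J, C (x ^ (j : ℕ)) * r j) +
        f ^ (l + c) *
          (∑ j : Fin J, X ^ ((j : ℕ) * q) * s j - ∑ j : Fin J, C (x ^ (j : ℕ)) * s j)) := by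
      rw [hRe]; ring
    rw [h3]
    exact dvd_add h1 (dvd_add (dvd_mul_of_dvd_right (h2 r) _) (dvd_mul_of_dvd_right (h2 s) _))
  have hprod : ∏ x ∈ Finset.univ.filter (fun x : F => f.eval x ^ c = a), (X - C x) ^ l ∣
      f ^ l * R := by
    refine Finset.prod_dvd_of_coprime ?_ hdvd'
    intro x _ y _ hxy
    exact (isCoprime_X_sub_C_of_isUnit_sub (sub_ne_zero.2 hxy).isUnit).pow
  have h4 := natDegree_le_of_dvd hprod hR
  rw [natDegree_prod_of_monic _ _ (fun x _ => (monic_X_sub_C x).pow l)] at h4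
  simp only [natDegree_pow, natDegree_X_sub_C, mul_one, Finset.sum_const, smul_eq_mul] at h4
  rw [mul_comm] at h4
  refine h4.trans ?_
  have h5 : R.natDegree ≤ c * f.natDegree + (B - 1) + (J - 1) * q := by
    refine natDegree_sum_le_of_forall_le _ _ fun j _ => ?_
    refine natDegree_mul_le.trans ?_
    rw [natDegree_X_pow]
    refine add_le_add ?_ (Nat.mul_le_mul_right _ (by have := j.2; omega))
    refine natDegree_add_le_of_degree_le ((hr j).trans (Nat.le_add_left _ _)) ?_
    refine natDegree_mul_le.trans (add_le_add ?_ (hs j))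
    exact natDegree_pow_le
  refine natDegree_mul_le.trans ?_
  rw [natDegree_pow, add_mul]
  omega

theorem stepanov_dim_lt {q d l B k : ℕ} (hd1 : 1 ≤ d) (hl1 : l * l ≤ q) (hl3 : 100 * d ≤ l)
    (hB : q = 2 * B + d) (hk1 : 2 * k ≤ l) (hk2 : l ≤ 2 * k + 1) :
    l * (B + (k + 4 * d + 1) + l * d) < 2 * ((k + 4 * d + 1) * B) := by
  have e1 : l * B ≤ (2 * k + 1) * B := Nat.mul_le_mul_right _ hk2
  have e3 : l * (2 * k) ≤ l * l := Nat.mul_le_mul_left _ hk1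
  have e4 : l * l * d ≤ q * d := Nat.mul_le_mul_right _ hl1
  have e5 : l * (100 * d) ≤ l * l := Nat.mul_le_mul_left _ hl3
  have e6 : l * 100 ≤ l * l := Nat.mul_le_mul_left _ (by omega)
  have e7 : d * (100 * d) ≤ l * (100 * d) := Nat.mul_le_mul_right _ (by omega)
  have e8 : q * d = 2 * (d * B) + d * d := by rw [hB]; ring
  have e9 : q * 1 ≤ q * d := Nat.mul_le_mul_left _ hd1
  have e10 : 100 * d ≤ l * 100 := by omega
  linarith

theorem card_eval_pow_eq_le {f : F[X]} (hodd : Odd f.natDegree) (h0 : f.eval 0 ≠ 0) (a : F)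
    {c : ℕ} (hc : Fintype.card F = 2 * c + 1) (hq : 10000 * f.natDegree ^ 2 ≤ Fintype.card F)
    [DecidableEq F] :
    ((Finset.univ.filter fun x : F => f.eval x ^ c = a).card : ℝ) ≤
      Fintype.card F / 2 + 7 * f.natDegree * √(Fintype.card F) := by
  set q := Fintype.card F with hqdef
  set d := f.natDegree with hd
  set l := Nat.sqrt q with hl
  have hd1 : 1 ≤ d := hodd.pos
  have hl1 : l * l ≤ q := Nat.sqrt_le q
  have hl2 : q < (l + 1) * (l + 1) := Nat.lt_succ_sqrt q
  have hl3 : 100 * d ≤ l := by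
    rw [hl, Nat.le_sqrt]; nlinarith
  obtain ⟨e, he⟩ := hodd
  obtain ⟨B, hB⟩ : ∃ B, q = 2 * B + d := ⟨c - e, by
    have : d ≤ q := by nlinarith
    omega⟩
  have hB0 : 0 < B := by nlinarith
  obtain ⟨k, hk⟩ : ∃ k, k = l / 2 := ⟨_, rfl⟩
  have hk1 : 2 * k ≤ l := by omega
  have hk2 : l ≤ 2 * k + 1 := by omega
  have hdim : l * (B + (k + 4 * d + 1) + l * d) < 2 * ((k + 4 * d + 1) * B) :=
    stepanov_dim_lt hd1 hl1 hl3 hB hk1 hk2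
  have key := card_eval_pow_eq_mul_le (l := l) (J := k + 4 * d + 1) ⟨e, he⟩ h0 a hc hB0 (by omega)
    (by nlinarith) hdim
  set N := (Finset.univ.filter fun x : F => f.eval x ^ c = a).card
  have hsq : (√(q : ℝ)) ^ 2 = q := Real.sq_sqrt (by positivity)
  set t := √(q : ℝ)
  have ht0 : 0 ≤ t := Real.sqrt_nonneg _
  have hlt : (l : ℝ) ≤ t := by
    apply Real.le_sqrt_of_sq_le; rw [sq]; exact_mod_cast hl1
  have htl : t ≤ l + 1 := by
    apply Real.sqrt_le_iff.2 ⟨by positivity, ?_⟩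
    rw [sq]; exact_mod_cast hl2.le
  have key' : (l : ℝ) * N ≤ (l + c) * d + B + (k + 4 * d) * q := by
    have : l * N ≤ (l + c) * d + B + (k + 4 * d) * q := by
      refine key.trans ?_
      have : k + 4 * d + 1 - 1 = k + 4 * d := by omega
      rw [this]
      exact Nat.add_le_add_right (Nat.add_le_add_left (Nat.sub_le _ _) _) _
    exact_mod_cast this
  have hl3' : (100 : ℝ) * d ≤ l := by exact_mod_cast hl3
  have hd1' : (1 : ℝ) ≤ d := by exact_mod_cast hd1
  have hk1' : 2 * (k : ℝ) ≤ l := by exact_mod_cast hk1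
  have hc' : (q : ℝ) = 2 * c + 1 := by exact_mod_cast hc
  have hB' : (q : ℝ) = 2 * B + d := by exact_mod_cast hB
  have hlpos : (0 : ℝ) < l := by linarith
  have hqd : (0:ℝ) ≤ q := by positivity
  have : (l : ℝ) * N ≤ l * (q / 2 + 7 * d * t) := by
    refine key'.trans ?_
    have a1 : (c : ℝ) * d ≤ q / 2 * d := by nlinarith
    have a2 : (B : ℝ) ≤ q / 2 * d := by nlinarith
    have a3 : (k : ℝ) * q ≤ l * (q / 2) := by nlinarith
    have a4 : (l : ℝ) * d ≤ q * d / 10 := by nlinarith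
    have a5 : (q : ℝ) * d * 6 ≤ 7 * (l * t) * d := by
      have : (q : ℝ) * 6 ≤ 7 * (l * t) := by nlinarith
      nlinarith
    nlinarith
  exact le_of_mul_le_mul_left this hlpos

theorem abs_sum_quadraticChar_le [DecidableEq F] (hF : Odd (Fintype.card F)) {f : F[X]}
    (hodd : Odd f.natDegree) :
    |∑ a : F, (quadraticChar F (f.eval a) : ℝ)| ≤ 100 * f.natDegree * √(Fintype.card F) := by
  set q := Fintype.card F with hqdef
  set d := f.natDegree with hd
  have hd1 : 1 ≤ d := hodd.pos
  have hsq : (√(q : ℝ)) ^ 2 = q := Real.sq_sqrt (by positivity)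
  have ht0 : 0 ≤ √(q : ℝ) := Real.sqrt_nonneg _
  have hd1' : (1 : ℝ) ≤ d := by exact_mod_cast hd1
  have hq1' : (1 : ℝ) ≤ q := by exact_mod_cast Fintype.card_pos
  rcases lt_or_ge q (10000 * d ^ 2) with hq | hq
  · refine (Finset.abs_sum_le_sum_abs _ _).trans ?_
    have h1 : ∑ a : F, |(quadraticChar F (f.eval a) : ℝ)| ≤ ∑ a : F, 1 := by
      refine Finset.sum_le_sum fun a _ => ?_
      by_cases h : f.eval a = 0
      · simp [h]
      · rcases quadraticChar_dichotomy h with h | h <;> simp [h]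
    refine h1.trans ?_
    rw [Finset.sum_const, Finset.card_univ, nsmul_eq_mul, mul_one, ← hqdef]
    have : √(q : ℝ) ≤ 100 * d := by
      apply Real.sqrt_le_iff.2 ⟨by positivity, ?_⟩
      have : (q : ℝ) ≤ 10000 * d ^ 2 := by exact_mod_cast hq.le
      linarith
    nlinarith
  obtain ⟨c, hc⟩ := hF
  have hchar : ringChar F ≠ 2 := by
    intro h
    have := FiniteField.even_card_of_char_two h
    omega
  have hf : f ≠ 0 := by rintro rfl; simp [hd] at hd1
  have hdq : d < q := by nlinarith
  obtain ⟨x0, hx0⟩ : ∃ x0, f.eval x0 ≠ 0 := by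
    by_contra hcon
    push Not at hcon
    exact hf (eq_zero_of_natDegree_lt_card_of_eval_eq_zero' f Finset.univ (fun x _ => hcon x)
      (by rw [Finset.card_univ]; exact hdq))
  set g := f.comp (X + C x0) with hg
  have hgd : g.natDegree = d := by rw [hg, natDegree_comp, natDegree_X_add_C, mul_one]
  have hg0 : g.eval 0 ≠ 0 := by rw [hg, eval_comp]; simpa using hx0
  have hgn : g ≠ 0 := by rintro h; simp [h] at hg0
  have hsum : ∑ a : F, (quadraticChar F (f.eval a) : ℝ) =
      ∑ a : F, (quadraticChar F (g.eval a) : ℝ) := by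
    symm
    refine Fintype.sum_equiv (Equiv.addRight x0) _ _ fun a => ?_
    rw [hg, eval_comp]; simp
  rw [hsum]
  have hN : ∀ a, ((Finset.univ.filter fun x : F => g.eval x ^ c = a).card : ℝ) ≤
      q / 2 + 7 * d * √q := by
    intro a
    have := card_eval_pow_eq_le (f := g) (by rw [hgd]; exact hodd) hg0 a hc (by rw [hgd]; exact hq)
    rwa [hgd] at this
  have hNz : ((Finset.univ.filter fun x : F => g.eval x = 0).card : ℝ) ≤ d := by
    rw [← hgd]
    have : (Finset.univ.filter fun x : F => g.eval x = 0) ⊆ g.roots.toFinset := by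
      intro x hx; simpa [hgn] using hx
    exact_mod_cast (Finset.card_le_card this).trans
      ((Multiset.toFinset_card_le _).trans (card_roots' g))
  have hpt : ∀ x : F, (quadraticChar F (g.eval x) : ℝ) =
      (if g.eval x ^ c = 1 then 1 else 0) - (if g.eval x ^ c = -1 then 1 else 0) ∧
      (1 : ℝ) = (if g.eval x ^ c = 1 then 1 else 0) + (if g.eval x ^ c = -1 then 1 else 0) +
        if g.eval x = 0 then 1 else 0 := by
    intro x
    have h12 : (1 : F) ≠ -1 := fun h => (Ring.neg_one_ne_one_of_char_ne_two hchar) h.symm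
    have hc0 : c ≠ 0 := by rintro rfl; omega
    by_cases h : g.eval x = 0
    · simp [h, hc0]
    · have h2 := quadraticChar_eq_pow_of_char_ne_two' hchar (g.eval x)
      have hc2 : Fintype.card F / 2 = c := by omega
      rw [hc2] at h2
      rcases quadraticChar_dichotomy h with h3 | h3
      · rw [h3] at h2 ⊢
        simp only [Int.cast_one] at h2
        rw [← h2]; simp [h, h12]
      · rw [h3] at h2 ⊢
        simp only [Int.cast_neg, Int.cast_one] at h2
        rw [← h2]; simp [h, h12.symm]
  have hS := Finset.sum_congr (rfl : (Finset.univ : Finset F) = Finset.univ)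
    fun x _ => (hpt x).1
  have hT := Finset.sum_congr (rfl : (Finset.univ : Finset F) = Finset.univ)
    fun x _ => (hpt x).2
  simp only [Finset.sum_sub_distrib, Finset.sum_add_distrib, Finset.sum_boole] at hS hT
  rw [Finset.sum_const, Finset.card_univ, nsmul_eq_mul, mul_one, ← hqdef] at hT
  have h1 := hN 1
  have h2 := hN (-1)
  rw [hS, abs_le]
  have h3 : (1:ℝ) ≤ √q := by rw [Real.one_le_sqrt]; exact hq1'
  have h4 : (d : ℝ) ≤ d * √q := by nlinarith
  constructor <;> linarith

end Stepanov

section Resultant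

theorem pow_finRotate {M : Type*} [Monoid M] {d : ℕ} {x : M} (hx : x ^ d = 1) (i : Fin d) :
    x ^ (finRotate d i : ℕ) = x ^ ((i : ℕ) + 1) := by
  cases d with
  | zero => exact i.elim0
  | succ d =>
    rcases eq_or_ne i (Fin.last d) with rfl | h
    · simp [hx]
    · rw [coe_finRotate_of_ne_last h]

variable {F : Type*} [Field F]

theorem resultant_natDegree_eq {f g : F[X]} (hf : f.Monic) {N : ℕ} (h : g.natDegree ≤ N) :
    resultant f g f.natDegree N = resultant f g := by
  obtain ⟨k, rfl⟩ := Nat.exists_eq_add_of_le h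
  rw [resultant_add_right_deg _ _ _ _ _ le_rfl, coeff_natDegree, hf.leadingCoeff, one_pow, one_mul]

theorem resultant_congr_right {f g h : F[X]} (hf : f.Monic) (hd : f ∣ g - h) :
    resultant f g = resultant f h := by
  obtain ⟨p, hp⟩ := hd
  obtain rfl : g = h + f * p := by rw [← hp]; ring
  let N := max (h + f * p).natDegree (max h.natDegree (p.natDegree + f.natDegree))
  rw [← resultant_natDegree_eq hf (N := N) (le_max_left _ _),
    ← resultant_natDegree_eq hf (N := N) (le_max_of_le_right (le_max_left _ _)),
    resultant_add_mul_right _ _ _ _ _ (le_max_of_le_right (le_max_right _ _)) le_rfl]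

theorem resultant_mul_right_of_monic {f : F[X]} (hf : f.Monic) (g h : F[X]) :
    resultant f (g * h) = resultant f g * resultant f h := by
  rw [← resultant_natDegree_eq hf natDegree_mul_le, resultant_mul_right _ _ _ _ le_rfl]

theorem resultant_mul_left_of_monic {f g : F[X]} (hf : f.Monic) (hg : g.Monic) (h : F[X]) :
    resultant (f * g) h = resultant f h * resultant g h := by
  rw [hf.natDegree_mul hg, resultant_mul_left _ _ _ _ le_rfl]

/-- The discriminant of a monic polynomial, as a signed resultant with the derivative. -/
noncomputable def monicDiscr (g : F[X]) : F :=
  (-1) ^ g.natDegree.choose 2 * resultant g (derivative g)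

theorem choose_two_add (a b : ℕ) : (a + b).choose 2 = a.choose 2 + b.choose 2 + a * b := by
  induction b with
  | zero => simp
  | succ b ih =>
    rw [← add_assoc, Nat.choose_succ_succ' (a + b), Nat.choose_succ_succ' b, ih]
    simp; ring

theorem monicDiscr_mul {g h : F[X]} (hg : g.Monic) (hh : h.Monic) :
    monicDiscr (g * h) = monicDiscr g * monicDiscr h * resultant g h ^ 2 := by
  unfold monicDiscr
  rw [resultant_mul_left_of_monic hg hh, hg.natDegree_mul hh, choose_two_add,
    resultant_congr_right (f := g) (h := derivative g * h) hg ⟨derivative h, by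
      rw [derivative_mul]; ring⟩,
    resultant_congr_right (f := h) (h := derivative h * g) hh ⟨derivative g, by
      rw [derivative_mul]; ring⟩,
    resultant_mul_right_of_monic hg, resultant_mul_right_of_monic hh, resultant_comm h g,
    mul_comm h.natDegree]
  have : ((-1 : F) ^ (g.natDegree * h.natDegree)) * (-1) ^ (g.natDegree * h.natDegree) = 1 := by
    rw [← mul_pow]; simp
  rw [pow_add, pow_add]
  linear_combination ((-1) ^ g.natDegree.choose 2 * (-1) ^ h.natDegree.choose 2 *
    resultant g (derivative g) * resultant h (derivative h) * resultant g h ^ 2) * this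

theorem monicDiscr_one : monicDiscr (1 : F[X]) = 1 := by
  simp [monicDiscr]

/-- The discriminant of a product of linear factors. -/
theorem monicDiscr_prod_X_sub_C {d : ℕ} (v : Fin d → F) :
    monicDiscr (∏ i, (X - C (v i))) = (Matrix.vandermonde v).det ^ 2 := by
  classical
  have hm : (∏ i, (X - C (v i))).Monic := monic_prod_of_monic _ _ fun i _ => monic_X_sub_C _
  have hdeg : (∏ i, (X - C (v i))).natDegree = d := by
    rw [natDegree_prod_of_monic _ _ fun i _ => monic_X_sub_C _]; simp
  have hres : ∀ g : F[X], resultant (∏ i, (X - C (v i))) g = ∏ i, g.eval (v i) := by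
    intro g
    rw [resultant_prod_left _ _ _ _ (by simp) le_rfl]
    refine Finset.prod_congr rfl fun i _ => ?_
    simp
  have hder : ∀ i, (derivative (∏ i, (X - C (v i)))).eval (v i) = ∏ j ∈ {i}ᶜ, (v i - v j) := by
    intro i
    rw [derivative_prod_finset, eval_finsetSum, Finset.sum_eq_single i]
    · simp [eval_prod, Finset.compl_eq_univ_sdiff, Finset.sdiff_singleton_eq_erase]
    · intro b _ hb
      rw [eval_mul, eval_prod, Finset.prod_eq_zero (i := i)]
      · simp
      · simp [hb.symm]
      · simp
    · simp
  rw [monicDiscr, hres, hdeg, Matrix.det_vandermonde]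
  simp_rw [hder]
  rw [← Finset.prod_prod_Ioi_mul_eq_prod_prod_off_diag (fun i j => v j - v i), ← Finset.prod_pow]
  have hcard : ∑ i : Fin d, (Finset.Ioi i).card = d.choose 2 := by
    simp_rw [Fin.card_Ioi]
    rw [Fin.sum_univ_eq_sum_range (fun i => d - 1 - i), Finset.sum_range_reflect (fun i => i) d,
      Finset.sum_range_id, Nat.choose_two_right]
  rw [← hcard, ← Finset.prod_pow_eq_pow_sum, ← Finset.prod_mul_distrib]
  refine Finset.prod_congr rfl fun i _ => ?_
  rw [← Finset.prod_const, ← Finset.prod_mul_distrib, ← Finset.prod_pow]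
  refine Finset.prod_congr rfl fun j _ => ?_
  ring

theorem map_monicDiscr {K : Type*} [Field K] (φ : F →+* K) {g : F[X]} (hg : g.Monic) :
    monicDiscr (g.map φ) = φ (monicDiscr g) := by
  have h := resultant_natDegree_eq (hg.map φ) (natDegree_map_le (p := derivative g) (f := φ))
  rw [natDegree_map, resultant_map_map] at h
  rw [monicDiscr, monicDiscr, natDegree_map, derivative_map, map_mul, map_pow, map_neg, map_one, h]

variable [Fintype F] [DecidableEq F]

/-- Stickelberger: the quadratic character of the discriminant of an irreducible polynomial. -/
theorem quadraticChar_monicDiscr_of_irreducible (hchar : ringChar F ≠ 2) {P : F[X]}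
    (hP : P.Monic) (hirr : Irreducible P) :
    quadraticChar F (monicDiscr P) = (-1) ^ (P.natDegree - 1) := by
  have := Fact.mk hirr
  let K := AdjoinRoot P
  let pb := AdjoinRoot.powerBasis hirr.ne_zero
  have : FiniteDimensional F K := pb.finite
  have : Finite K := Module.finite_of_finite F
  set d := P.natDegree with hd
  have hd0 : 0 < d := hirr.natDegree_pos
  have hfr : Module.finrank F K = d := by rw [pb.finrank, AdjoinRoot.powerBasis_dim]
  set q := Fintype.card F with hq
  let α : K := AdjoinRoot.root P
  let φ : K →ₐ[F] K := FiniteField.frobeniusAlgHom F K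
  have hφ : ∀ x, φ x = x ^ q := fun x => rfl
  have hφi : ∀ (i : ℕ) x, (φ ^ i) x = x ^ (q ^ i) := by
    intro i x
    rw [AlgHom.coe_pow]
    show (fun x => x ^ q)^[i] x = _
    rw [pow_iterate]
  let v : Fin d → K := fun i => (φ ^ (i : ℕ)) α
  have hPα : aeval α P = 0 := by rw [AdjoinRoot.aeval_eq, AdjoinRoot.mk_self]
  have hvinj : Function.Injective v := by
    intro i j hij
    have h1 : φ ^ (i : ℕ) = φ ^ (j : ℕ) := AdjoinRoot.algHom_ext hij
    have h2 := (FiniteField.bijective_frobeniusAlgHom_pow F K).1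
      (a₁ := Fin.cast hfr.symm i) (a₂ := Fin.cast hfr.symm j) h1
    simpa [Fin.ext_iff] using h2
  have hvroot : ∀ i, aeval (v i) P = 0 := fun i => by
    rw [aeval_algHom_apply, hPα, map_zero]
  have hmap : P.map (algebraMap F K) = ∏ i, (X - C (v i)) := by
    refine eq_of_monic_of_dvd_of_natDegree_le
      (monic_prod_of_monic _ _ fun i _ => monic_X_sub_C _) (hP.map (algebraMap F K)) ?_ ?_
    · refine Finset.prod_dvd_of_coprime ?_ fun i _ => ?_
      · intro i _ j _ hij
        exact isCoprime_X_sub_C_of_isUnit_sub (sub_ne_zero.2 (hvinj.ne hij)).isUnit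
      · rw [dvd_iff_isRoot, IsRoot.def, eval_map_algebraMap, hvroot]
    · rw [natDegree_map, natDegree_prod_of_monic _ _ fun i _ => monic_X_sub_C _]; simp [hd]
  have hdisc : algebraMap F K (monicDiscr P) = (Matrix.vandermonde v).det ^ 2 := by
    rw [← map_monicDiscr _ hP, hmap, monicDiscr_prod_X_sub_C]
  set δ := (Matrix.vandermonde v).det with hδ
  have hδ0 : δ ≠ 0 := Matrix.det_vandermonde_ne_zero_iff.2 hvinj
  have hfrob : δ ^ q = (-1) ^ (d - 1) * δ := by
    rw [← hφ, hδ]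
    change (φ : K →+* K) _ = _
    rw [RingHom.map_det]
    have h1 : (φ : K →+* K).mapMatrix (Matrix.vandermonde v) =
        (Matrix.vandermonde v).submatrix (finRotate d) id := by
      ext i j
      simp only [RingHom.mapMatrix_apply, Matrix.map_apply, Matrix.vandermonde_apply,
        Matrix.submatrix_apply, id]
      rw [map_pow]
      congr 1
      show φ (v i) = v _
      simp only [v]
      rw [pow_finRotate (hfr ▸ FiniteField.orderOf_frobeniusAlgHom F K ▸ pow_orderOf_eq_one φ),
        pow_succ']
      rfl
    rw [h1, Matrix.det_permute, sign_finRotate]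
    simp
  have hδq : δ ^ (q - 1) = (-1) ^ (d - 1) := by
    have hq0 : 0 < q := Fintype.card_pos
    have : δ ^ (q - 1) * δ = (-1) ^ (d - 1) * δ := by
      rw [← pow_succ, Nat.sub_add_cancel hq0, hfrob]
    exact mul_right_cancel₀ hδ0 this
  have hD0 : monicDiscr P ≠ 0 := by
    intro h0
    rw [h0, map_zero] at hdisc
    exact pow_ne_zero 2 hδ0 hdisc.symm
  have hodd : q % 2 = 1 := FiniteField.odd_card_of_char_ne_two hchar
  have h3 := congrArg (algebraMap F K) (quadraticChar_eq_pow_of_char_ne_two' hchar (monicDiscr P))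
  rw [map_pow, hdisc, ← pow_mul, show 2 * (Fintype.card F / 2) = q - 1 by omega, hδq] at h3
  have hne : (-1 : K) ≠ 1 := by
    apply Ring.neg_one_ne_one_of_char_ne_two
    rwa [← Algebra.ringChar_eq F K]
  rcases quadraticChar_dichotomy hD0 with h | h <;> rw [h] at h3 ⊢ <;>
    rcases Nat.even_or_odd (d - 1) with h' | h' <;> rw [h'.neg_one_pow] at h3 ⊢
  · simp only [Int.cast_one, map_one] at h3
    exact absurd h3.symm hne
  · simp only [Int.cast_one, map_one, Int.cast_neg, map_neg] at h3
    exact absurd h3 hne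

end Resultant

section Mob

variable {F : Type*} [Field F] [DecidableEq F]

theorem mem_primeFactors_iff {g P : F[X]} (hg : g ≠ 0) :
    P ∈ primeFactors g ↔ P.Monic ∧ Irreducible P ∧ P ∣ g := by
  rw [mem_primeFactors, mem_normalizedFactors_iff' hg]
  constructor
  · rintro ⟨h1, h2, h3⟩
    exact ⟨h2 ▸ monic_normalize h1.ne_zero, h1, h3⟩
  · rintro ⟨h1, h2, h3⟩
    exact ⟨h2, h1.normalize_eq_self, h3⟩

theorem prod_primeFactors {g : F[X]} (hg : g.Monic) (hs : Squarefree g) :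
    ∏ P ∈ primeFactors g, P = g := by
  have h1 : (primeFactors g).val = normalizedFactors g :=
    primeFactors_val_eq_normalizedFactors hs.isRadical
  have h2 := prod_normalizedFactors_eq hg.ne_zero
  rw [hg.normalize_eq_self, ← h1] at h2
  exact (Finset.prod_val _).symm.trans h2

open scoped Classical in
/-- The Möbius function on polynomials. -/
noncomputable def mob (g : F[X]) : ℤ :=
  if Squarefree g then (-1) ^ (primeFactors g).card else 0

theorem mob_mul {g h : F[X]} (hgh : IsCoprime g h) : mob (g * h) = mob g * mob h := by
  classical
  unfold mob
  rw [squarefree_mul_iff]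
  have := primeFactors_mul_eq_disjUnion hgh.isRelPrime
  by_cases h1 : Squarefree g <;> by_cases h2 : Squarefree h
  · rw [if_pos ⟨hgh.isRelPrime, h1, h2⟩, if_pos h1, if_pos h2, this, Finset.card_disjUnion, pow_add]
  all_goals simp [h1, h2]

theorem mob_irreducible {P : F[X]} (hm : P.Monic) (hP : Irreducible P) : mob P = -1 := by
  have : primeFactors P = {P} := by
    ext Q
    rw [mem_primeFactors_iff hP.ne_zero, Finset.mem_singleton]
    constructor
    · rintro ⟨h1, h2, h3⟩
      exact eq_of_monic_of_associated h1 hm (h2.associated_of_dvd hP h3)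
    · rintro rfl
      exact ⟨hm, hP, dvd_rfl⟩
  simp [mob, hP.squarefree, this]

theorem mob_one : mob (1 : F[X]) = 1 := by
  simp [mob]

theorem mob_sq {g : F[X]} (hs : Squarefree g) : mob g ^ 2 = 1 := by
  simp [mob, hs, ← pow_mul, mul_comm _ 2]

theorem mob_eq_one_or {g : F[X]} (hs : Squarefree g) : mob g = 1 ∨ mob g = -1 :=
  mul_self_eq_one_iff.1 (by rw [← sq, mob_sq hs])

theorem mob_of_not_squarefree {g : F[X]} (hs : ¬ Squarefree g) : mob g = 0 := by
  simp [mob, hs]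

variable [Fintype F]

omit [DecidableEq F] in
theorem squarefree_iff_isCoprime_derivative {g : F[X]} :
    Squarefree g ↔ IsCoprime g (derivative g) := by
  rw [← PerfectField.separable_iff_squarefree]; rfl

/-- Pellet's formula. -/
theorem mob_eq_quadraticChar (hchar : ringChar F ≠ 2) {g : F[X]} (hg : g.Monic) :
    mob g = (-1) ^ g.natDegree * quadraticChar F (monicDiscr g) := by
  by_cases hs : Squarefree g
  · induction hn : g.natDegree using Nat.strong_induction_on generalizing g with
    | _ n ih =>
      subst hn
      by_cases h0 : g.natDegree = 0
      · rw [hg.natDegree_eq_zero.1 h0]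
        simp [mob_one, monicDiscr_one]
      · obtain ⟨P, hPm, hP, h, rfl⟩ := exists_monic_irreducible_factor g
          (fun hu => h0 (natDegree_eq_zero_of_isUnit hu))
        have hh : h.Monic := hPm.of_mul_monic_left hg
        obtain ⟨hrel, hsP, hsh⟩ := squarefree_mul_iff.1 hs
        have hco : IsCoprime P h := hrel.isCoprime
        have hPd := hP.natDegree_pos
        have hlt : h.natDegree < (P * h).natDegree := by
          rw [hPm.natDegree_mul hh]; omega
        rw [mob_mul hco, mob_irreducible hPm hP, ih _ hlt hh hsh rfl, monicDiscr_mul hPm hh,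
          map_mul, map_mul, map_pow, quadraticChar_sq_one (resultant_ne_zero _ _ hco),
          quadraticChar_monicDiscr_of_irreducible hchar hPm hP, hPm.natDegree_mul hh]
        obtain ⟨e, he⟩ : ∃ e, P.natDegree = e + 1 := ⟨P.natDegree - 1, by omega⟩
        rw [he, Nat.add_sub_cancel, pow_add, pow_add]
        have : ((-1 : ℤ) ^ e) * (-1) ^ e = 1 := by rw [← mul_pow]; simp
        linear_combination ((-1) ^ h.natDegree * quadraticChar F (monicDiscr h)) * this
  · have : resultant g (derivative g) = 0 := by
      rw [resultant_eq_zero_iff]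
      exact ⟨Or.inl hg.ne_zero, fun h => hs (squarefree_iff_isCoprime_derivative.2 h)⟩
    rw [mob_of_not_squarefree hs, monicDiscr, this]
    simp

end Mob

section Lines

variable {F : Type*} [Field F] [DecidableEq F]

theorem card_primeFactors_le {K : F[X]} (hK : K ≠ 0) : (primeFactors K).card ≤ K.natDegree := by
  have h1 : radical K ∣ K := radical_dvd_self
  have h2 := natDegree_le_of_dvd h1 hK
  have h3 : (radical K).natDegree = ∑ P ∈ primeFactors K, P.natDegree := by
    rw [radical, natDegree_prod_of_monic]
    · rfl
    · intro P hP
      exact ((mem_primeFactors_iff hK).1 hP).1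
  rw [h3] at h2
  refine le_trans ?_ h2
  rw [Finset.card_eq_sum_ones]
  exact Finset.sum_le_sum fun P hP => ((mem_primeFactors_iff hK).1 hP).2.1.natDegree_pos

theorem exists_monic_irreducible_of_not_isCoprime {g K : F[X]} (hK : K ≠ 0)
    (h : ¬ IsCoprime g K) : ∃ P ∈ primeFactors K, P ∣ g := by
  by_contra hcon
  push Not at hcon
  refine h (isCoprime_of_irreducible_dvd (by tauto) fun P hP hPg hPK => ?_)
  refine hcon (normalize P) ?_ ((normalize_associated P).dvd.trans hPg)
  rw [mem_primeFactors_iff hK]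
  exact ⟨monic_normalize hP.ne_zero, (normalize_associated P).irreducible_iff.2 hP,
    (normalize_associated P).dvd.trans hPK⟩

variable [Fintype F]

open scoped Classical in
/-- Along a line in a direction coprime to its origin, few points share a factor with `K`. -/
theorem card_not_isCoprime_line_le {U V K : F[X]} (hUV : IsCoprime U V) (hK : K ≠ 0) :
    (Finset.univ.filter fun a : F => ¬ IsCoprime (U + C a * V) K).card ≤ K.natDegree := by
  refine le_trans ?_ (card_primeFactors_le hK)
  choose! φ hφ1 hφ2 using fun a (ha : ¬ IsCoprime (U + C a * V) K) =>
    exists_monic_irreducible_of_not_isCoprime hK ha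
  refine Finset.card_le_card_of_injOn φ (fun a ha => hφ1 a (by simpa using ha)) ?_
  intro a ha b hb hab
  have ha' : ¬ IsCoprime (U + C a * V) K := by simpa using ha
  have hb' : ¬ IsCoprime (U + C b * V) K := by simpa using hb
  by_contra hne
  have hirr := ((mem_primeFactors_iff hK).1 (hφ1 a ha')).2.1
  have h1 := hφ2 a ha'
  have h2 := hφ2 b hb'
  rw [← hab] at h2
  have h3 : φ a ∣ C (a - b) * V := by
    have := dvd_sub h1 h2
    convert this using 1
    rw [C_sub]; ring
  have h4 : φ a ∣ V :=
    (isUnit_C.2 (sub_ne_zero.2 hne).isUnit).dvd_mul_left.1 h3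
  have h5 : φ a ∣ U := (dvd_add_left (dvd_mul_of_dvd_right h4 _)).1 h1
  exact hirr.not_isUnit (hUV.isUnit_of_dvd' h5 h4)

omit [Fintype F] [DecidableEq F] in
theorem natDegree_resultant_line_of_splits {W g M : F[X]} (hW : W.Splits) (hWM : IsCoprime W M)
    (hW0 : W ≠ 0) {n : ℕ} (hg : g.natDegree ≤ n) (hM : M.natDegree ≤ n) :
    (resultant (W.map C) (g.map C + C X * M.map C) W.natDegree n).natDegree = W.natDegree := by
  have h1 : (W.map (C : F →+* F[X])).natDegree = W.natDegree :=
    natDegree_map_eq_of_injective C_injective _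
  have h2 : (g.map C + C X * M.map C : F[X][X]).natDegree ≤ n :=
    natDegree_add_le_of_degree_le (natDegree_map_le.trans hg)
      ((natDegree_C_mul_le _ _).trans (natDegree_map_le.trans hM))
  have h3 := resultant_eq_prod_eval (W.map (C : F →+* F[X])) _ n h2 (hW.map C)
  rw [h1] at h3
  rw [h3, leadingCoeff_map_of_injective C_injective, ← C_pow, natDegree_C_mul (pow_ne_zero _ (leadingCoeff_ne_zero.2 hW0)),
    hW.roots_map, Multiset.map_map]
  have h4 : ∀ ω ∈ W.roots, (eval (C ω) (g.map C + C X * M.map C : F[X][X])).natDegree = 1 := by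
    intro ω hω
    have hMω : M.eval ω ≠ 0 := by
      intro h0
      have h5 : X - C ω ∣ M := dvd_iff_isRoot.2 h0
      have h6 : X - C ω ∣ W := dvd_iff_isRoot.2 ((mem_roots hW0).1 hω)
      exact (irreducible_X_sub_C ω).not_isUnit (hWM.isUnit_of_dvd' h6 h5)
    rw [eval_add, eval_mul, eval_C, eval_map, eval_map, eval₂_hom, eval₂_hom, add_comm, X_mul_C]
    exact natDegree_linear hMω
  rw [natDegree_multiset_prod]
  · rw [Multiset.map_map, Multiset.map_congr rfl (g := fun _ => 1)]
    · simp [hW.natDegree_eq_card_roots]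
    · intro ω hω
      exact h4 ω hω
  · intro hmem
    obtain ⟨ω, hω, h0⟩ := Multiset.mem_map.1 hmem
    have := h4 ω hω
    simp only [Function.comp] at h0
    rw [h0] at this
    simp at this

omit [Fintype F] [DecidableEq F] in
theorem natDegree_resultant_line {W g M : F[X]} (hWM : IsCoprime W M)
    (hW0 : W ≠ 0) {n : ℕ} (hg : g.natDegree ≤ n) (hM : M.natDegree ≤ n) :
    (resultant (W.map C) (g.map C + C X * M.map C) W.natDegree n).natDegree = W.natDegree := by
  let K := AlgebraicClosure F
  let ι := algebraMap F K
  have h := natDegree_resultant_line_of_splits (W := W.map ι) (g := g.map ι) (M := M.map ι)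
    (IsAlgClosed.splits _) (hWM.map (mapRingHom ι)) ((Polynomial.map_ne_zero_iff ι.injective).2 hW0)
    (n := n) (natDegree_map_le.trans hg) (natDegree_map_le.trans hM)
  rw [natDegree_map] at h
  rw [← h, ← natDegree_map ι, ← coe_mapRingHom ι, ← resultant_map_map]
  congr 2
  · ext; simp [coeff_map]
  · ext; simp [coeff_map]

omit [Fintype F] [DecidableEq F] in
theorem eval_resultant_line {W g M : F[X]} {m n : ℕ} (a : F) :
    (resultant (W.map C) (g.map C + C X * M.map C) m n).eval a =
      resultant W (g + C a * M) m n := by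
  rw [← coe_evalRingHom, ← resultant_map_map]
  congr 1
  · rw [map_map]; simp [evalRingHom]
  · rw [Polynomial.map_add, Polynomial.map_mul, map_map, map_map]; simp [evalRingHom]

omit [Fintype F] [DecidableEq F] in
theorem natDegree_wronskian_eq {g M : F[X]} (hg : g.Monic) (hM : M ≠ 0)
    (hlt : M.natDegree < g.natDegree) (hne : (g.natDegree : F) - M.natDegree ≠ 0) :
    derivative g * M - g * derivative M ≠ 0 ∧
    (derivative g * M - g * derivative M).natDegree + 1 = g.natDegree + M.natDegree := by
  have hle : (derivative g * M - g * derivative M).natDegree ≤ g.natDegree - 1 + M.natDegree := by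
    refine (natDegree_sub_le _ _).trans (max_le ?_ ?_)
    · exact natDegree_mul_le.trans (add_le_add (natDegree_derivative_le g) le_rfl)
    · by_cases h0 : M.natDegree = 0
      · rw [derivative_of_natDegree_zero h0]; simp
      · refine natDegree_mul_le.trans ?_
        have := natDegree_derivative_le M
        omega
  have hco : (derivative g * M - g * derivative M).coeff (g.natDegree - 1 + M.natDegree) =
      ((g.natDegree : F) - M.natDegree) * M.leadingCoeff := by
    rw [coeff_sub, coeff_mul_add_eq_of_natDegree_le (natDegree_derivative_le g) le_rfl, coeff_derivative,
      Nat.sub_add_cancel (by omega), coeff_natDegree, coeff_natDegree, hg.leadingCoeff]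
    have h1 : ((g.natDegree - 1 : ℕ) : F) + 1 = g.natDegree := by
      rw [← Nat.cast_succ]; congr 1; omega
    rw [h1]
    by_cases h0 : M.natDegree = 0
    · rw [derivative_of_natDegree_zero h0, h0]; simp
    · have h2 : g.natDegree - 1 + M.natDegree = g.natDegree + (M.natDegree - 1) := by omega
      rw [h2, coeff_mul_add_eq_of_natDegree_le le_rfl (natDegree_derivative_le M), coeff_derivative,
        Nat.sub_add_cancel (by omega), coeff_natDegree, coeff_natDegree, hg.leadingCoeff]
      have h3 : ((M.natDegree - 1 : ℕ) : F) + 1 = M.natDegree := by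
        rw [← Nat.cast_succ]; congr 1; omega
      rw [h3]; ring
  have hco0 := hco ▸ mul_ne_zero hne (leadingCoeff_ne_zero.2 hM)
  have := le_natDegree_of_ne_zero hco0
  refine ⟨fun h0 => hco0 (by rw [h0, coeff_zero]), by omega⟩

omit [DecidableEq F] in
theorem isCoprime_wronskian {g M : F[X]} (hgM : IsCoprime g M) (hM : Squarefree M) :
    IsCoprime (derivative g * M - g * derivative M) M := by
  have h1 : IsCoprime (g * derivative M) M :=
    hgM.mul_left (squarefree_iff_isCoprime_derivative.1 hM).symm
  have : derivative g * M - g * derivative M = -(g * derivative M) + derivative g * M := by ring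
  rw [this]
  exact (IsCoprime.neg_left h1).add_mul_right_left _

omit [DecidableEq F] [Fintype F] in
theorem monic_line {g M : F[X]} (hg : g.Monic) (hlt : M.natDegree < g.natDegree) (a : F) :
    (g + C a * M).Monic ∧ (g + C a * M).natDegree = g.natDegree := by
  have h : (C a * M).natDegree < g.natDegree := (natDegree_C_mul_le _ _).trans_lt hlt
  exact ⟨hg.add_of_left (degree_lt_degree h), natDegree_add_eq_left_of_natDegree_lt h⟩

/-- Along a line, the Möbius function is given by a quadratic character, in the coprime case. -/
theorem exists_line_poly_of_isCoprime (hchar : ringChar F ≠ 2) {g M : F[X]} (hg : g.Monic)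
    (hM : M.Monic) (hMs : Squarefree M) (hgM : IsCoprime g M) (hlt : M.natDegree < g.natDegree)
    (hne : (g.natDegree : F) - M.natDegree ≠ 0) :
    ∃ (P : F[X]) (κ : ℤ), P ≠ 0 ∧ (κ = 1 ∨ κ = -1) ∧ P.natDegree + 1 = g.natDegree + M.natDegree ∧
      ∀ a : F, mob (g + C a * M) = κ * quadraticChar F (P.eval a) := by
  obtain ⟨hW0, hWd⟩ := natDegree_wronskian_eq hg hM.ne_zero hlt hne
  have hWM := isCoprime_wronskian hgM hMs
  set W := derivative g * M - g * derivative M with hW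
  let P := resultant (W.map C) (g.map C + C X * M.map C) W.natDegree g.natDegree
  have hPd : P.natDegree = W.natDegree := natDegree_resultant_line hWM hW0 le_rfl hlt.le
  set R := resultant M g with hR
  have hR0 : R ≠ 0 := ((isUnit_resultant_iff_isCoprime hM).2 hgM.symm).ne_zero
  have hχ : ∀ k : ℕ, quadraticChar F ((-1) ^ k) = 1 ∨ quadraticChar F ((-1) ^ k) = -1 := fun k =>
    quadraticChar_dichotomy (pow_ne_zero _ (neg_ne_zero.2 one_ne_zero))
  obtain ⟨κ, hκ, hκe⟩ : ∃ κ : ℤ, (κ = 1 ∨ κ = -1) ∧ κ = (-1) ^ g.natDegree *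
      quadraticChar F ((-1) ^ (g.natDegree.choose 2)) *
      quadraticChar F ((-1) ^ (g.natDegree * M.natDegree)) * quadraticChar F R *
      quadraticChar F ((-1) ^ (g.natDegree * W.natDegree)) := by
    refine ⟨_, ?_, rfl⟩
    rcases neg_one_pow_eq_or ℤ g.natDegree with h1 | h1 <;>
    rcases hχ (g.natDegree.choose 2) with h2 | h2 <;>
    rcases hχ (g.natDegree * M.natDegree) with h3 | h3 <;>
    rcases quadraticChar_dichotomy hR0 with h4 | h4 <;>
    rcases hχ (g.natDegree * W.natDegree) with h5 | h5 <;>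
    rw [h1, h2, h3, h4, h5] <;> norm_num
  have hP0 : P ≠ 0 := by
    by_cases h0 : W.natDegree = 0
    · obtain ⟨c, hc⟩ := natDegree_eq_zero.1 h0
      have hc0 : c ≠ 0 := by rintro rfl; exact hW0 (by rw [← hc, C_0])
      have : P = C c ^ g.natDegree := by
        simp only [P]
        rw [h0, ← hc, map_C, resultant_C_zero_left]
      rw [this]
      exact pow_ne_zero _ (C_ne_zero.2 hc0)
    · exact ne_zero_of_natDegree_gt (n := 0) (by omega)
  refine ⟨P, κ, hP0, hκ, by rw [hPd, hWd], fun a => ?_⟩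
  obtain ⟨hGm, hGd⟩ := monic_line hg hlt a
  have hP : P.eval a = resultant W (g + C a * M) W.natDegree g.natDegree := eval_resultant_line a
  set G := g + C a * M with hG
  have h1 : resultant G W = (-1) ^ (g.natDegree * W.natDegree) * P.eval a := by
    rw [resultant_comm, hGd, hP]
  have h2 : resultant G W = resultant G (derivative G) * resultant G M := by
    rw [← resultant_mul_right_of_monic hGm]
    refine resultant_congr_right hGm ⟨-derivative M, ?_⟩
    rw [hW, hG]
    simp only [derivative_add, derivative_mul, derivative_C]
    ring
  have h3 : resultant G M = (-1) ^ (g.natDegree * M.natDegree) * R := by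
    rw [resultant_comm, hGd, hR, resultant_natDegree_eq hM hGd.le]
    congr 1
    exact resultant_congr_right hM ⟨C a, by rw [hG]; ring⟩
  have h7 : G.natDegree.choose 2 = g.natDegree.choose 2 := by rw [hGd]
  have h8 : (-1 : ℤ) ^ G.natDegree = (-1) ^ g.natDegree := by rw [hGd]
  rw [mob_eq_quadraticChar hchar hGm, monicDiscr, h7, h8, map_mul, hκe]
  have h4 := congrArg (quadraticChar F) (h2.symm.trans h1)
  rw [h3, map_mul, map_mul, map_mul] at h4
  have h5 := quadraticChar_sq_one hR0
  have h6 : quadraticChar F ((-1) ^ (g.natDegree * M.natDegree)) ^ 2 = 1 :=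
    quadraticChar_sq_one (pow_ne_zero _ (neg_ne_zero.2 one_ne_zero))
  set e := quadraticChar F ((-1) ^ (g.natDegree * M.natDegree))
  set r := quadraticChar F R
  linear_combination (-1) ^ g.natDegree * quadraticChar F ((-1) ^ (g.natDegree.choose 2)) *
    (e * r * h4 - quadraticChar F (resultant G (derivative G)) * (r ^ 2 * h6 + h5))

omit [DecidableEq F] [Fintype F] in
theorem exists_monic_gcd {g : F[X]} (hg : g ≠ 0) (M : F[X]) :
    ∃ E g1 M1 : F[X], E.Monic ∧ g = E * g1 ∧ M = E * M1 ∧ IsCoprime g1 M1 := by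
  classical
  let e := EuclideanDomain.gcd g M
  have he : e ≠ 0 := fun h => hg (EuclideanDomain.gcd_eq_zero_iff.1 h).1
  have hu : e.leadingCoeff ≠ 0 := leadingCoeff_ne_zero.2 he
  have hinv : C e.leadingCoeff⁻¹ * C e.leadingCoeff = 1 := by
    rw [← C_mul, inv_mul_cancel₀ hu, C_1]
  have h1 : e * (g / e) = g := EuclideanDomain.mul_div_cancel' he (EuclideanDomain.gcd_dvd_left _ _)
  have h2 : e * (M / e) = M :=
    EuclideanDomain.mul_div_cancel' he (EuclideanDomain.gcd_dvd_right _ _)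
  refine ⟨e * C e.leadingCoeff⁻¹, C e.leadingCoeff * (g / e), C e.leadingCoeff * (M / e),
    monic_mul_leadingCoeff_inv he, ?_, ?_, ?_⟩
  · linear_combination -h1 - e * (g / e) * hinv
  · linear_combination -h2 - e * (M / e) * hinv
  · rw [isCoprime_mul_unit_left (isUnit_C.2 hu.isUnit)]
    refine ⟨EuclideanDomain.gcdA g M, EuclideanDomain.gcdB g M, mul_left_cancel₀ he ?_⟩
    linear_combination EuclideanDomain.gcdA g M * h1 + EuclideanDomain.gcdB g M * h2 -
      EuclideanDomain.gcd_eq_gcd_ab g M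

open scoped Classical in
/-- Along a line, the Möbius function is given by a quadratic character up to few exceptions. -/
theorem exists_line_poly (hchar : ringChar F ≠ 2) {g M : F[X]} (hg : g.Monic)
    (hM : M.Monic) (hMs : Squarefree M) (hlt : M.natDegree < g.natDegree)
    (hne : (g.natDegree : F) - M.natDegree ≠ 0) :
    ∃ (P : F[X]) (κ : ℤ) (k : ℕ), P ≠ 0 ∧ (κ = 1 ∨ κ = -1) ∧
      P.natDegree + 2 * k + 1 = g.natDegree + M.natDegree ∧
      (Finset.univ.filter fun a : F =>
        mob (g + C a * M) ≠ κ * quadraticChar F (P.eval a)).card ≤ M.natDegree := by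
  obtain ⟨E, g1, M1, hEm, rfl, rfl, hco⟩ := exists_monic_gcd hg.ne_zero M
  have hg1 : g1.Monic := hEm.of_mul_monic_left hg
  have hM1 : M1.Monic := hEm.of_mul_monic_left hM
  rw [hEm.natDegree_mul hg1, hEm.natDegree_mul hM1] at *
  obtain ⟨P, κ, hP0, hκ, hP, h⟩ := exists_line_poly_of_isCoprime hchar hg1 hM1
    (hMs.squarefree_of_dvd (dvd_mul_left _ _)) hco (by omega) (by push_cast at hne; simpa using hne)
  have hE := mob_eq_one_or (hMs.squarefree_of_dvd (dvd_mul_right E M1))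
  refine ⟨P, mob E * κ, E.natDegree, hP0, ?_, by omega, ?_⟩
  · rcases hE with h1 | h1 <;> rcases hκ with h2 | h2 <;> rw [h1, h2] <;> norm_num
  · refine le_trans (Finset.card_le_card ?_)
      ((card_not_isCoprime_line_le hco hEm.ne_zero).trans (Nat.le_add_right _ _))
    intro a ha
    rw [Finset.mem_filter] at ha ⊢
    refine ⟨ha.1, fun hc => ha.2 ?_⟩
    rw [mul_assoc, ← h a, ← mob_mul hc.symm]
    congr 1
    ring

end Lines

section Counting

variable {F : Type*} [Field F] [Fintype F]

/-- An equivalence between monic polynomials of degree `m` and coefficient vectors. -/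
noncomputable def monicEquivFun (F : Type*) [Field F] (m : ℕ) :
    {p : F[X] // p.Monic ∧ p.natDegree = m} ≃ (Fin m → F) :=
  (monicEquivDegreeLT m).trans (degreeLTEquiv F m).toEquiv

theorem finite_monics (F : Type*) [Field F] [Fintype F] (m : ℕ) :
    {p : F[X] | p.Monic ∧ p.natDegree = m}.Finite :=
  Set.finite_coe_iff.1 (Finite.of_equiv _ (monicEquivFun F m).symm)

/-- The monic polynomials of degree `m` over a finite field. -/
noncomputable def monics (F : Type*) [Field F] [Fintype F] (m : ℕ) : Finset F[X] :=
  (finite_monics F m).toFinset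

theorem mem_monics {m : ℕ} {g : F[X]} : g ∈ monics F m ↔ g.Monic ∧ g.natDegree = m := by
  simp [monics]

theorem card_monics (m : ℕ) : (monics F m).card = Fintype.card F ^ m := by
  rw [monics, ← Set.ncard_eq_toFinset_card _ (finite_monics F m), ← Nat.card_coe_set_eq]
  exact (Nat.card_congr (monicEquivFun F m)).trans (by simp)

open scoped Classical in
theorem card_monics_filter_dvd_sub {m : ℕ} {D : F[X]} (hD : D.Monic) (hm : D.natDegree ≤ m)
    (a : F[X]) :
    ((monics F m).filter fun g => D ∣ g - a).card = Fintype.card F ^ (m - D.natDegree) := by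
  have hlt : ∀ h ∈ monics F (m - D.natDegree), (a %ₘ D).degree < (D * h).degree := by
    intro h hh
    rw [mem_monics] at hh
    refine (degree_modByMonic_lt a hD).trans_le ?_
    exact degree_le_mul_left _ hh.1.ne_zero
  rw [← card_monics]
  symm
  refine Finset.card_bij (fun h _ => D * h + a %ₘ D) ?_ ?_ ?_
  · intro h hh
    have hl := hlt h hh
    rw [mem_monics] at hh
    rw [Finset.mem_filter, mem_monics]
    refine ⟨⟨(hD.mul hh.1).add_of_left hl, ?_⟩, ?_⟩
    · rw [natDegree_add_eq_left_of_degree_lt hl, hD.natDegree_mul hh.1, hh.2]; omega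
    · refine ⟨h - a /ₘ D, ?_⟩
      linear_combination (modByMonic_add_div a D)
  · intro h _ k _ hk
    exact mul_left_cancel₀ hD.ne_zero (add_right_cancel hk)
  · intro g hg
    rw [Finset.mem_filter, mem_monics] at hg
    obtain ⟨⟨hgm, hgd⟩, k, hk⟩ := hg
    have he : D * (k + a /ₘ D) = g - a %ₘ D := by
      linear_combination -hk + modByMonic_add_div a D
    have hl : (a %ₘ D).degree < g.degree := by
      refine (degree_modByMonic_lt a hD).trans_le ?_
      rw [degree_eq_natDegree hD.ne_zero, degree_eq_natDegree hgm.ne_zero, hgd]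
      exact_mod_cast hm
    have hm1 : (D * (k + a /ₘ D)).Monic := by
      rw [he]; exact hgm.sub_of_left hl
    have hm2 := hD.of_mul_monic_left hm1
    refine ⟨k + a /ₘ D, mem_monics.2 ⟨hm2, ?_⟩, by rw [he]; ring⟩
    have h3 := congrArg natDegree he
    rw [hD.natDegree_mul hm2, natDegree_eq_of_degree_eq (degree_sub_eq_left_of_degree_lt hl),
      hgd] at h3
    omega

open scoped Classical in
theorem card_monics_filter_dvd_dvd_sub {m : ℕ} {D₁ D₂ : F[X]} (h₁ : D₁.Monic) (h₂ : D₂.Monic)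
    (hco : IsCoprime D₁ D₂) (hm : D₁.natDegree + D₂.natDegree ≤ m) (f : F[X]) :
    ((monics F m).filter fun g => D₁ ∣ g ∧ D₂ ∣ f - g).card =
      Fintype.card F ^ (m - (D₁.natDegree + D₂.natDegree)) := by
  rw [← h₁.natDegree_mul h₂] at hm ⊢
  obtain ⟨u, v, huv⟩ := id hco
  rw [← card_monics_filter_dvd_sub (h₁.mul h₂) hm (u * D₁ * f)]
  congr 1
  refine Finset.filter_congr fun g _ => ⟨fun ⟨h3, h4⟩ => ?_, fun h => ⟨?_, ?_⟩⟩
  · refine hco.mul_dvd (dvd_sub h3 ⟨u * f, by ring⟩) ?_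
    have : g - u * D₁ * f = -(f - g) + D₂ * (v * f) := by linear_combination -f * huv
    rw [this]
    exact dvd_add (dvd_neg.2 h4) (dvd_mul_right _ _)
  · have := (dvd_mul_right D₁ D₂).trans h
    have h5 : D₁ ∣ u * D₁ * f := ⟨u * f, by ring⟩
    simpa using dvd_add this h5
  · have := (dvd_mul_left D₂ D₁).trans h
    have h6 : f - g = -(g - u * D₁ * f) + D₂ * (v * f) := by linear_combination -f * huv
    rw [h6]
    exact dvd_add (dvd_neg.2 this) (dvd_mul_right _ _)

/-- Averaging over lines in a fixed direction. -/
theorem card_mul_abs_sum_le {A : Finset F[X]} {M : F[X]}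
    (hA : ∀ g ∈ A, ∀ a : F, g + C a * M ∈ A) {φ : F[X] → ℝ} {B : ℝ}
    (hB : ∀ g ∈ A, |∑ a : F, φ (g + C a * M)| ≤ B) :
    Fintype.card F * |∑ g ∈ A, φ g| ≤ A.card * B := by
  have h1 : ∀ a : F, ∑ g ∈ A, φ (g + C a * M) = ∑ g ∈ A, φ g := by
    intro a
    refine Finset.sum_bij' (fun g _ => g + C a * M) (fun g _ => g + C (-a) * M)
      (fun g hg => hA g hg a) (fun g hg => hA g hg (-a)) ?_ ?_ ?_
    · intro g _; simp
    · intro g _; simp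
    · intro g _; rfl
  have h2 : (Fintype.card F : ℝ) * ∑ g ∈ A, φ g = ∑ g ∈ A, ∑ a : F, φ (g + C a * M) := by
    rw [Finset.sum_comm, Finset.sum_congr rfl fun a _ => h1 a]
    simp
  rw [← abs_of_nonneg (Nat.cast_nonneg (α := ℝ) (Fintype.card F)), ← abs_mul, h2]
  refine (Finset.abs_sum_le_sum_abs _ _).trans ((Finset.sum_le_sum hB).trans ?_)
  simp

theorem exists_squarefree_multiple {D : F[X]} (hD : D.Monic) (hs : Squarefree D) {d : ℕ}
    (hd : D.natDegree ≤ d) (hq : d < Fintype.card F) :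
    ∃ M : F[X], M.Monic ∧ Squarefree M ∧ D ∣ M ∧ M.natDegree = d := by
  classical
  induction d, hd using Nat.le_induction with
  | base => exact ⟨D, hD, hs, dvd_rfl, rfl⟩
  | succ d hd ih =>
    obtain ⟨M, hM, hMs, hDM, hMd⟩ := ih (by omega)
    obtain ⟨c, hc⟩ : ∃ c : F, c ∉ M.roots.toFinset := by
      by_contra! hcon
      have h1 : Fintype.card F ≤ M.roots.toFinset.card := by
        rw [← Finset.card_univ]; exact Finset.card_le_card fun c _ => hcon c
      have h2 := M.roots.toFinset_card_le
      have h3 := M.card_roots'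
      omega
    have hc' : ¬ X - C c ∣ M := by
      rw [dvd_iff_isRoot]
      rwa [Multiset.mem_toFinset, mem_roots hM.ne_zero] at hc
    refine ⟨(X - C c) * M, (monic_X_sub_C c).mul hM, ?_, hDM.mul_left _, ?_⟩
    · rw [squarefree_mul_iff]
      exact ⟨((irreducible_X_sub_C c).coprime_iff_not_dvd.2 hc').isRelPrime,
        (irreducible_X_sub_C c).squarefree, hMs⟩
    · rw [(monic_X_sub_C c).natDegree_mul hM, hMd, natDegree_X_sub_C, add_comm]

end Counting

section SubsetSums

variable {F : Type*} [Field F]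

/-- The sum of the degrees of a finite set of polynomials. -/
noncomputable def degSum (T : Finset F[X]) : ℕ := ∑ P ∈ T, P.natDegree

theorem natDegree_prod_eq_degSum {T : Finset F[X]} (hT : ∀ P ∈ T, P.Monic) :
    (∏ P ∈ T, P).natDegree = degSum T :=
  natDegree_prod_of_monic _ _ hT

theorem isCoprime_of_monic_irreducible_ne {P Q : F[X]} (hP : P.Monic ∧ Irreducible P)
    (hQ : Q.Monic ∧ Irreducible Q) (h : P ≠ Q) : IsCoprime P Q := by
  rw [hP.2.coprime_iff_not_dvd]
  exact fun hd => h (eq_of_monic_of_associated hP.1 hQ.1 (hP.2.associated_of_dvd hQ.2 hd))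

theorem squarefree_prod_of_monic_irreducible {T : Finset F[X]}
    (hT : ∀ P ∈ T, P.Monic ∧ Irreducible P) : Squarefree (∏ P ∈ T, P) := by
  classical
  induction T using Finset.induction_on with
  | empty => simp
  | insert P T hPT ih =>
    rw [Finset.prod_insert hPT, squarefree_mul_iff]
    refine ⟨IsCoprime.isRelPrime (IsCoprime.prod_right fun Q hQ => ?_),
      (hT P (Finset.mem_insert_self _ _)).2.squarefree,
      ih fun Q hQ => hT Q (Finset.mem_insert_of_mem hQ)⟩
    refine isCoprime_of_monic_irreducible_ne (hT P (Finset.mem_insert_self _ _))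
      (hT Q (Finset.mem_insert_of_mem hQ)) ?_
    rintro rfl
    exact hPT hQ

variable [DecidableEq F]

theorem subset_primeFactors_iff {T : Finset F[X]} (hT : ∀ P ∈ T, P.Monic ∧ Irreducible P)
    {h : F[X]} (h0 : h ≠ 0) : T ⊆ primeFactors h ↔ ∏ P ∈ T, P ∣ h := by
  constructor
  · intro hs
    refine Finset.prod_dvd_of_coprime (fun P hP Q hQ hne =>
      isCoprime_of_monic_irreducible_ne (hT P hP) (hT Q hQ) hne) fun P hP => ?_
    exact ((mem_primeFactors_iff h0).1 (hs hP)).2.2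
  · intro hd P hP
    exact (mem_primeFactors_iff h0).2 ⟨(hT P hP).1, (hT P hP).2,
      (Finset.dvd_prod_of_mem _ hP).trans hd⟩

theorem degSum_primeFactors {h : F[X]} (hm : h.Monic) (hs : Squarefree h) :
    degSum (primeFactors h) = h.natDegree := by
  rw [← natDegree_prod_eq_degSum fun P hP => ((mem_primeFactors_iff hm.ne_zero).1 hP).1,
    prod_primeFactors hm hs]

theorem primeFactors_nonempty {h : F[X]} (h0 : 0 < h.natDegree) : (primeFactors h).Nonempty := by
  have hne : h ≠ 0 := by rintro rfl; simp at h0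
  by_contra hcon
  have hc : IsCoprime (0 : F[X]) h := by
    by_contra hc
    obtain ⟨P, hP, -⟩ := exists_monic_irreducible_of_not_isCoprime hne hc
    exact hcon ⟨P, hP⟩
  rw [isCoprime_zero_left] at hc
  rw [natDegree_eq_zero_of_isUnit hc] at h0
  exact lt_irrefl _ h0

/-- The alternating sum of a weight over the sets of prime factors of a polynomial. -/
noncomputable def altSum (w : ℕ → ℝ) (h : F[X]) : ℝ :=
  ∑ T ∈ (primeFactors h).powerset, (-1) ^ T.card * w (degSum T)

theorem altSum_one {h : F[X]} (h0 : 0 < h.natDegree) : altSum (fun _ => 1) h = 0 := by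
  have := Finset.sum_powerset_neg_one_pow_card_of_nonempty (primeFactors_nonempty h0)
  unfold altSum
  simp only [mul_one]
  exact_mod_cast this

theorem altSum_sub_natCast (c : ℝ) {h : F[X]} (hm : h.Monic) (hs : Squarefree h)
    (h0 : 0 < h.natDegree) [Decidable (Irreducible h)] :
    altSum (fun j => c - j) h = if Irreducible h then (h.natDegree : ℝ) else 0 := by
  obtain ⟨P, hP⟩ := primeFactors_nonempty h0
  set S := (primeFactors h).erase P with hS
  have hPS : P ∉ S := Finset.notMem_erase _ _
  have hins : primeFactors h = insert P S := (Finset.insert_erase hP).symm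
  have h1 : altSum (fun j => c - j) h = P.natDegree * ∑ T ∈ S.powerset, (-1 : ℝ) ^ T.card := by
    rw [altSum, hins, Finset.sum_powerset_insert hPS, ← Finset.sum_add_distrib, Finset.mul_sum]
    refine Finset.sum_congr rfl fun T hT => ?_
    have hPT : P ∉ T := fun hc => hPS (Finset.mem_powerset.1 hT hc)
    rw [Finset.card_insert_of_notMem hPT, degSum, degSum, Finset.sum_insert hPT]
    push_cast
    ring
  rw [h1]
  by_cases hSe : S = ∅
  · have hhP : h = P := by
      rw [← prod_primeFactors hm hs, hins, hSe]; simp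
    rw [if_pos (hhP ▸ ((mem_primeFactors_iff hm.ne_zero).1 hP).2.1), hSe, ← hhP]
    simp
  · have h2 := Finset.sum_powerset_neg_one_pow_card_of_nonempty
      (Finset.nonempty_iff_ne_empty.2 hSe)
    have h3 : ∑ T ∈ S.powerset, (-1 : ℝ) ^ T.card = 0 := by exact_mod_cast h2
    rw [h3, mul_zero, if_neg]
    intro hirr
    obtain ⟨Q, hQ⟩ := Finset.nonempty_iff_ne_empty.2 hSe
    have hQh := Finset.mem_of_mem_erase hQ
    rw [mem_primeFactors_iff hm.ne_zero] at hP hQh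
    refine Finset.ne_of_mem_erase hQ ?_
    rw [eq_of_monic_of_associated hP.1 hm (hP.2.1.associated_of_dvd hirr hP.2.2),
      eq_of_monic_of_associated hQh.1 hm (hQh.2.1.associated_of_dvd hirr hQh.2.2)]

theorem altSum_eq_mob_mul (w : ℕ → ℝ) {h : F[X]} (hm : h.Monic) (hs : Squarefree h) :
    altSum w h = mob h * altSum (fun j => w (h.natDegree - j)) h := by
  rw [altSum, altSum, Finset.mul_sum]
  refine Finset.sum_bij' (fun T _ => primeFactors h \ T) (fun T _ => primeFactors h \ T)
    ?_ ?_ ?_ ?_ ?_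
  · intro T _; simp
  · intro T _; simp
  · intro T hT; exact Finset.sdiff_sdiff_eq_self (Finset.mem_powerset.1 hT)
  · intro T hT; exact Finset.sdiff_sdiff_eq_self (Finset.mem_powerset.1 hT)
  · intro T hT
    rw [Finset.mem_powerset] at hT
    have h1 : degSum (primeFactors h \ T) + degSum T = h.natDegree := by
      rw [← degSum_primeFactors hm hs]; exact Finset.sum_sdiff hT
    have h2 : degSum T = h.natDegree - degSum (primeFactors h \ T) := by omega
    rw [← h2, mob, if_pos hs, ← Finset.card_sdiff_add_card_eq_card hT]
    push_cast
    have h3 : ((-1 : ℝ) ^ (primeFactors h \ T).card) ^ 2 = 1 := by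
      rw [← pow_mul, mul_comm, pow_mul]; simp
    rw [pow_add]
    linear_combination (-(-1 : ℝ) ^ T.card * w (degSum T)) * h3

theorem abs_altSum_le {w : ℕ → ℝ} {c : ℝ} (hw : ∀ j, |w j| ≤ c) {h : F[X]} (h0 : h ≠ 0) :
    |altSum w h| ≤ 2 ^ h.natDegree * c := by
  have hc : 0 ≤ c := (abs_nonneg _).trans (hw 0)
  refine (Finset.abs_sum_le_sum_abs _ _).trans ?_
  have h1 : ∀ T ∈ (primeFactors h).powerset, |(-1 : ℝ) ^ T.card * w (degSum T)| ≤ c := by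
    intro T _
    rw [abs_mul, abs_pow, abs_neg, abs_one, one_pow, one_mul]
    exact hw _
  refine (Finset.sum_le_sum h1).trans ?_
  rw [Finset.sum_const, Finset.card_powerset, nsmul_eq_mul]
  push_cast
  gcongr
  · norm_num
  · exact card_primeFactors_le h0

theorem altSum_sub (w w' : ℕ → ℝ) (h : F[X]) :
    altSum (fun j => w j - w' j) h = altSum w h - altSum w' h := by
  rw [altSum, altSum, altSum, ← Finset.sum_sub_distrib]
  exact Finset.sum_congr rfl fun T _ => mul_sub _ _ _

theorem degSum_le {h : F[X]} (h0 : h ≠ 0) {T : Finset F[X]} (hT : T ⊆ primeFactors h) :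
    degSum T ≤ h.natDegree := by
  have hirr : ∀ P ∈ T, P.Monic ∧ Irreducible P := fun P hP =>
    ⟨((mem_primeFactors_iff h0).1 (hT hP)).1, ((mem_primeFactors_iff h0).1 (hT hP)).2.1⟩
  rw [← natDegree_prod_eq_degSum fun P hP => (hirr P hP).1]
  exact natDegree_le_of_dvd ((subset_primeFactors_iff hirr h0).1 hT) h0

theorem altSum_congr {w w' : ℕ → ℝ} {h : F[X]} (h0 : h ≠ 0)
    (hw : ∀ j ≤ h.natDegree, w j = w' j) : altSum w h = altSum w' h := by
  refine Finset.sum_congr rfl fun T hT => ?_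
  rw [hw _ (degSum_le h0 (Finset.mem_powerset.1 hT))]

/-- Splitting the prime indicator into a short divisor sum and a Möbius-twisted one. -/
theorem altSum_pos_sub_mob {h : F[X]} (hm : h.Monic) (hs : Squarefree h) (h0 : 0 < h.natDegree)
    [Decidable (Irreducible h)] (c : ℝ) :
    (if Irreducible h then (h.natDegree : ℝ) else 0) =
      altSum (fun j => max (c - j) 0) h -
        mob h * altSum (fun j => max (h.natDegree - j - c) 0) h := by
  rw [← altSum_sub_natCast c hm hs h0]
  have h1 : altSum (fun j => max (h.natDegree - j - c) 0) h =
      altSum (fun j => max (((h.natDegree - j : ℕ) : ℝ) - c) 0) h :=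
    altSum_congr hm.ne_zero fun j hj => by rw [Nat.cast_sub hj]
  rw [h1, ← altSum_eq_mob_mul (fun j => max ((j : ℝ) - c) 0) hm hs, ← altSum_sub]
  congr 1
  funext j
  rcases le_total (j : ℝ) c with hj | hj
  · rw [max_eq_left (by linarith), max_eq_right (by linarith)]; ring
  · rw [max_eq_right (by linarith), max_eq_left (by linarith)]; ring

end SubsetSums

section Averages

variable {F : Type*} [Field F] [Fintype F]

open scoped Classical in
/-- The monic irreducible polynomials of degree at most `N`. -/
noncomputable def primesLE (F : Type*) [Field F] [Fintype F] (N : ℕ) : Finset F[X] :=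
  ((Finset.range (N + 1)).biUnion fun d => monics F d).filter Irreducible

theorem mem_primesLE {N : ℕ} {P : F[X]} :
    P ∈ primesLE F N ↔ (P.Monic ∧ Irreducible P) ∧ P.natDegree ≤ N := by
  simp only [primesLE, Finset.mem_filter, Finset.mem_biUnion, Finset.mem_range, mem_monics,
    Order.lt_add_one_iff]
  constructor
  · rintro ⟨⟨d, hd, h1, rfl⟩, h2⟩
    exact ⟨⟨h1, h2⟩, hd⟩
  · rintro ⟨⟨h1, h2⟩, h3⟩
    exact ⟨⟨_, h3, h1, rfl⟩, h2⟩

theorem monic_irreducible_of_mem_powerset {N : ℕ} {T : Finset F[X]}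
    (hT : T ∈ (primesLE F N).powerset) : ∀ P ∈ T, P.Monic ∧ Irreducible P :=
  fun _ hP => (mem_primesLE.1 (Finset.mem_powerset.1 hT hP)).1

theorem natDegree_prod_of_mem_powerset {N : ℕ} {T : Finset F[X]}
    (hT : T ∈ (primesLE F N).powerset) : (∏ P ∈ T, P).natDegree = degSum T :=
  natDegree_prod_eq_degSum fun P hP => (monic_irreducible_of_mem_powerset hT P hP).1

theorem monic_prod_of_mem_powerset {N : ℕ} {T : Finset F[X]}
    (hT : T ∈ (primesLE F N).powerset) : (∏ P ∈ T, P).Monic :=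
  monic_prod_of_monic _ _ fun P hP => (monic_irreducible_of_mem_powerset hT P hP).1

variable [DecidableEq F]

open scoped Classical in
theorem powerset_primeFactors_eq_filter {N : ℕ} {h : F[X]} (h0 : h ≠ 0) (hN : h.natDegree ≤ N) :
    (primeFactors h).powerset = (primesLE F N).powerset.filter fun T => ∏ P ∈ T, P ∣ h := by
  ext T
  rw [Finset.mem_filter, Finset.mem_powerset]
  constructor
  · intro hT
    have hmem : T ∈ (primesLE F N).powerset := by
      rw [Finset.mem_powerset]
      intro P hP
      have := (mem_primeFactors_iff h0).1 (hT hP)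
      exact mem_primesLE.2 ⟨⟨this.1, this.2.1⟩, (natDegree_le_of_dvd this.2.2 h0).trans hN⟩
    exact ⟨hmem, (subset_primeFactors_iff (monic_irreducible_of_mem_powerset hmem) h0).1 hT⟩
  · rintro ⟨hmem, hT⟩
    exact (subset_primeFactors_iff (monic_irreducible_of_mem_powerset hmem) h0).2 hT

/-- The signed number of sets of monic irreducibles with total degree `j`. -/
noncomputable def altCount (F : Type*) [Field F] [Fintype F] (N j : ℕ) : ℝ :=
  ∑ T ∈ (primesLE F N).powerset with degSum T = j, (-1) ^ T.card

open scoped Classical in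
theorem sum_altSum_eq_sum_altCount {N m : ℕ} {u : F[X] → F[X]}
    (hu0 : ∀ g ∈ monics F m, u g ≠ 0 ∧ (u g).natDegree ≤ N)
    (hu : ∀ D : F[X], D.Monic → D.natDegree ≤ m →
      ((monics F m).filter fun g => D ∣ u g).card = Fintype.card F ^ (m - D.natDegree))
    {w : ℕ → ℝ} (hw : ∀ j, m < j → w j = 0) :
    ∑ g ∈ monics F m, altSum w (u g) =
      ∑ j ∈ Finset.range (m + 1), altCount F N j * w j * (Fintype.card F : ℝ) ^ (m - j) := by
  have h1 : ∀ g ∈ monics F m, altSum w (u g) = ∑ T ∈ (primesLE F N).powerset,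
      if ∏ P ∈ T, P ∣ u g then (-1) ^ T.card * w (degSum T) else 0 := by
    intro g hg
    rw [altSum, powerset_primeFactors_eq_filter (hu0 g hg).1 (hu0 g hg).2, Finset.sum_filter]
  rw [Finset.sum_congr rfl h1, Finset.sum_comm]
  have h2 : ∀ T ∈ (primesLE F N).powerset, (∑ g ∈ monics F m,
      if ∏ P ∈ T, P ∣ u g then (-1 : ℝ) ^ T.card * w (degSum T) else 0) =
      ∑ j ∈ Finset.range (m + 1), if degSum T = j then
        (-1 : ℝ) ^ T.card * w j * (Fintype.card F : ℝ) ^ (m - j) else 0 := by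
    intro T hT
    rw [Finset.sum_ite_eq, ← Finset.sum_filter, Finset.sum_const, nsmul_eq_mul]
    split_ifs with hj
    · rw [Finset.mem_range, Order.lt_add_one_iff] at hj
      rw [hu _ (monic_prod_of_mem_powerset hT) (by rwa [natDegree_prod_of_mem_powerset hT]),
        natDegree_prod_of_mem_powerset hT]
      push_cast
      ring
    · rw [hw _ (by simpa using hj)]
      simp
  rw [Finset.sum_congr rfl h2, Finset.sum_comm]
  refine Finset.sum_congr rfl fun j _ => ?_
  rw [← Finset.sum_filter, altCount, Finset.sum_mul, Finset.sum_mul]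

theorem sum_altCount_eq {N k : ℕ} (hk : k ≤ N) :
    ∑ j ∈ Finset.range (k + 1), altCount F N j * (Fintype.card F : ℝ) ^ (k - j) =
      if k = 0 then 1 else 0 := by
  classical
  have h := sum_altSum_eq_sum_altCount (F := F) (N := N) (m := k) (u := id)
    (fun g hg => ⟨(mem_monics.1 hg).1.ne_zero, (mem_monics.1 hg).2.le.trans hk⟩)
    (fun D hD hd => by simpa using card_monics_filter_dvd_sub hD hd 0)
    (w := fun j => if j ≤ k then 1 else 0) (fun j hj => if_neg (by omega))
  have h2 : ∀ j ∈ Finset.range (k + 1), altCount F N j * (if j ≤ k then (1 : ℝ) else 0) *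
      (Fintype.card F : ℝ) ^ (k - j) = altCount F N j * (Fintype.card F : ℝ) ^ (k - j) := by
    intro j hj
    rw [if_pos (by simpa [Order.lt_add_one_iff] using hj), mul_one]
  rw [Finset.sum_congr rfl h2] at h
  rw [← h]
  have h3 : ∀ g ∈ monics F k, altSum (fun j => if j ≤ k then (1 : ℝ) else 0) (id g) =
      if k = 0 then 1 else 0 := by
    intro g hg
    rw [mem_monics] at hg
    split_ifs with hk0
    · subst hk0
      rw [eq_one_of_monic_natDegree_zero hg.1 hg.2]
      simp [altSum, degSum]
    · rw [id, altSum_congr hg.1.ne_zero (w' := fun _ => 1) (fun j hj => if_pos (hg.2 ▸ hj))]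
      exact altSum_one (by omega)
  rw [Finset.sum_congr rfl h3, Finset.sum_const, card_monics]
  split_ifs with hk0 <;> simp [hk0]

theorem altCount_zero (N : ℕ) : altCount F N 0 = 1 := by
  simpa using sum_altCount_eq (F := F) (Nat.zero_le N)

theorem altCount_succ {N k : ℕ} (hk : k + 1 ≤ N) :
    altCount F N (k + 1) = if k = 0 then -(Fintype.card F : ℝ) else 0 := by
  have h1 := sum_altCount_eq (F := F) hk
  have h2 := sum_altCount_eq (F := F) (Nat.le_of_succ_le hk)
  rw [Finset.sum_range_succ] at h1
  have h3 : ∑ j ∈ Finset.range (k + 1), altCount F N j * (Fintype.card F : ℝ) ^ (k + 1 - j) =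
      Fintype.card F * ∑ j ∈ Finset.range (k + 1),
        altCount F N j * (Fintype.card F : ℝ) ^ (k - j) := by
    rw [Finset.mul_sum]
    refine Finset.sum_congr rfl fun j hj => ?_
    rw [Finset.mem_range] at hj
    rw [show k + 1 - j = (k - j) + 1 by omega, pow_succ]
    ring
  rw [h3, h2] at h1
  split_ifs with hk0
  · simp [hk0] at h1 ⊢; linarith
  · simp [hk0] at h1 ⊢; linarith

open scoped Classical in
theorem sum_altSum_eq {N m : ℕ} (hm : 1 ≤ m) (hmN : m ≤ N) {u : F[X] → F[X]}
    (hu0 : ∀ g ∈ monics F m, u g ≠ 0 ∧ (u g).natDegree ≤ N)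
    (hu : ∀ D : F[X], D.Monic → D.natDegree ≤ m →
      ((monics F m).filter fun g => D ∣ u g).card = Fintype.card F ^ (m - D.natDegree))
    {w : ℕ → ℝ} (hw : ∀ j, m < j → w j = 0) :
    ∑ g ∈ monics F m, altSum w (u g) = (Fintype.card F : ℝ) ^ m * (w 0 - w 1) := by
  rw [sum_altSum_eq_sum_altCount hu0 hu hw]
  obtain ⟨k, rfl⟩ := Nat.exists_eq_add_of_le' hm
  rw [Finset.sum_range_succ', Finset.sum_range_succ', Finset.sum_eq_zero]
  · rw [altCount_zero, altCount_succ (by omega), if_pos rfl]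
    simp only [zero_add, Nat.add_sub_cancel, Nat.sub_zero]
    ring
  · intro j hj
    rw [Finset.mem_range] at hj
    rw [altCount_succ (by omega), if_neg (by omega)]
    ring

end Averages

section Pairs

variable {F : Type*} [Field F] [Fintype F]

/-- Pairs of sets of monic irreducibles of degree at most `N`. -/
noncomputable def primePairs (F : Type*) [Field F] [Fintype F] (N : ℕ) :
    Finset (Finset F[X] × Finset F[X]) :=
  (primesLE F N).powerset ×ˢ (primesLE F N).powerset

/-- The signed weight of a pair of sets of polynomials. -/
noncomputable def pairWeight (w₁ w₂ : ℕ → ℝ) (p : Finset F[X] × Finset F[X]) : ℝ :=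
  (-1) ^ p.1.card * w₁ (degSum p.1) * ((-1) ^ p.2.card * w₂ (degSum p.2))

/-- Every member of `p.1` divides `g`, and every member of `p.2` divides `h`. -/
def PairDvd (p : Finset F[X] × Finset F[X]) (g h : F[X]) : Prop :=
  ∏ P ∈ p.1, P ∣ g ∧ ∏ P ∈ p.2, P ∣ h

omit [Fintype F] in
theorem abs_pairWeight_le {w₁ w₂ : ℕ → ℝ} {c : ℝ} (h₁ : ∀ j, |w₁ j| ≤ c) (h₂ : ∀ j, |w₂ j| ≤ c)
    (p : Finset F[X] × Finset F[X]) : |pairWeight w₁ w₂ p| ≤ c ^ 2 := by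
  simp only [pairWeight, abs_mul, abs_pow, abs_neg, abs_one, one_pow, one_mul]
  rw [sq]
  exact mul_le_mul (h₁ _) (h₂ _) (abs_nonneg _) ((abs_nonneg _).trans (h₁ 0))

variable [DecidableEq F]

open scoped Classical in
theorem primePairs_filter_eq {N : ℕ} {g h : F[X]} (hg : g ≠ 0) (hgN : g.natDegree ≤ N)
    (hh : h ≠ 0) (hhN : h.natDegree ≤ N) :
    ((primePairs F N).filter fun p => PairDvd p g h) =
      (primeFactors g).powerset ×ˢ (primeFactors h).powerset := by
  rw [powerset_primeFactors_eq_filter hg hgN, powerset_primeFactors_eq_filter hh hhN]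
  ext p
  rw [Finset.mem_filter, primePairs, Finset.mem_product, Finset.mem_product, Finset.mem_filter,
    Finset.mem_filter, PairDvd]
  tauto

open scoped Classical in
theorem altSum_mul_altSum (w₁ w₂ : ℕ → ℝ) {N : ℕ} {g h : F[X]} (hg : g ≠ 0)
    (hgN : g.natDegree ≤ N) (hh : h ≠ 0) (hhN : h.natDegree ≤ N) :
    altSum w₁ g * altSum w₂ h =
      ∑ p ∈ (primePairs F N) with PairDvd p g h, pairWeight w₁ w₂ p := by
  rw [primePairs_filter_eq hg hgN hh hhN, altSum, altSum, Finset.sum_mul_sum,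
    Finset.sum_product]
  rfl

open scoped Classical in
theorem card_primePairs_filter_le {N : ℕ} {g h : F[X]} (hg : g ≠ 0) (hgN : g.natDegree ≤ N)
    (hh : h ≠ 0) (hhN : h.natDegree ≤ N) :
    ((primePairs F N).filter fun p => PairDvd p g h).card ≤ 2 ^ (g.natDegree + h.natDegree) := by
  rw [primePairs_filter_eq hg hgN hh hhN, Finset.card_product, Finset.card_powerset,
    Finset.card_powerset, pow_add]
  exact Nat.mul_le_mul (Nat.pow_le_pow_right two_pos (card_primeFactors_le hg))
    (Nat.pow_le_pow_right two_pos (card_primeFactors_le hh))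

omit [Fintype F] [DecidableEq F] in
theorem monic_sub_line {f g : F[X]} (hf : f.Monic) (h : g.natDegree < f.natDegree) :
    (f - g).Monic ∧ (f - g).natDegree = f.natDegree :=
  ⟨hf.sub_of_left (degree_lt_degree h), natDegree_sub_eq_left_of_natDegree_lt h⟩

open scoped Classical in
theorem sum_altSum_mul_altSum_mul (w₁ w₂ : ℕ → ℝ) {m : ℕ} {f : F[X]} (hf : f.Monic)
    (hmf : m < f.natDegree) (φ : F[X] → ℝ) :
    ∑ g ∈ monics F m, altSum w₁ g * altSum w₂ (f - g) * φ g =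
      ∑ p ∈ primePairs F f.natDegree, pairWeight w₁ w₂ p *
        ∑ g ∈ monics F m with PairDvd p g (f - g), φ g := by
  have h1 : ∀ g ∈ monics F m, altSum w₁ g * altSum w₂ (f - g) * φ g =
      ∑ p ∈ primePairs F f.natDegree,
        if PairDvd p g (f - g) then pairWeight w₁ w₂ p * φ g else 0 := by
    intro g hg
    rw [mem_monics] at hg
    obtain ⟨h1, h2⟩ := monic_sub_line hf (hg.2 ▸ hmf)
    rw [altSum_mul_altSum w₁ w₂ hg.1.ne_zero (hg.2 ▸ hmf).le h1.ne_zero h2.le, Finset.sum_mul,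
      Finset.sum_filter]
  rw [Finset.sum_congr rfl h1, Finset.sum_comm]
  refine Finset.sum_congr rfl fun p _ => ?_
  rw [Finset.mul_sum, Finset.sum_filter]

open scoped Classical in
theorem sum_card_filter_pairDvd_le {m : ℕ} {f : F[X]} (hf : f.Monic) (hmf : m < f.natDegree) :
    ∑ p ∈ primePairs F f.natDegree, ((monics F m).filter fun g => PairDvd p g (f - g)).card ≤
      2 ^ (m + f.natDegree) * Fintype.card F ^ m := by
  simp only [Finset.card_filter]
  rw [Finset.sum_comm]
  simp only [← Finset.card_filter]
  rw [← card_monics, mul_comm, ← smul_eq_mul]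
  refine Finset.sum_le_card_nsmul _ _ _ fun g hg => ?_
  rw [mem_monics] at hg
  obtain ⟨h1, h2⟩ := monic_sub_line hf (hg.2 ▸ hmf)
  have := card_primePairs_filter_le hg.1.ne_zero (hg.2 ▸ hmf).le h1.ne_zero h2.le
  rwa [hg.2, h2] at this

/-- A sum of short divisor sums twisted by a function which cancels along lines is small. -/
theorem card_mul_abs_sum_altSum_mul_le {w₁ w₂ : ℕ → ℝ} {c : ℝ} (h₁ : ∀ j, |w₁ j| ≤ c)
    (h₂ : ∀ j, |w₂ j| ≤ c) {m d : ℕ} {f : F[X]} (hf : f.Monic) (hmf : m < f.natDegree)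
    (hdm : d < m) (hdq : d < Fintype.card F)
    (hw : ∀ i k, w₁ i ≠ 0 → w₂ k ≠ 0 → i + k ≤ d) {φ : F[X] → ℝ} {B : ℝ} (hB0 : 0 ≤ B)
    (hB : ∀ M : F[X], M.Monic → Squarefree M → M.natDegree = d → ∀ g ∈ monics F m,
      |∑ a : F, φ (g + C a * M)| ≤ B) :
    Fintype.card F * |∑ g ∈ monics F m, altSum w₁ g * altSum w₂ (f - g) * φ g| ≤
      c ^ 2 * B * (2 ^ (m + f.natDegree) * (Fintype.card F : ℝ) ^ m) := by
  classical
  rw [sum_altSum_mul_altSum_mul w₁ w₂ hf hmf]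
  have hterm : ∀ p ∈ primePairs F f.natDegree, Fintype.card F * |pairWeight w₁ w₂ p *
      ∑ g ∈ monics F m with PairDvd p g (f - g), φ g| ≤
      c ^ 2 * B * ((monics F m).filter fun g => PairDvd p g (f - g)).card := by
    intro p hp
    by_cases h0 : w₁ (degSum p.1) = 0 ∨ w₂ (degSum p.2) = 0
    · have : pairWeight w₁ w₂ p = 0 := by
        rcases h0 with h0 | h0 <;> simp [pairWeight, h0]
      rw [this]
      simp only [zero_mul, abs_zero, mul_zero]
      positivity
    · push Not at h0
      have hdeg := hw _ _ h0.1 h0.2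
      rw [primePairs, Finset.mem_product] at hp
      have hp1 := monic_irreducible_of_mem_powerset hp.1
      have hp2 := monic_irreducible_of_mem_powerset hp.2
      have hu : ∀ P ∈ p.1 ∪ p.2, P.Monic ∧ Irreducible P := fun P hP =>
        (Finset.mem_union.1 hP).elim (hp1 P) (hp2 P)
      have hdu : degSum (p.1 ∪ p.2) ≤ d := by
        refine le_trans ?_ hdeg
        rw [degSum, degSum, degSum, ← Finset.sum_union_inter]
        exact Nat.le_add_right _ _
      obtain ⟨M, hM, hMs, hDM, hMd⟩ := exists_squarefree_multiple
        (monic_prod_of_monic _ _ fun P hP => (hu P hP).1) (squarefree_prod_of_monic_irreducible hu)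
        (by rwa [natDegree_prod_eq_degSum fun P hP => (hu P hP).1]) hdq
      have hM1 := (Finset.prod_dvd_prod_of_subset _ _ _ Finset.subset_union_left).trans hDM
      have hM2 := (Finset.prod_dvd_prod_of_subset _ _ _ Finset.subset_union_right).trans hDM
      have havg := card_mul_abs_sum_le (A := (monics F m).filter fun g => PairDvd p g (f - g))
        (M := M) (φ := φ) (B := B) (by
          intro g hg a
          rw [Finset.mem_filter, mem_monics] at hg ⊢
          obtain ⟨⟨hg1, hg2⟩, hg3, hg4⟩ := hg
          obtain ⟨h3, h4⟩ := monic_line hg1 (M := M) (by omega) a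
          refine ⟨⟨h3, h4.trans hg2⟩, dvd_add hg3 (dvd_mul_of_dvd_right hM1 _), ?_⟩
          rw [← sub_sub]
          exact dvd_sub hg4 (dvd_mul_of_dvd_right hM2 _))
        (fun g hg => hB M hM hMs hMd g (Finset.mem_filter.1 hg).1)
      rw [abs_mul]
      have h5 := abs_pairWeight_le h₁ h₂ p
      calc _ = |pairWeight w₁ w₂ p| * (Fintype.card F *
            |∑ g ∈ monics F m with PairDvd p g (f - g), φ g|) := by ring
        _ ≤ c ^ 2 * (((monics F m).filter fun g => PairDvd p g (f - g)).card * B) := by gcongr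
        _ = _ := by ring
  calc _ ≤ (Fintype.card F : ℝ) * ∑ p ∈ primePairs F f.natDegree, |pairWeight w₁ w₂ p *
      ∑ g ∈ monics F m with PairDvd p g (f - g), φ g| := by
        gcongr; exact Finset.abs_sum_le_sum_abs _ _
    _ ≤ ∑ p ∈ primePairs F f.natDegree, c ^ 2 * B *
        ((monics F m).filter fun g => PairDvd p g (f - g)).card := by
        rw [Finset.mul_sum]; exact Finset.sum_le_sum hterm
    _ ≤ _ := by
        rw [← Finset.mul_sum]
        gcongr
        exact_mod_cast sum_card_filter_pairDvd_le hf hmf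

end Pairs

section Exact

variable {F : Type*} [Field F] [Fintype F]

open scoped Classical in
theorem card_mul_card_not_isCoprime_le {m : ℕ} (hm : 1 ≤ m) {K : F[X]} (hK : K ≠ 0) :
    (Fintype.card F : ℝ) * ((monics F m).filter fun g => ¬ IsCoprime g K).card ≤
      K.natDegree * (Fintype.card F : ℝ) ^ m := by
  have h := card_mul_abs_sum_le (A := monics F m) (M := 1)
    (φ := fun g => if ¬ IsCoprime g K then (1 : ℝ) else 0) (B := K.natDegree) ?_ ?_
  · rw [Finset.sum_boole, abs_of_nonneg (Nat.cast_nonneg _), card_monics] at h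
    push_cast at h
    linarith
  · intro g hg a
    rw [mem_monics] at hg ⊢
    obtain ⟨h1, h2⟩ := monic_line hg.1 (M := 1) (by rw [natDegree_one]; omega) a
    exact ⟨h1, h2.trans hg.2⟩
  · intro g _
    rw [Finset.sum_boole, abs_of_nonneg (Nat.cast_nonneg _)]
    exact_mod_cast card_not_isCoprime_line_le (isCoprime_one_right (x := g)) hK

variable [DecidableEq F]

open scoped Classical in
/-- The part of a product of two alternating sums that comes from disjoint pairs. -/
noncomputable def disjSum (w₁ w₂ : ℕ → ℝ) (N : ℕ) (g h : F[X]) : ℝ :=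
  ∑ p ∈ primePairs F N with PairDvd p g h, if Disjoint p.1 p.2 then pairWeight w₁ w₂ p else 0

open scoped Classical in
theorem abs_altSum_mul_sub_disjSum_le {w₁ w₂ : ℕ → ℝ} {c : ℝ} (h₁ : ∀ j, |w₁ j| ≤ c)
    (h₂ : ∀ j, |w₂ j| ≤ c) {N : ℕ} {g h : F[X]} (hg : g ≠ 0)
    (hgN : g.natDegree ≤ N) (hh : h ≠ 0) (hhN : h.natDegree ≤ N) :
    |altSum w₁ g * altSum w₂ h - disjSum w₁ w₂ N g h| ≤
      if ¬ IsCoprime g h then 2 ^ (g.natDegree + h.natDegree) * c ^ 2 else 0 := by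
  rw [altSum_mul_altSum w₁ w₂ hg hgN hh hhN, disjSum, ← Finset.sum_sub_distrib]
  refine (Finset.abs_sum_le_sum_abs _ _).trans ?_
  by_cases hc : IsCoprime g h
  swap
  · rw [if_pos hc]
    have h3 : ∀ p ∈ (primePairs F N).filter fun p => PairDvd p g h,
        |pairWeight w₁ w₂ p - if Disjoint p.1 p.2 then pairWeight w₁ w₂ p else 0| ≤ c ^ 2 := by
      intro p _
      split_ifs
      · simp [sq_nonneg]
      · simpa using abs_pairWeight_le h₁ h₂ p
    refine (Finset.sum_le_card_nsmul _ _ _ h3).trans ?_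
    rw [nsmul_eq_mul]
    gcongr
    exact_mod_cast card_primePairs_filter_le hg hgN hh hhN
  · rw [if_neg (not_not.2 hc)]
    refine (Finset.sum_eq_zero fun p hp => ?_).le
    rw [Finset.mem_filter, primePairs, Finset.mem_product] at hp
    rw [if_pos, sub_self, abs_zero]
    rw [Finset.disjoint_left]
    intro P hP1 hP2
    exact (monic_irreducible_of_mem_powerset hp.1.1 P hP1).2.not_isUnit
      (hc.isUnit_of_dvd' ((Finset.dvd_prod_of_mem (fun P => P) hP1).trans hp.2.1)
        ((Finset.dvd_prod_of_mem (fun P => P) hP2).trans hp.2.2))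

open scoped Classical in
theorem sum_disjSum {w₁ w₂ : ℕ → ℝ} {m N : ℕ} (hw : ∀ i k, w₁ i ≠ 0 → w₂ k ≠ 0 → i + k ≤ m)
    (f : F[X]) :
    (Fintype.card F : ℝ) ^ m * ∑ g ∈ monics F m, disjSum w₁ w₂ N g (f - g) =
      ∑ g ∈ monics F m, ∑ g' ∈ monics F m, disjSum w₁ w₂ N g (f - g') := by
  simp only [disjSum, Finset.sum_filter]
  rw [Finset.sum_comm]
  conv_rhs =>
    enter [2, g]
    rw [Finset.sum_comm]
  conv_rhs => rw [Finset.sum_comm]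
  rw [Finset.mul_sum]
  refine Finset.sum_congr rfl fun p hp => ?_
  by_cases hd : Disjoint p.1 p.2
  swap
  · simp [hd]
  simp only [hd, if_true]
  by_cases h0 : w₁ (degSum p.1) = 0 ∨ w₂ (degSum p.2) = 0
  · have : pairWeight w₁ w₂ p = 0 := by
      rcases h0 with h0 | h0 <;> simp [pairWeight, h0]
    simp [this]
  push Not at h0
  have hdeg := hw _ _ h0.1 h0.2
  rw [primePairs, Finset.mem_product] at hp
  have hm1 := monic_prod_of_mem_powerset hp.1
  have hm2 := monic_prod_of_mem_powerset hp.2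
  have hd1 := natDegree_prod_of_mem_powerset hp.1
  have hd2 := natDegree_prod_of_mem_powerset hp.2
  have hco : IsCoprime (∏ P ∈ p.1, P) (∏ P ∈ p.2, P) := by
    refine IsCoprime.prod_left fun P hP => IsCoprime.prod_right fun Q hQ => ?_
    refine isCoprime_of_monic_irreducible_ne (monic_irreducible_of_mem_powerset hp.1 P hP)
      (monic_irreducible_of_mem_powerset hp.2 Q hQ) ?_
    rintro rfl
    exact Finset.disjoint_left.1 hd hP hQ
  have c0 : ((monics F m).filter fun g => PairDvd p g (f - g)).card =
      Fintype.card F ^ (m - ((∏ P ∈ p.1, P).natDegree + (∏ P ∈ p.2, P).natDegree)) := by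
    refine Eq.trans ?_ (card_monics_filter_dvd_dvd_sub hm1 hm2 hco (m := m) (by omega) f)
    congr 1
    ext g
    rw [Finset.mem_filter, Finset.mem_filter, PairDvd]
  have c1 := card_monics_filter_dvd_dvd_sub hm1 monic_one isCoprime_one_right (m := m)
    (by rw [natDegree_one]; omega) f
  have c2 := card_monics_filter_dvd_dvd_sub monic_one hm2 isCoprime_one_left (m := m)
    (by rw [natDegree_one]; omega) f
  simp only [one_dvd, and_true, true_and, natDegree_one, add_zero, zero_add] at c1 c2
  have e1 : ∀ g ∈ monics F m, ∑ g' ∈ monics F m,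
      (if PairDvd p g (f - g') then pairWeight w₁ w₂ p else 0) =
      if ∏ P ∈ p.1, P ∣ g then
        (Fintype.card F : ℝ) ^ (m - degSum p.2) * pairWeight w₁ w₂ p else 0 := by
    intro g _
    split_ifs with hg
    · simp only [PairDvd, hg, true_and]
      rw [← Finset.sum_filter, Finset.sum_const, c2, hd2, nsmul_eq_mul]
      push_cast; rfl
    · simp [PairDvd, hg]
  rw [Finset.sum_congr rfl e1, ← Finset.sum_filter, ← Finset.sum_filter, Finset.sum_const,
    Finset.sum_const, c1, hd1]
  rw [c0, hd1, hd2, nsmul_eq_mul, nsmul_eq_mul]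
  push_cast
  rw [← mul_assoc, ← mul_assoc, ← pow_add, ← pow_add]
  congr 2
  omega

/-- The divisor sums at `g` and `f - g` are nearly uncorrelated. -/
theorem card_mul_abs_sum_altSum_mul_sub_le {w₁ w₂ : ℕ → ℝ} {c : ℝ} (h₁ : ∀ j, |w₁ j| ≤ c)
    (h₂ : ∀ j, |w₂ j| ≤ c) {m : ℕ} (hm : 1 ≤ m) {f : F[X]} (hf : f.Monic) (hmf : m < f.natDegree)
    (hw : ∀ i k, w₁ i ≠ 0 → w₂ k ≠ 0 → i + k ≤ m) :
    Fintype.card F * |(Fintype.card F : ℝ) ^ m *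
        ∑ g ∈ monics F m, altSum w₁ g * altSum w₂ (f - g) -
        (∑ g ∈ monics F m, altSum w₁ g) * ∑ g ∈ monics F m, altSum w₂ (f - g)| ≤
      2 * (2 ^ (m + f.natDegree) * c ^ 2 * f.natDegree * (Fintype.card F : ℝ) ^ m *
        (Fintype.card F : ℝ) ^ m) := by
  classical
  set q := (Fintype.card F : ℝ) with hq
  set n := f.natDegree with hn
  set K : ℝ := 2 ^ (m + n) * c ^ 2 with hK
  have hK0 : 0 ≤ K := by positivity
  have hq0 : 0 ≤ q := Nat.cast_nonneg _
  let E : F[X] → F[X] → ℝ := fun g h => altSum w₁ g * altSum w₂ h - disjSum w₁ w₂ n g h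
  have hE : ∀ g ∈ monics F m, ∀ g' ∈ monics F m, |E g (f - g')| ≤
      K * if ¬ IsCoprime g (f - g') then 1 else 0 := by
    intro g hg g' hg'
    rw [mem_monics] at hg hg'
    obtain ⟨h3, h4⟩ := monic_sub_line hf (hg'.2 ▸ hmf)
    have := abs_altSum_mul_sub_disjSum_le h₁ h₂ (N := n) hg.1.ne_zero (hg.2 ▸ hmf.le) h3.ne_zero
      h4.le
    rw [hg.2, h4] at this
    rwa [mul_ite, mul_one, mul_zero]
  have hid : q ^ m * ∑ g ∈ monics F m, altSum w₁ g * altSum w₂ (f - g) -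
      (∑ g ∈ monics F m, altSum w₁ g) * ∑ g ∈ monics F m, altSum w₂ (f - g) =
      q ^ m * ∑ g ∈ monics F m, E g (f - g) -
        ∑ g ∈ monics F m, ∑ g' ∈ monics F m, E g (f - g') := by
    have h5 := sum_disjSum (F := F) (N := n) hw f
    rw [← hq] at h5
    simp only [E, Finset.sum_sub_distrib, mul_sub, Finset.sum_mul_sum]
    linarith
  have b1 : q * |∑ g ∈ monics F m, E g (f - g)| ≤ K * (n * q ^ m) := by
    have h6 : |∑ g ∈ monics F m, E g (f - g)| ≤
        K * ((monics F m).filter fun g => ¬ IsCoprime g f).card := by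
      refine (Finset.abs_sum_le_sum_abs _ _).trans ?_
      rw [← Finset.sum_boole, Finset.mul_sum]
      refine Finset.sum_le_sum fun g hg => (hE g hg g hg).trans_eq ?_
      have : IsCoprime g (f - g) ↔ IsCoprime g f := by
        rw [sub_eq_add_neg, show f + -g = f + g * -1 by ring, IsCoprime.add_mul_left_right_iff]
      rw [this]
    calc _ ≤ q * (K * ((monics F m).filter fun g => ¬ IsCoprime g f).card) := by gcongr
      _ = K * (q * ((monics F m).filter fun g => ¬ IsCoprime g f).card) := by ring
      _ ≤ _ := mul_le_mul_of_nonneg_left (card_mul_card_not_isCoprime_le hm hf.ne_zero) hK0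
  have b2 : q * |∑ g ∈ monics F m, ∑ g' ∈ monics F m, E g (f - g')| ≤
      K * (n * q ^ m) * q ^ m := by
    rw [Finset.sum_comm]
    have h7 : ∀ g' ∈ monics F m, q * |∑ g ∈ monics F m, E g (f - g')| ≤ K * (n * q ^ m) := by
      intro g' hg'
      have h6 : |∑ g ∈ monics F m, E g (f - g')| ≤
          K * ((monics F m).filter fun g => ¬ IsCoprime g (f - g')).card := by
        refine (Finset.abs_sum_le_sum_abs _ _).trans ?_
        rw [← Finset.sum_boole, Finset.mul_sum]
        exact Finset.sum_le_sum fun g hg => hE g hg g' hg'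
      obtain ⟨h3, h4⟩ := monic_sub_line hf ((mem_monics.1 hg').2 ▸ hmf)
      have h8 := card_mul_card_not_isCoprime_le hm h3.ne_zero
      rw [h4] at h8
      calc _ ≤ q * (K * ((monics F m).filter fun g => ¬ IsCoprime g (f - g')).card) := by gcongr
        _ = K * (q * ((monics F m).filter fun g => ¬ IsCoprime g (f - g')).card) := by ring
        _ ≤ _ := mul_le_mul_of_nonneg_left h8 hK0
    calc _ ≤ q * ∑ g' ∈ monics F m, |∑ g ∈ monics F m, E g (f - g')| := by
          gcongr; exact Finset.abs_sum_le_sum_abs _ _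
      _ ≤ ∑ g' ∈ monics F m, K * (n * q ^ m) := by
          rw [Finset.mul_sum]; exact Finset.sum_le_sum h7
      _ = _ := by
          rw [Finset.sum_const, card_monics, nsmul_eq_mul]; push_cast; ring
  rw [hid]
  calc _ ≤ q * (|q ^ m * ∑ g ∈ monics F m, E g (f - g)| +
        |∑ g ∈ monics F m, ∑ g' ∈ monics F m, E g (f - g')|) := by
        gcongr; exact abs_sub _ _
    _ = q ^ m * (q * |∑ g ∈ monics F m, E g (f - g)|) +
        q * |∑ g ∈ monics F m, ∑ g' ∈ monics F m, E g (f - g')| := by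
        rw [abs_mul, abs_of_nonneg (pow_nonneg hq0 m)]; ring
    _ ≤ q ^ m * (K * (n * q ^ m)) + K * (n * q ^ m) * q ^ m :=
        add_le_add (mul_le_mul_of_nonneg_left b1 (pow_nonneg hq0 m)) b2
    _ = _ := by ring

end Exact

section CharacterLines

variable {F : Type*} [Field F] [Fintype F] [DecidableEq F]

/-- Up to sign and at most `E` exceptions, `ψ` is the quadratic character of the values of `P`. -/
def IsCharLine (ψ : F → ℤ) (E : ℕ) (P : F[X]) : Prop :=
  ∃ κ : ℤ, (κ = 1 ∨ κ = -1) ∧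
    (Finset.univ.filter fun a => ψ a ≠ κ * quadraticChar F (P.eval a)).card ≤ E

theorem abs_quadraticChar_le_one (a : F) : |quadraticChar F a| ≤ 1 := by
  by_cases h : a = 0
  · simp [h]
  · rcases quadraticChar_dichotomy h with h | h <;> simp [h]

theorem IsCharLine.abs_sum_le {ψ : F → ℤ} {E : ℕ} {P : F[X]} (h : IsCharLine ψ E P)
    (hψ : ∀ a, |ψ a| ≤ 1) (hq : Odd (Fintype.card F)) (hP : Odd P.natDegree) :
    |∑ a : F, (ψ a : ℝ)| ≤ 100 * P.natDegree * √(Fintype.card F) + 2 * E := by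
  obtain ⟨κ, hκ, hE⟩ := h
  have h1 := abs_sum_quadraticChar_le hq hP
  have h2 : ∑ a : F, (ψ a : ℝ) = κ * ∑ a : F, (quadraticChar F (P.eval a) : ℝ) +
      ∑ a : F, ((ψ a : ℝ) - κ * (quadraticChar F (P.eval a) : ℝ)) := by
    rw [Finset.mul_sum, ← Finset.sum_add_distrib]
    exact Finset.sum_congr rfl fun a _ => by ring
  have hκ1 : |(κ : ℝ)| = 1 := by rcases hκ with h | h <;> simp [h]
  have h3 : |∑ a : F, ((ψ a : ℝ) - κ * (quadraticChar F (P.eval a) : ℝ))| ≤ 2 * E := by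
    refine (Finset.abs_sum_le_sum_abs _ _).trans ?_
    have h4 : ∀ a ∈ (Finset.univ : Finset F), |(ψ a : ℝ) - κ * (quadraticChar F (P.eval a) : ℝ)| ≤
        2 * if ψ a ≠ κ * quadraticChar F (P.eval a) then 1 else 0 := by
      intro a _
      split_ifs with hc
      · have h5 : |(ψ a : ℝ)| ≤ 1 := by exact_mod_cast hψ a
        have h6 : |(quadraticChar F (P.eval a) : ℝ)| ≤ 1 := by
          exact_mod_cast abs_quadraticChar_le_one _
        refine (abs_sub _ _).trans ?_
        rw [abs_mul, hκ1]
        linarith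
      · rw [not_not] at hc
        rw [hc]; simp
    refine (Finset.sum_le_sum h4).trans ?_
    rw [← Finset.mul_sum, Finset.sum_boole]
    have : ((Finset.univ.filter fun a => ψ a ≠ κ * quadraticChar F (P.eval a)).card : ℝ) ≤ E := by
      exact_mod_cast hE
    linarith
  rw [h2]
  refine (abs_add_le _ _).trans (add_le_add ?_ h3)
  rw [abs_mul, hκ1, one_mul]
  exact h1

theorem IsCharLine.mul {ψ₁ ψ₂ : F → ℤ} {E₁ E₂ : ℕ} {P₁ P₂ : F[X]} (h₁ : IsCharLine ψ₁ E₁ P₁)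
    (h₂ : IsCharLine ψ₂ E₂ P₂) :
    IsCharLine (fun a => ψ₁ a * ψ₂ a) (E₁ + E₂) (P₁ * P₂) := by
  obtain ⟨κ₁, hκ₁, hE₁⟩ := h₁
  obtain ⟨κ₂, hκ₂, hE₂⟩ := h₂
  refine ⟨κ₁ * κ₂, ?_, le_trans (Finset.card_le_card ?_)
    ((Finset.card_union_le _ _).trans (add_le_add hE₁ hE₂))⟩
  · rcases hκ₁ with h | h <;> rcases hκ₂ with h' | h' <;> simp [h, h']
  · intro a ha
    simp only [Finset.mem_filter, Finset.mem_union, Finset.mem_univ, true_and] at ha ⊢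
    by_contra! hcon
    refine ha ?_
    rw [hcon.1, hcon.2, eval_mul, map_mul]
    ring

theorem IsCharLine.card_eq_zero_le {ψ : F → ℤ} {E : ℕ} {P : F[X]} (h : IsCharLine ψ E P)
    (hP : P ≠ 0) : (Finset.univ.filter fun a => ψ a = 0).card ≤ E + P.natDegree := by
  obtain ⟨κ, hκ, hE⟩ := h
  have h1 : P.roots.toFinset.card ≤ P.natDegree :=
    P.roots.toFinset_card_le.trans P.card_roots'
  refine le_trans (Finset.card_le_card ?_)
    ((Finset.card_union_le _ _).trans (add_le_add hE h1))
  intro a ha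
  simp only [Finset.mem_filter, Finset.mem_union, Finset.mem_univ, true_and,
    Multiset.mem_toFinset, mem_roots hP, IsRoot.def] at ha ⊢
  by_contra! hcon
  have h2 := hcon.1
  rw [ha] at h2
  rcases hκ with h | h <;> rcases quadraticChar_dichotomy hcon.2 with h' | h' <;>
    rw [h, h'] at h2 <;> norm_num at h2

theorem IsCharLine.comp_neg {ψ : F → ℤ} {E : ℕ} {P : F[X]} (h : IsCharLine ψ E P) :
    IsCharLine (fun a => ψ (-a)) E (P.comp (-X)) := by
  obtain ⟨κ, hκ, hE⟩ := h
  refine ⟨κ, hκ, le_trans ?_ hE⟩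
  refine Finset.card_le_card_of_injOn Neg.neg ?_ neg_injective.injOn
  intro a ha
  simpa using ha

omit [Fintype F] in
theorem abs_mob_le_one (g : F[X]) : |mob g| ≤ 1 := by
  by_cases hs : Squarefree g
  · rcases mob_eq_one_or hs with h | h <;> simp [h]
  · simp [mob_of_not_squarefree hs]

omit [Fintype F] in
theorem mob_eq_zero_iff {g : F[X]} : mob g = 0 ↔ ¬ Squarefree g := by
  refine ⟨fun h hs => ?_, mob_of_not_squarefree⟩
  rcases mob_eq_one_or hs with h1 | h1 <;> rw [h1] at h <;> norm_num at h

theorem exists_isCharLine (hchar : ringChar F ≠ 2) {g M : F[X]} (hg : g.Monic)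
    (hM : M.Monic) (hMs : Squarefree M) (hlt : M.natDegree < g.natDegree)
    (hne : (g.natDegree : F) - M.natDegree ≠ 0) :
    ∃ (P : F[X]) (k : ℕ), P ≠ 0 ∧ P.natDegree + 2 * k + 1 = g.natDegree + M.natDegree ∧
      IsCharLine (fun a => mob (g + C a * M)) M.natDegree P := by
  obtain ⟨P, κ, k, h0, hκ, hd, h⟩ := exists_line_poly hchar hg hM hMs hlt hne
  exact ⟨P, k, h0, hd, κ, hκ, by convert h⟩

theorem exists_isCharLine_sub (hchar : ringChar F ≠ 2) {f g M : F[X]} (hf : f.Monic)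
    (hgf : g.natDegree < f.natDegree) (hM : M.Monic) (hMs : Squarefree M)
    (hlt : M.natDegree < f.natDegree) (hne : (f.natDegree : F) - M.natDegree ≠ 0) :
    ∃ (P : F[X]) (k : ℕ), P ≠ 0 ∧ P.natDegree + 2 * k + 1 = f.natDegree + M.natDegree ∧
      IsCharLine (fun a => mob (f - (g + C a * M))) M.natDegree P := by
  obtain ⟨h1, h2⟩ := monic_sub_line hf hgf
  obtain ⟨P, k, h0, hd, h⟩ := exists_isCharLine hchar h1 hM hMs (h2 ▸ hlt) (h2 ▸ hne)
  refine ⟨P.comp (-X), k, ?_, ?_, ?_⟩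
  · rw [← neg_one_mul, ← C_1, ← C_neg]
    rwa [Ne, comp_C_mul_X_eq_zero_iff (isUnit_one.neg.mem_nonZeroDivisors)]
  · rw [natDegree_comp, natDegree_neg, natDegree_X, mul_one, hd, h2]
  · convert h.comp_neg using 3 with a
    rw [C_neg]; ring

end CharacterLines

section LineSums

variable {F : Type*} [Field F] [Fintype F] [DecidableEq F]

omit [DecidableEq F] in
theorem ringChar_ne_two_of_odd (hq : Odd (Fintype.card F)) : ringChar F ≠ 2 := fun h => by
  have := FiniteField.even_card_iff_char_two.1 h
  rw [Nat.odd_iff] at hq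
  omega

omit [Fintype F] [DecidableEq F] in
theorem natCast_sub_natCast_ne_zero_of_eq_add_one {a b : ℕ} (h : a = b + 1) :
    (a : F) - b ≠ 0 := by
  rw [h]; push_cast; simp

omit [Fintype F] [DecidableEq F] in
theorem natCast_sub_natCast_ne_zero_of_eq_add_two (hchar : ringChar F ≠ 2) {a b : ℕ}
    (h : a = b + 2) : (a : F) - b ≠ 0 := by
  rw [h]; push_cast; simpa using Ring.two_ne_zero hchar

omit [DecidableEq F] in
theorem mul_sqrt_add_le {D n : ℝ} {E d : ℕ} (hD : D ≤ 4 * n) (hE : (E : ℝ) ≤ 2 * n)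
    (hd : (d : ℝ) ≤ D) :
    100 * d * √(Fintype.card F) + 2 * E ≤ 404 * n * √(Fintype.card F) := by
  have h1 : (1 : ℝ) ≤ √(Fintype.card F) :=
    Real.one_le_sqrt.2 (by exact_mod_cast Fintype.card_pos)
  nlinarith

theorem abs_sum_mob_line_le (hq : Odd (Fintype.card F)) {m : ℕ} {g M : F[X]} (hg : g ∈ monics F m)
    (hM : M.Monic) (hMs : Squarefree M) (hd : M.natDegree + 2 = m) :
    |∑ a : F, (mob (g + C a * M) : ℝ)| ≤ 404 * (m + 1) * √(Fintype.card F) := by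
  rw [mem_monics] at hg
  have hchar := ringChar_ne_two_of_odd hq
  obtain ⟨P, k, -, hPd, h⟩ := exists_isCharLine hchar hg.1 hM hMs (by omega)
    (natCast_sub_natCast_ne_zero_of_eq_add_two hchar (by omega))
  refine (h.abs_sum_le (fun a => abs_mob_le_one _) hq ⟨m - 2 - k, by omega⟩).trans
    (mul_sqrt_add_le (D := 2 * m) (by linarith) ?_ ?_)
  · have : M.natDegree ≤ 2 * (m + 1) := by omega
    exact_mod_cast this
  · have : P.natDegree ≤ 2 * m := by omega
    exact_mod_cast this

theorem abs_sum_mob_sub_line_le (hq : Odd (Fintype.card F)) {m : ℕ} {f g M : F[X]} (hf : f.Monic)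
    (hfd : f.natDegree = m + 1) (hg : g ∈ monics F m)
    (hM : M.Monic) (hMs : Squarefree M) (hd : M.natDegree + 1 = m) :
    |∑ a : F, (mob (f - (g + C a * M)) : ℝ)| ≤ 404 * (m + 1) * √(Fintype.card F) := by
  rw [mem_monics] at hg
  have hchar := ringChar_ne_two_of_odd hq
  obtain ⟨P, k, -, hPd, h⟩ := exists_isCharLine_sub hchar hf (g := g) (by omega) hM hMs (by omega)
    (natCast_sub_natCast_ne_zero_of_eq_add_two hchar (by omega))
  refine (h.abs_sum_le (fun a => abs_mob_le_one _) hq ⟨m - 1 - k, by omega⟩).trans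
    (mul_sqrt_add_le (D := 2 * m) (by linarith) ?_ ?_)
  · have : M.natDegree ≤ 2 * (m + 1) := by omega
    exact_mod_cast this
  · have : P.natDegree ≤ 2 * m := by omega
    exact_mod_cast this

theorem abs_sum_mob_mul_mob_line_le (hq : Odd (Fintype.card F)) {m : ℕ} {f g M : F[X]}
    (hf : f.Monic) (hfd : f.natDegree = m + 1) (hg : g ∈ monics F m)
    (hM : M.Monic) (hMs : Squarefree M) (hd : M.natDegree + 1 = m) :
    |∑ a : F, ((mob (g + C a * M) * mob (f - (g + C a * M)) : ℤ) : ℝ)| ≤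
      404 * (m + 1) * √(Fintype.card F) := by
  rw [mem_monics] at hg
  have hchar := ringChar_ne_two_of_odd hq
  obtain ⟨P₁, k₁, h₁0, hd₁, h₁⟩ := exists_isCharLine hchar hg.1 hM hMs (by omega)
    (natCast_sub_natCast_ne_zero_of_eq_add_one (by omega))
  obtain ⟨P₂, k₂, h₂0, hd₂, h₂⟩ := exists_isCharLine_sub hchar hf (g := g) (by omega) hM hMs
    (by omega) (natCast_sub_natCast_ne_zero_of_eq_add_two hchar (by omega))
  have hdeg := natDegree_mul h₁0 h₂0
  refine ((h₁.mul h₂).abs_sum_le (fun a => ?_) hq ⟨2 * m - 2 - k₁ - k₂, by omega⟩).trans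
    (mul_sqrt_add_le (D := 4 * m) (by linarith) ?_ ?_)
  · rw [abs_mul]
    exact mul_le_one₀ (abs_mob_le_one _) (abs_nonneg _) (abs_mob_le_one _)
  · have : M.natDegree + M.natDegree ≤ 2 * (m + 1) := by omega
    exact_mod_cast this
  · have : (P₁ * P₂).natDegree ≤ 4 * m := by omega
    exact_mod_cast this

omit [DecidableEq F] in
theorem card_mul_card_filter_le {m B : ℕ} (hm : 1 ≤ m) (hmq : m ≤ Fintype.card F)
    {ψ : F[X] → ℤ} (hB : ∀ M : F[X], M.Monic → Squarefree M → M.natDegree + 1 = m →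
      ∀ g ∈ monics F m, (Finset.univ.filter fun a : F => ψ (g + C a * M) = 0).card ≤ B) :
    (Fintype.card F : ℝ) * ((monics F m).filter fun g => ψ g = 0).card ≤
      B * (Fintype.card F : ℝ) ^ m := by
  obtain ⟨M, hM, hMs, -, hMd⟩ := exists_squarefree_multiple (F := F) (D := 1) monic_one
    squarefree_one (d := m - 1) (by simp) (by omega)
  have h := card_mul_abs_sum_le (A := monics F m) (M := M)
    (φ := fun g => if ψ g = 0 then (1 : ℝ) else 0) (B := B) ?_ ?_
  · rw [Finset.sum_boole, abs_of_nonneg (Nat.cast_nonneg _), card_monics] at h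
    push_cast at h
    linarith
  · intro g hg a
    rw [mem_monics] at hg ⊢
    obtain ⟨h1, h2⟩ := monic_line hg.1 (M := M) (by omega) a
    exact ⟨h1, h2.trans hg.2⟩
  · intro g hg
    rw [Finset.sum_boole, abs_of_nonneg (Nat.cast_nonneg _)]
    exact_mod_cast hB M hM hMs (by omega) g hg

theorem card_mul_card_mob_eq_zero_le (hq : Odd (Fintype.card F)) {m : ℕ} (hm : 1 ≤ m)
    (hmq : m ≤ Fintype.card F) :
    (Fintype.card F : ℝ) * ((monics F m).filter fun g => mob g = 0).card ≤
      (3 * (m + 1) : ℕ) * (Fintype.card F : ℝ) ^ m := by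
  refine card_mul_card_filter_le hm hmq fun M hM hMs hd g hg => ?_
  rw [mem_monics] at hg
  obtain ⟨P, k, h0, hPd, h⟩ := exists_isCharLine (ringChar_ne_two_of_odd hq) hg.1 hM hMs (by omega)
    (natCast_sub_natCast_ne_zero_of_eq_add_one (by omega))
  exact (h.card_eq_zero_le h0).trans (by omega)

theorem card_mul_card_mob_sub_eq_zero_le (hq : Odd (Fintype.card F)) {m : ℕ} (hm : 1 ≤ m)
    (hmq : m ≤ Fintype.card F) {f : F[X]} (hf : f.Monic) (hfd : f.natDegree = m + 1) :
    (Fintype.card F : ℝ) * ((monics F m).filter fun g => mob (f - g) = 0).card ≤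
      (3 * (m + 1) : ℕ) * (Fintype.card F : ℝ) ^ m := by
  refine card_mul_card_filter_le (ψ := fun g => mob (f - g)) hm hmq fun M hM hMs hd g hg => ?_
  rw [mem_monics] at hg
  have hchar := ringChar_ne_two_of_odd hq
  obtain ⟨P, k, h0, hPd, h⟩ := exists_isCharLine_sub hchar hf (g := g) (by omega) hM hMs (by omega)
    (natCast_sub_natCast_ne_zero_of_eq_add_two hchar (by omega))
  exact (h.card_eq_zero_le h0).trans (by omega)

end LineSums

section GoldbachCount

variable {F : Type*} [Field F]

/-- The truncated linear weight `max (c - j) 0`. -/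
def ramp (c : ℝ) (j : ℕ) : ℝ := max (c - j) 0

theorem abs_ramp_le {c d : ℝ} (hcd : c ≤ d) (hd : 0 ≤ d) (j : ℕ) : |ramp c j| ≤ d := by
  rw [ramp, abs_of_nonneg (le_max_right _ _)]
  exact max_le (by linarith [(Nat.cast_nonneg j : (0 : ℝ) ≤ j)]) hd

theorem lt_of_ramp_ne_zero {c : ℝ} {j : ℕ} (h : ramp c j ≠ 0) : (j : ℝ) < c := by
  by_contra hc
  exact h (max_eq_right (by linarith))

theorem ramp_eq_zero {c : ℝ} {j : ℕ} (h : c ≤ j) : ramp c j = 0 :=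
  max_eq_right (by linarith)

theorem ramp_zero_sub_ramp_one {c : ℝ} (h : 1 ≤ c) : ramp c 0 - ramp c 1 = 1 := by
  rw [ramp, ramp, max_eq_left (by push_cast; linarith), max_eq_left (by push_cast; linarith)]
  push_cast; ring

variable [DecidableEq F]

open scoped Classical in
theorem altSum_ramp_sub_mob {h : F[X]} (hm : h.Monic) (hs : Squarefree h) (h0 : 0 < h.natDegree)
    (c : ℝ) : (if Irreducible h then (h.natDegree : ℝ) else 0) =
      altSum (ramp c) h - mob h * altSum (ramp (h.natDegree - c)) h := by
  have h1 : ramp (h.natDegree - c) = fun j : ℕ => max ((h.natDegree : ℝ) - j - c) 0 := by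
    funext j; rw [ramp, sub_right_comm]
  rw [h1]
  exact altSum_pos_sub_mob hm hs h0 c

/-- The combination of divisor sums which detects pairs `(g, h)` of irreducible polynomials of
degrees `m` and `m + 1`. -/
noncomputable def pairDetector (m : ℕ) (g h : F[X]) : ℝ :=
  altSum (ramp (((m + 1) / 2 : ℕ) + 1)) g * altSum (ramp ((m + 1 : ℝ) / 2)) h -
    altSum (ramp (m - (((m + 1) / 2 : ℕ) + 1))) g * altSum (ramp ((m + 1 : ℝ) / 2)) h * mob g -
    altSum (ramp ((m : ℝ) / 2)) g * altSum (ramp ((m + 1 : ℝ) / 2)) h * mob h +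
    altSum (ramp ((m : ℝ) / 2)) g * altSum (ramp ((m + 1 : ℝ) / 2)) h * (mob g * mob h : ℤ)

open scoped Classical in
theorem pairDetector_eq {m : ℕ} (hm : 1 ≤ m) {g h : F[X]} (hg : g.Monic) (hgm : g.natDegree = m)
    (hh : h.Monic) (hhm : h.natDegree = m + 1) (hgs : Squarefree g) (hhs : Squarefree h) :
    pairDetector m g h =
      if Irreducible g ∧ Irreducible h then (m : ℝ) * (m + 1) else 0 := by
  have h1 := altSum_ramp_sub_mob hg hgs (by omega) (((m + 1) / 2 : ℕ) + 1)
  have h2 := altSum_ramp_sub_mob hg hgs (by omega) ((m : ℝ) / 2)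
  have h3 := altSum_ramp_sub_mob hh hhs (by omega) ((m + 1 : ℝ) / 2)
  rw [hgm] at h1 h2
  rw [hhm] at h3
  have e2 : (m : ℝ) - m / 2 = m / 2 := by ring
  have e3 : ((m + 1 : ℕ) : ℝ) - (m + 1) / 2 = (m + 1) / 2 := by push_cast; ring
  rw [e2] at h2
  rw [e3] at h3
  have h4 : (if Irreducible g ∧ Irreducible h then (m : ℝ) * (m + 1) else 0) =
      (if Irreducible g then (m : ℝ) else 0) * if Irreducible h then ((m + 1 : ℕ) : ℝ) else 0 := by
    by_cases a : Irreducible g <;> by_cases b : Irreducible h <;> simp [a, b]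
  rw [h4, h3, mul_sub, pairDetector]
  nth_rewrite 2 [h2]
  rw [h1]
  push_cast
  ring

theorem abs_pairDetector_le {m : ℕ} (hm : 1 ≤ m) {g h : F[X]} (hg : g.Monic)
    (hgm : g.natDegree = m) (hh : h.Monic) (hhm : h.natDegree = m + 1) :
    |pairDetector m g h| ≤ 4 * (2 ^ (m + (m + 1)) * (m + 1) ^ 2) := by
  have hm' : (1 : ℝ) ≤ m := by exact_mod_cast hm
  have key : ∀ c₁ c₂ : ℝ, c₁ ≤ m + 1 → c₂ ≤ m + 1 → ∀ x : ℤ, |x| ≤ 1 →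
      |altSum (ramp c₁) g * altSum (ramp c₂) h * x| ≤ 2 ^ (m + (m + 1)) * (m + 1) ^ 2 := by
    intro c₁ c₂ h₁ h₂ x hx
    have b1 := abs_altSum_le (fun j => abs_ramp_le h₁ (by positivity) j) hg.ne_zero
    have b2 := abs_altSum_le (fun j => abs_ramp_le h₂ (by positivity) j) hh.ne_zero
    rw [hgm] at b1
    rw [hhm] at b2
    have b3 : |(x : ℝ)| ≤ 1 := by exact_mod_cast hx
    rw [abs_mul, abs_mul]
    calc _ ≤ 2 ^ m * ((m : ℝ) + 1) * (2 ^ (m + 1) * (m + 1)) * 1 := by gcongr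
      _ = _ := by ring
  have hJ : (((m + 1) / 2 : ℕ) : ℝ) ≤ m := by
    have : (m + 1) / 2 ≤ m := by omega
    exact_mod_cast this
  have hJ0 : (0 : ℝ) ≤ ((m + 1) / 2 : ℕ) := Nat.cast_nonneg _
  have k1 := key (((m + 1) / 2 : ℕ) + 1) ((m + 1 : ℝ) / 2) (by linarith) (by linarith) 1 (by simp)
  have k2 := key (m - (((m + 1) / 2 : ℕ) + 1)) ((m + 1 : ℝ) / 2) (by linarith) (by linarith)
    (mob g) (abs_mob_le_one g)
  have k3 := key ((m : ℝ) / 2) ((m + 1 : ℝ) / 2) (by linarith) (by linarith)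
    (mob h) (abs_mob_le_one h)
  have k4 := key ((m : ℝ) / 2) ((m + 1 : ℝ) / 2) (by linarith) (by linarith)
    (mob g * mob h) (by
      rw [abs_mul]; exact mul_le_one₀ (abs_mob_le_one _) (abs_nonneg _) (abs_mob_le_one _))
  rw [Int.cast_one, mul_one] at k1
  rw [abs_le] at k1 k2 k3 k4
  rw [pairDetector, abs_le]
  constructor <;> linarith [k1.1, k1.2, k2.1, k2.2, k3.1, k3.2, k4.1, k4.2]

variable [Fintype F]

theorem card_mul_abs_main_sub_le {m : ℕ} (hm : 1 ≤ m) {f : F[X]} (hf : f.Monic)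
    (hfd : f.natDegree = m + 1) :
    Fintype.card F * |∑ g ∈ monics F m, altSum (ramp (((m + 1) / 2 : ℕ) + 1)) g *
        altSum (ramp ((m + 1 : ℝ) / 2)) (f - g) - (Fintype.card F : ℝ) ^ m| ≤
      2 * (2 ^ (m + (m + 1)) * (m + 1) ^ 3 * (Fintype.card F : ℝ) ^ m) := by
  classical
  have hm' : (1 : ℝ) ≤ m := by exact_mod_cast hm
  have hJ : (((m + 1) / 2 : ℕ) : ℝ) ≤ m := by
    have : (m + 1) / 2 ≤ m := by omega
    exact_mod_cast this
  have hJ1 : (1 : ℝ) ≤ ((m + 1) / 2 : ℕ) := by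
    have : 1 ≤ (m + 1) / 2 := by omega
    exact_mod_cast this
  have h := card_mul_abs_sum_altSum_mul_sub_le (w₁ := ramp (((m + 1) / 2 : ℕ) + 1))
    (w₂ := ramp ((m + 1 : ℝ) / 2)) (c := m + 1)
    (fun j => abs_ramp_le (by linarith) (by positivity) j)
    (fun j => abs_ramp_le (by linarith) (by positivity) j) hm hf (by omega) ?_
  · have s1 : ∑ g ∈ monics F m, altSum (ramp (((m + 1) / 2 : ℕ) + 1)) g =
        (Fintype.card F : ℝ) ^ m := by
      rw [sum_altSum_eq (N := m) (u := fun g => g) hm le_rfl, ramp_zero_sub_ramp_one (by linarith),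
        mul_one]
      · intro g hg
        rw [mem_monics] at hg
        exact ⟨hg.1.ne_zero, hg.2.le⟩
      · intro D hD hDm
        simpa using card_monics_filter_dvd_sub hD hDm 0
      · intro j hj
        refine ramp_eq_zero ?_
        have : (m + 1) / 2 + 1 ≤ j := by omega
        exact_mod_cast this
    have s2 : ∑ g ∈ monics F m, altSum (ramp ((m + 1 : ℝ) / 2)) (f - g) =
        (Fintype.card F : ℝ) ^ m := by
      rw [sum_altSum_eq (N := m + 1) (u := fun g => f - g) hm (by omega),
        ramp_zero_sub_ramp_one (by linarith), mul_one]
      · intro g hg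
        rw [mem_monics] at hg
        obtain ⟨h1, h2⟩ := monic_sub_line hf (g := g) (by omega)
        exact ⟨h1.ne_zero, (h2.trans hfd).le⟩
      · intro D hD hDm
        rw [← card_monics_filter_dvd_sub hD hDm f]
        congr 1
        ext g
        rw [Finset.mem_filter, Finset.mem_filter, dvd_sub_comm]
      · intro j hj
        refine ramp_eq_zero ?_
        have : (m : ℝ) + 1 ≤ j := by exact_mod_cast hj
        linarith
    rw [s1, s2, ← mul_sub, abs_mul, abs_of_nonneg (by positivity), hfd] at h
    have hq : (0 : ℝ) < (Fintype.card F : ℝ) ^ m := by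
      have : (0 : ℝ) < Fintype.card F := by exact_mod_cast Fintype.card_pos
      positivity
    refine le_of_mul_le_mul_left ?_ hq
    calc _ = _ := by ring
      _ ≤ _ := h
      _ = _ := by push_cast; ring
  · intro i k hi hk
    have h1 := lt_of_ramp_ne_zero hi
    have h2 := lt_of_ramp_ne_zero hk
    have h3 : i < (m + 1) / 2 + 1 := by exact_mod_cast h1
    have h4 : 2 * k < m + 1 := by
      rw [lt_div_iff₀ two_pos] at h2
      have : ((2 * k : ℕ) : ℝ) < (m + 1 : ℕ) := by push_cast; linarith
      exact_mod_cast this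
    omega

theorem card_mul_abs_twisted_le {m d : ℕ} {f : F[X]} (hf : f.Monic)
    (hfd : f.natDegree = m + 1) (hdm : d < m) (hdq : d < Fintype.card F)
    {c₁ : ℝ} (hc₁ : c₁ ≤ m + 1) (hd : ∀ i k : ℕ, (i : ℝ) < c₁ → 2 * k < m + 1 → i + k ≤ d)
    {φ : F[X] → ℝ} (hφ : ∀ M : F[X], M.Monic → Squarefree M → M.natDegree = d →
      ∀ g ∈ monics F m, |∑ a : F, φ (g + C a * M)| ≤ 404 * (m + 1) * √(Fintype.card F)) :
    Fintype.card F * |∑ g ∈ monics F m, altSum (ramp c₁) g *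
        altSum (ramp ((m + 1 : ℝ) / 2)) (f - g) * φ g| ≤
      404 * √(Fintype.card F) *
        (2 ^ (m + (m + 1)) * (m + 1) ^ 3 * (Fintype.card F : ℝ) ^ m) := by
  have hm' : (0 : ℝ) ≤ m := Nat.cast_nonneg m
  have h := card_mul_abs_sum_altSum_mul_le (w₁ := ramp c₁)
    (w₂ := ramp ((m + 1 : ℝ) / 2)) (c := m + 1)
    (fun j => abs_ramp_le hc₁ (by positivity) j)
    (fun j => abs_ramp_le (by linarith) (by positivity) j) hf (by omega) hdm hdq ?_
    (by positivity) hφ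
  · rw [hfd] at h
    refine h.trans_eq (by ring)
  · intro i k hi hk
    refine hd i k (lt_of_ramp_ne_zero hi) ?_
    have h2 := lt_of_ramp_ne_zero hk
    rw [lt_div_iff₀ two_pos] at h2
    have : ((2 * k : ℕ) : ℝ) < (m + 1 : ℕ) := by push_cast; linarith
    exact_mod_cast this

theorem card_mul_abs_sum_pairDetector_sub_le (hq : Odd (Fintype.card F)) {m : ℕ} (hm : 1 ≤ m)
    (hmq : m ≤ Fintype.card F) {f : F[X]} (hf : f.Monic) (hfd : f.natDegree = m + 1) :
    Fintype.card F * |∑ g ∈ monics F m, pairDetector m g (f - g) - (Fintype.card F : ℝ) ^ m| ≤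
      (2 + 1212 * √(Fintype.card F)) *
        (2 ^ (m + (m + 1)) * (m + 1) ^ 3 * (Fintype.card F : ℝ) ^ m) := by
  have hm' : (1 : ℝ) ≤ m := by exact_mod_cast hm
  have k1 := card_mul_abs_main_sub_le hm hf hfd
  have k2 : Fintype.card F * |∑ g ∈ monics F m, altSum (ramp (m - (((m + 1) / 2 : ℕ) + 1))) g *
        altSum (ramp ((m + 1 : ℝ) / 2)) (f - g) * mob g| ≤
      404 * √(Fintype.card F) *
        (2 ^ (m + (m + 1)) * (m + 1) ^ 3 * (Fintype.card F : ℝ) ^ m) := by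
    have hlt : ∀ i : ℕ, (i : ℝ) < m - (((m + 1) / 2 : ℕ) + 1) → i + (m + 1) / 2 + 1 < m := by
      intro i hi
      have : ((i + (m + 1) / 2 + 1 : ℕ) : ℝ) < m := by push_cast at hi ⊢; linarith
      exact_mod_cast this
    obtain rfl | hm2 := hm.eq_or_lt
    · rw [Finset.sum_eq_zero fun g _ => ?_]
      · rw [abs_zero, mul_zero]; positivity
      · rw [altSum, Finset.sum_eq_zero, zero_mul, zero_mul]
        intro T _
        rw [ramp_eq_zero, mul_zero]
        by_contra hcon
        have := hlt _ (not_le.1 hcon)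
        omega
    · refine card_mul_abs_twisted_le (d := m - 2) hf hfd (by omega) (by omega)
        (by linarith [(Nat.cast_nonneg ((m + 1) / 2) : (0 : ℝ) ≤ ((m + 1) / 2 : ℕ))]) ?_ ?_
      · intro i k hi hk
        have := hlt i hi
        omega
      · intro M hM hMs hd g hg
        exact abs_sum_mob_line_le hq hg hM hMs (by omega)
  have hhalf : ∀ i k : ℕ, (i : ℝ) < (m : ℝ) / 2 → 2 * k < m + 1 → i + k ≤ m - 1 := by
    intro i k hi hk
    rw [lt_div_iff₀ two_pos] at hi
    have : i * 2 < m := by exact_mod_cast hi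
    omega
  have k3 := card_mul_abs_twisted_le (d := m - 1) hf hfd (by omega) (by omega) (c₁ := (m : ℝ) / 2)
    (by linarith) hhalf (φ := fun g => (mob (f - g) : ℝ)) fun M hM hMs hd g hg =>
      abs_sum_mob_sub_line_le hq hf hfd hg hM hMs (by omega)
  have k4 := card_mul_abs_twisted_le (d := m - 1) hf hfd (by omega) (by omega) (c₁ := (m : ℝ) / 2)
    (by linarith) hhalf (φ := fun g => ((mob g * mob (f - g) : ℤ) : ℝ)) fun M hM hMs hd g hg =>
      abs_sum_mob_mul_mob_line_le hq hf hfd hg hM hMs (by omega)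
  simp only [pairDetector, Finset.sum_add_distrib, Finset.sum_sub_distrib]
  have hQ : (0 : ℝ) ≤ Fintype.card F := Nat.cast_nonneg _
  rw [← abs_of_nonneg hQ, ← abs_mul, abs_of_nonneg hQ] at k1 k2 k3 k4 ⊢
  rw [abs_le] at k1 k2 k3 k4 ⊢
  constructor <;> nlinarith [k1.1, k1.2, k2.1, k2.2, k3.1, k3.2, k4.1, k4.2]

open scoped Classical in
/-- The monic irreducible `g` of degree `m` such that `f - g` is irreducible. -/
noncomputable def goldbachSummands (f : F[X]) (m : ℕ) : Finset F[X] :=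
  (monics F m).filter fun g => Irreducible g ∧ Irreducible (f - g)

theorem card_mul_abs_card_sub_sum_pairDetector_le (hq : Odd (Fintype.card F)) {m : ℕ} (hm : 1 ≤ m)
    (hmq : m ≤ Fintype.card F) {f : F[X]} (hf : f.Monic) (hfd : f.natDegree = m + 1) :
    Fintype.card F * |(goldbachSummands f m).card * ((m : ℝ) * (m + 1)) -
        ∑ g ∈ monics F m, pairDetector m g (f - g)| ≤
      24 * (2 ^ (m + (m + 1)) * (m + 1) ^ 3 * (Fintype.card F : ℝ) ^ m) := by
  classical
  have hQ : (0 : ℝ) ≤ Fintype.card F := Nat.cast_nonneg _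
  set W : ℝ := 4 * (2 ^ (m + (m + 1)) * (m + 1) ^ 2) with hW
  have hW0 : 0 ≤ W := by positivity
  have h1 : (goldbachSummands f m).card * ((m : ℝ) * (m + 1)) =
      ∑ g ∈ monics F m, if Irreducible g ∧ Irreducible (f - g) then (m : ℝ) * (m + 1) else 0 := by
    rw [goldbachSummands, ← Finset.sum_filter, Finset.sum_const, nsmul_eq_mul]
  have h2 : ∀ g ∈ monics F m,
      |(if Irreducible g ∧ Irreducible (f - g) then (m : ℝ) * (m + 1) else 0) -
        pairDetector m g (f - g)| ≤
      (if mob g = 0 then W else 0) + if mob (f - g) = 0 then W else 0 := by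
    intro g hg
    rw [mem_monics] at hg
    obtain ⟨hfg, hfgd⟩ := monic_sub_line hf (g := g) (by omega)
    rw [hfd] at hfgd
    by_cases hgs : Squarefree g
    · by_cases hfs : Squarefree (f - g)
      · rw [pairDetector_eq hm hg.1 hg.2 hfg hfgd hgs hfs, sub_self, abs_zero]
        positivity
      · rw [if_neg fun h => hfs h.2.squarefree, if_pos (mob_eq_zero_iff.2 hfs), zero_sub, abs_neg]
        have := abs_pairDetector_le hm hg.1 hg.2 hfg hfgd
        split_ifs <;> linarith
    · rw [if_neg fun h => hgs h.1.squarefree, if_pos (mob_eq_zero_iff.2 hgs), zero_sub, abs_neg]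
      have := abs_pairDetector_le hm hg.1 hg.2 hfg hfgd
      split_ifs <;> linarith
  have h3 := (Finset.abs_sum_le_sum_abs _ _).trans (Finset.sum_le_sum h2)
  rw [Finset.sum_sub_distrib, ← h1, Finset.sum_add_distrib, ← Finset.sum_filter,
    ← Finset.sum_filter, Finset.sum_const, Finset.sum_const, nsmul_eq_mul, nsmul_eq_mul] at h3
  have b1 := card_mul_card_mob_eq_zero_le hq hm hmq
  have b2 := card_mul_card_mob_sub_eq_zero_le hq hm hmq hf hfd
  push_cast at b1 b2
  calc _ ≤ _ := mul_le_mul_of_nonneg_left h3 hQ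
    _ = W * (Fintype.card F * ((monics F m).filter fun g => mob g = 0).card +
        Fintype.card F * ((monics F m).filter fun g => mob (f - g) = 0).card) := by ring
    _ ≤ W * (3 * (m + 1) * (Fintype.card F : ℝ) ^ m + 3 * (m + 1) * (Fintype.card F : ℝ) ^ m) :=
        mul_le_mul_of_nonneg_left (add_le_add b1 b2) hW0
    _ = _ := by rw [hW]; ring

/-- An asymptotic Goldbach count with square-root saving in the size of the field. -/
theorem card_mul_abs_card_goldbachSummands_sub_le (hq : Odd (Fintype.card F)) {m : ℕ} (hm : 1 ≤ m)
    {f : F[X]} (hf : f.Monic) (hfd : f.natDegree = m + 1) :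
    Fintype.card F * |(goldbachSummands f m).card * ((m : ℝ) * (m + 1)) -
        (Fintype.card F : ℝ) ^ m| ≤
      1238 * √(Fintype.card F) *
        (2 ^ (m + (m + 1)) * (m + 1) ^ 3 * (Fintype.card F : ℝ) ^ m) := by
  have hm' : (1 : ℝ) ≤ m := by exact_mod_cast hm
  set q : ℝ := (Fintype.card F : ℝ) with hQ
  have hQ1 : (1 : ℝ) ≤ q := by rw [hQ]; exact_mod_cast Fintype.card_pos
  have hs : 1 ≤ √q := Real.one_le_sqrt.2 hQ1
  have hT : 0 ≤ 2 ^ (m + (m + 1)) * ((m : ℝ) + 1) ^ 3 * q ^ m := by positivity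
  obtain hmq | hmq := le_or_gt m (Fintype.card F)
  · have h1 := card_mul_abs_sum_pairDetector_sub_le hq hm hmq hf hfd
    have h2 := card_mul_abs_card_sub_sum_pairDetector_le hq hm hmq hf hfd
    rw [← hQ] at h1 h2
    have h3 := abs_sub_le ((goldbachSummands f m).card * ((m : ℝ) * (m + 1)))
      (∑ g ∈ monics F m, pairDetector m g (f - g)) (q ^ m)
    nlinarith
  · have hc : ((goldbachSummands f m).card : ℝ) ≤ q ^ m := by
      have : (goldbachSummands f m).card ≤ Fintype.card F ^ m := by
        classical
        rw [← card_monics m, goldbachSummands]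
        exact Finset.card_filter_le _ _
      rw [hQ]
      exact_mod_cast this
    have hqm : q ≤ m := by rw [hQ]; exact_mod_cast hmq.le
    have hP : 0 ≤ q ^ m := by positivity
    have h1 : |(goldbachSummands f m).card * ((m : ℝ) * (m + 1)) - q ^ m| ≤
        q ^ m * ((m : ℝ) + 1) ^ 2 := by
      have h0 : (0 : ℝ) ≤ (goldbachSummands f m).card * ((m : ℝ) * (m + 1)) := by positivity
      have h2 : (goldbachSummands f m).card * ((m : ℝ) * (m + 1)) ≤ q ^ m * ((m : ℝ) + 1) ^ 2 := by
        gcongr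
        nlinarith
      have h3 : q ^ m * 1 ≤ q ^ m * ((m : ℝ) + 1) ^ 2 := by
        gcongr
        nlinarith
      rw [abs_le]
      constructor <;> linarith
    calc _ ≤ ((m : ℝ) + 1) * (q ^ m * ((m : ℝ) + 1) ^ 2) := by gcongr; linarith
      _ = 1 * 1 * (1 * ((m : ℝ) + 1) ^ 3 * q ^ m) := by ring
      _ ≤ _ := by
        gcongr
        · norm_num
        · exact one_le_pow₀ one_le_two

end GoldbachCount

section BivariateLines

variable {F : Type*} [Field F]

/-- Restriction of a bivariate polynomial to the line `x = t + b`. -/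
noncomputable def lineEval (b : F) : MvPolynomial (Fin 2) F →ₐ[F] F[X] :=
  MvPolynomial.aeval ![X + C b, X]

/-- A univariate polynomial in `t`, seen as a bivariate one. -/
noncomputable def liftSnd : F[X] →ₐ[F] MvPolynomial (Fin 2) F :=
  aeval (MvPolynomial.X 1)

/-- The linear form `x - t - b`. -/
noncomputable def lineForm (b : F) : MvPolynomial (Fin 2) F :=
  MvPolynomial.X 0 - MvPolynomial.X 1 - MvPolynomial.C b

theorem natDegree_lineEval_le (b : F) (f : MvPolynomial (Fin 2) F) :
    (lineEval b f).natDegree ≤ f.totalDegree := by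
  have h := MvPolynomial.aeval_natDegree_le f le_rfl (![X + C b, X] : Fin 2 → F[X]) (n := 1)
    (by intro i; fin_cases i <;> simp)
  simpa [lineEval] using h

theorem lineEval_liftSnd (b : F) (g : F[X]) : lineEval b (liftSnd g) = g := by
  have : (lineEval b).comp liftSnd = AlgHom.id F F[X] := by
    ext
    simp [lineEval, liftSnd]
  exact DFunLike.congr_fun this g

theorem totalDegree_liftSnd_le (g : F[X]) : (liftSnd g).totalDegree ≤ g.natDegree := by
  rw [liftSnd, aeval_eq_sum_range]
  refine MvPolynomial.totalDegree_finsetSum_le fun i hi => ?_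
  refine (MvPolynomial.totalDegree_smul_le _ _).trans ?_
  rw [MvPolynomial.totalDegree_X_pow]
  exact Nat.lt_succ_iff.1 (Finset.mem_range.1 hi)

theorem lineEval_lineForm (b b' : F) : lineEval b' (lineForm b) = C (b' - b) := by
  simp [lineEval, lineForm]

theorem totalDegree_lineForm_le (b : F) : (lineForm b).totalDegree ≤ 1 := by
  refine (MvPolynomial.totalDegree_sub _ _).trans (max_le ?_ (by simp))
  refine (MvPolynomial.totalDegree_sub _ _).trans (max_le ?_ ?_) <;>
    rw [MvPolynomial.totalDegree_X]

theorem lineForm_ne_zero (b : F) : lineForm b ≠ 0 := by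
  intro h
  have := lineEval_lineForm b (b + 1)
  rw [h, map_zero] at this
  simp at this

theorem totalDegree_lineForm (b : F) : (lineForm b).totalDegree = 1 := by
  refine le_antisymm (totalDegree_lineForm_le b) ?_
  by_contra hlt
  have h0 : (lineForm b).totalDegree = 0 := by omega
  rw [MvPolynomial.totalDegree_eq_zero_iff_eq_C] at h0
  have h1 := congrArg (MvPolynomial.eval ![0, 0]) h0
  have h2 := congrArg (MvPolynomial.eval ![1, 0]) h0
  simp only [lineForm, map_sub, MvPolynomial.eval_X, MvPolynomial.eval_C] at h1 h2
  rw [← h1] at h2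
  simp at h2

theorem lineForm_dvd_sub (b : F) (f : MvPolynomial (Fin 2) F) :
    lineForm b ∣ f - liftSnd (lineEval b f) := by
  induction f using MvPolynomial.induction_on with
  | C a => simp [lineEval, liftSnd]
  | add p q hp hq =>
    rw [map_add, map_add, add_sub_add_comm]
    exact dvd_add hp hq
  | mul_X p i hp =>
    have hX : lineForm b ∣ MvPolynomial.X i - liftSnd (lineEval b (MvPolynomial.X i)) := by
      fin_cases i
      · simp [lineEval, liftSnd, lineForm, sub_sub]
      · simp [lineEval, liftSnd]
    rw [map_mul, map_mul]
    have : p * MvPolynomial.X i -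
        liftSnd (lineEval b p) * liftSnd (lineEval b (MvPolynomial.X i)) =
        (p - liftSnd (lineEval b p)) * MvPolynomial.X i + liftSnd (lineEval b p) *
          (MvPolynomial.X i - liftSnd (lineEval b (MvPolynomial.X i))) := by ring
    rw [this]
    exact dvd_add (hp.mul_right _) (hX.mul_left _)

/-- Bivariate `f` of degree `m`, monic of degree `m` on all lines `x = t + b`, with a marked line
on which it equals `g`. -/
def IsMarkedLift (m : ℕ) (g : F[X]) (p : MvPolynomial (Fin 2) F × F) : Prop :=
  p.1.totalDegree = m ∧ (∀ b, (lineEval b p.1).Monic ∧ (lineEval b p.1).natDegree = m) ∧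
    lineEval p.2 p.1 = g

theorem lineEval_lift_add (b b' : F) (g : F[X]) (r : MvPolynomial (Fin 2) F) :
    lineEval b' (liftSnd g + lineForm b * r) = g + C (b' - b) * lineEval b' r := by
  rw [map_add, map_mul, lineEval_liftSnd, lineEval_lineForm]

theorem isMarkedLift_add {m : ℕ} {g : F[X]} (hg : g.Monic) (hgm : g.natDegree = m + 1) (b : F)
    {r : MvPolynomial (Fin 2) F} (hr : r.totalDegree ≤ m) :
    IsMarkedLift (m + 1) g (liftSnd g + lineForm b * r, b) := by
  have hline : ∀ b', (lineEval b' (liftSnd g + lineForm b * r)).Monic ∧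
      (lineEval b' (liftSnd g + lineForm b * r)).natDegree = m + 1 := by
    intro b'
    rw [lineEval_lift_add, ← hgm]
    exact monic_line hg (by have := natDegree_lineEval_le b' r; omega) _
  refine ⟨le_antisymm ?_ ?_, hline, ?_⟩
  · refine (MvPolynomial.totalDegree_add _ _).trans (max_le ?_ ?_)
    · exact (totalDegree_liftSnd_le g).trans hgm.le
    · refine (MvPolynomial.totalDegree_mul _ _).trans ?_
      rw [totalDegree_lineForm]
      omega
  · exact (hline b).2.ge.trans (natDegree_lineEval_le b _)
  · rw [lineEval_lift_add, sub_self, C_0, zero_mul, add_zero]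

theorem IsMarkedLift.exists_eq {m : ℕ} {g : F[X]} (hgm : g.natDegree = m + 1)
    {p : MvPolynomial (Fin 2) F × F} (hp : IsMarkedLift (m + 1) g p) :
    ∃ r : MvPolynomial (Fin 2) F, r.totalDegree ≤ m ∧ p.1 = liftSnd g + lineForm p.2 * r := by
  obtain ⟨hdeg, -, rfl⟩ := hp
  obtain ⟨r, hr⟩ := lineForm_dvd_sub p.2 p.1
  refine ⟨r, ?_, by rw [← hr]; ring⟩
  obtain rfl | h0 := eq_or_ne r 0
  · simp
  have h1 : (p.1 - liftSnd (lineEval p.2 p.1)).totalDegree ≤ m + 1 :=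
    (MvPolynomial.totalDegree_sub _ _).trans
      (max_le hdeg.le ((totalDegree_liftSnd_le _).trans hgm.le))
  rw [hr, MvPolynomial.totalDegree_mul_of_isDomain (lineForm_ne_zero _) h0,
    totalDegree_lineForm] at h1
  omega

theorem card_finsupp_sum_le (k : ℕ) :
    Nat.card {d : Fin 2 →₀ ℕ | (d.sum fun _ e => e) ≤ k} = (k + 2).choose 2 := by
  have hsum : ∀ d : Fin 2 →₀ ℕ, (d.sum fun _ e => e) = d 0 + d 1 := fun d => by
    rw [Finsupp.sum_fintype _ _ fun _ => rfl, Fin.sum_univ_two]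
  let S : Finset (Σ _ : ℕ, ℕ) := (Finset.range (k + 1)).sigma fun i => Finset.range (k + 1 - i)
  have e : {d : Fin 2 →₀ ℕ | (d.sum fun _ e => e) ≤ k} ≃ S :=
    { toFun := fun d => ⟨⟨d.1 0, d.1 1⟩, by
        have := d.2
        rw [Set.mem_ofPred_eq, hsum] at this
        simp only [S, Finset.mem_sigma, Finset.mem_range]
        omega⟩
      invFun := fun x => ⟨Finsupp.equivFunOnFinite.symm ![x.1.1, x.1.2], by
        have := x.2
        simp only [S, Finset.mem_sigma, Finset.mem_range] at this
        rw [Set.mem_ofPred_eq, hsum]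
        simp
        omega⟩
      left_inv := fun d => by
        ext i
        fin_cases i <;> simp
      right_inv := fun x => by simp }
  rw [Nat.card_congr e, Nat.card_eq_fintype_card, Fintype.card_coe, Finset.card_sigma]
  simp only [Finset.card_range]
  rw [← Finset.sum_range_reflect, Nat.choose_two_right, ← Finset.sum_range_id_mul_two]
  rw [Nat.mul_div_cancel _ two_pos, Finset.sum_range_succ' _ (k + 1)]
  refine (Finset.sum_congr rfl fun i hi => ?_).trans (add_zero _).symm
  have := Finset.mem_range.1 hi
  omega

theorem natCard_restrictTotalDegree [Finite F] (k : ℕ) :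
    Nat.card (MvPolynomial.restrictTotalDegree (Fin 2) F k) =
      Nat.card F ^ (k + 2).choose 2 := by
  have h := Module.finrank_eq_nat_card_basis
    (MvPolynomial.basisRestrictSupport F {d : Fin 2 →₀ ℕ | (d.sum fun _ e => e) ≤ k})
  rw [card_finsupp_sum_le] at h
  rw [Module.natCard_eq_pow_finrank (K := F), ← h]
  rfl

theorem natCard_isMarkedLift [Finite F] {m : ℕ} {g : F[X]} (hg : g.Monic)
    (hgm : g.natDegree = m + 1) :
    Nat.card {p // IsMarkedLift (m + 1) g p} = Nat.card F ^ ((m + 2).choose 2 + 1) := by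
  rw [pow_succ, ← natCard_restrictTotalDegree, ← Nat.card_prod]
  symm
  refine Nat.card_eq_of_bijective (fun x => ⟨(liftSnd g + lineForm x.2 * x.1.1, x.2),
    isMarkedLift_add hg hgm x.2 ((MvPolynomial.mem_restrictTotalDegree _ _ _).1 x.1.2)⟩) ⟨?_, ?_⟩
  · rintro ⟨⟨r, hr⟩, b⟩ ⟨⟨r', hr'⟩, b'⟩ h
    simp only [Subtype.mk.injEq, Prod.mk.injEq] at h
    obtain ⟨h, rfl⟩ := h
    have := mul_left_cancel₀ (lineForm_ne_zero b) (add_left_cancel h)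
    subst this
    rfl
  · rintro ⟨⟨f, b⟩, hp⟩
    obtain ⟨r, hr, h⟩ := hp.exists_eq hgm
    exact ⟨(⟨r, (MvPolynomial.mem_restrictTotalDegree _ _ _).2 hr⟩, b),
      Subtype.ext (Prod.ext h.symm rfl)⟩

end BivariateLines

section Final

theorem two_pow_mul_cube_le (m : ℕ) :
    (2 : ℝ) ^ (m + (m + 1)) * (m + 1) ^ 3 ≤ 16 * Real.exp 32 * m.factorial := by
  have h1 : ((m : ℝ) + 1) ≤ 2 ^ (m + 1) := by
    exact_mod_cast (Nat.lt_two_pow_self (n := m + 1)).le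
  have h2 := Real.pow_div_factorial_le_exp 32 (by norm_num) m
  rw [div_le_iff₀ (by positivity)] at h2
  calc (2 : ℝ) ^ (m + (m + 1)) * (m + 1) ^ 3 ≤ 2 ^ (m + (m + 1)) * (2 ^ (m + 1)) ^ 3 := by gcongr
    _ = 16 * (2 ^ 5) ^ m := by rw [← pow_mul (2 : ℝ) 5]; ring
    _ = 16 * 32 ^ m := by norm_num
    _ ≤ _ := by linarith

open scoped Classical in
theorem coe_goldbachSummands {F : Type*} [Field F] [Fintype F] {m : ℕ} {f : F[X]} (hf : f.Monic)
    (hfd : m < f.natDegree) :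
    {g : F[X] | g.Monic ∧ Irreducible g ∧ g.natDegree = m ∧ (f - g).Monic ∧ Irreducible (f - g)} =
      goldbachSummands f m := by
  ext g
  simp only [goldbachSummands, Finset.coe_filter, mem_monics, Set.mem_ofPred_eq]
  refine ⟨fun h => ⟨⟨h.1, h.2.2.1⟩, h.2.1, h.2.2.2.2⟩, fun h => ⟨h.1.1, h.2.1, h.1.2, ?_, h.2.2⟩⟩
  exact (monic_sub_line hf (by rw [h.1.2]; exact hfd)).1

/-- Rescaling the Goldbach count by a power of `q`. -/
theorem abs_mul_pow_sub_le {q R A : ℝ} {m e : ℕ} (hm : 1 ≤ m) (hq : 0 < q)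
    (h : q * |R * ((m : ℝ) * (m + 1)) - q ^ m| ≤ A * q ^ m) :
    |R * q ^ (e + 1) - q ^ (m + e + 1) / ((m + 1) * m)| ≤ A * q ^ (m + e) := by
  have hm' : (1 : ℝ) ≤ m := by exact_mod_cast hm
  have hmm : 1 ≤ (m : ℝ) * (m + 1) := by nlinarith
  have h1 : R * q ^ (e + 1) - q ^ (m + e + 1) / ((m + 1) * m) =
      q ^ e * (q * (R * ((m : ℝ) * (m + 1)) - q ^ m)) / (m * (m + 1)) := by
    field_simp
    ring
  rw [h1, abs_div, abs_mul, abs_mul, abs_of_pos hq, abs_of_pos (pow_pos hq e),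
    abs_of_pos (by linarith : (0 : ℝ) < m * (m + 1))]
  calc _ ≤ q ^ e * (q * |R * ((m : ℝ) * (m + 1)) - q ^ m|) := div_le_self (by positivity) hmm
    _ ≤ q ^ e * (A * q ^ m) := by gcongr
    _ = _ := by ring

end Final

/-- **Lemma 2.**  Let `F_q` be a finite field of odd order `q`, `F ∈ F_q[t]` monic of degree
`n ≥ 2`, `I := C(n+1,2) − 1`, `N := (n−1)!·n!`, and let `𝓡` be the set of monic irreducible
`g` of degree `n−1` with `F − g` monic irreducible.  Then, with absolute constants
`C₁, C₂ > 0`,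
`|Σ_{g ∈ 𝓡} N_g − q^(I+1)/(n(n−1))| ≤ C₁·N·q^(I+1/2) + C₂·n·2^(C(n+2,2))·q^I`,
where `N_g` counts pairs `(f, b) ∈ 𝓕 × F_q` with `f(t+b,t) = g`. -/
theorem sum_Ng_over_goldbach_summands :
    ∃ C₁ C₂ : ℝ, 0 < C₁ ∧ 0 < C₂ ∧
      ∀ (Fq : Type) [Field Fq] [Fintype Fq], Odd (Fintype.card Fq) →
      ∀ (n : ℕ), 2 ≤ n → ∀ F : Polynomial Fq, F.Monic → F.natDegree = n →
      |(∑ᶠ g ∈ {g : Polynomial Fq | g.Monic ∧ Irreducible g ∧ g.natDegree = n - 1 ∧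
              (F - g).Monic ∧ Irreducible (F - g)},
          (Nat.card {p : MvPolynomial (Fin 2) Fq × Fq //
              p.1.totalDegree = n - 1 ∧
              (∀ b : Fq,
                (MvPolynomial.aeval ![Polynomial.X + Polynomial.C b, Polynomial.X] p.1 :
                    Polynomial Fq).Monic ∧
                (MvPolynomial.aeval ![Polynomial.X + Polynomial.C b, Polynomial.X] p.1 :
                    Polynomial Fq).natDegree = n - 1) ∧
              (MvPolynomial.aeval ![Polynomial.X + Polynomial.C p.2, Polynomial.X] p.1 :
                  Polynomial Fq) = g} : ℝ))
          - (Fintype.card Fq : ℝ) ^ (Nat.choose (n + 1) 2 - 1 + 1) / (n * (n - 1))|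
        ≤ C₁ * ((n - 1).factorial * n.factorial) *
            (Fintype.card Fq : ℝ) ^ (((Nat.choose (n + 1) 2 - 1 : ℕ) : ℝ) + 1 / 2)
          + C₂ * n * 2 ^ (Nat.choose (n + 2) 2) *
            (Fintype.card Fq : ℝ) ^ (Nat.choose (n + 1) 2 - 1) := by
  refine ⟨1238 * (16 * Real.exp 32), 1, by positivity, one_pos, ?_⟩
  intro Fq _ _ hq n hn f hf hfd
  classical
  obtain ⟨k, rfl⟩ := Nat.exists_eq_add_of_le' hn
  have hQ : (0 : ℝ) < Fintype.card Fq := by exact_mod_cast Fintype.card_pos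
  have hchoose : (k + 2 + 1).choose 2 - 1 = k + 1 + (k + 2).choose 2 := by
    have h : (k + 2 + 1).choose 2 = (k + 2).choose 1 + (k + 2).choose 2 := Nat.choose_succ_succ' _ _
    rw [Nat.choose_one_right] at h
    omega
  have hsum : (∑ᶠ g ∈ {g : Polynomial Fq | g.Monic ∧ Irreducible g ∧ g.natDegree = k + 2 - 1 ∧
      (f - g).Monic ∧ Irreducible (f - g)},
      (Nat.card {p // IsMarkedLift (k + 2 - 1) g p} : ℝ)) =
      (goldbachSummands f (k + 1)).card * (Fintype.card Fq : ℝ) ^ ((k + 2).choose 2 + 1) := by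
    rw [show k + 2 - 1 = k + 1 from rfl, coe_goldbachSummands hf (by omega),
      finsum_mem_coe_finset, ← nsmul_eq_mul]
    refine Finset.sum_eq_card_nsmul fun g hg => ?_
    have hg' := (mem_monics.1 (Finset.mem_filter.1 hg).1)
    rw [natCard_isMarkedLift hg'.1 hg'.2, Nat.card_eq_fintype_card]
    push_cast
    rfl
  have hcount := card_mul_abs_card_goldbachSummands_sub_le hq (m := k + 1) (by omega) hf hfd
  rw [← mul_assoc (1238 * _)] at hcount
  have hmain := abs_mul_pow_sub_le (m := k + 1) (e := (k + 2).choose 2) (by omega) hQ hcount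
  change |(∑ᶠ g ∈ {g : Polynomial Fq | g.Monic ∧ Irreducible g ∧ g.natDegree = k + 2 - 1 ∧
      (f - g).Monic ∧ Irreducible (f - g)},
      (Nat.card {p // IsMarkedLift (k + 2 - 1) g p} : ℝ)) - _| ≤ _
  have hdenom : ((k + 2 : ℕ) : ℝ) * ((k + 2 : ℕ) - 1) = (((k + 1 : ℕ) : ℝ) + 1) * (k + 1 : ℕ) := by
    push_cast; ring
  rw [hsum, hchoose, hdenom, Real.rpow_add hQ, Real.rpow_natCast, ← Real.sqrt_eq_rpow]
  have hfac : (1 : ℝ) ≤ (k + 2).factorial := by exact_mod_cast Nat.succ_le_of_lt (Nat.factorial_pos _)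
  have hnum := two_pow_mul_cube_le (k + 1)
  calc _ ≤ _ := hmain
    _ = 1238 * (2 ^ (k + 1 + (k + 1 + 1)) * (((k + 1 : ℕ) : ℝ) + 1) ^ 3) * 1 *
        ((Fintype.card Fq : ℝ) ^ (k + 1 + (k + 2).choose 2) * √(Fintype.card Fq)) := by ring
    _ ≤ 1238 * (16 * Real.exp 32 * (k + 1).factorial) * (k + 2).factorial *
        ((Fintype.card Fq : ℝ) ^ (k + 1 + (k + 2).choose 2) * √(Fintype.card Fq)) := by gcongr
    _ = 1238 * (16 * Real.exp 32) * ((k + 2 - 1).factorial * (k + 2).factorial) *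
        ((Fintype.card Fq : ℝ) ^ (k + 1 + (k + 2).choose 2) * √(Fintype.card Fq)) := by
      rw [show k + 2 - 1 = k + 1 from rfl]; ring
    _ ≤ _ := le_add_of_nonneg_right (by positivity)
end

section
/- Let F_q be a finite field and n ≥ 2. The set 𝓕 of bivariate polynomials f(x,t) ∈ F_q[x,t] of total degree n−1 such that f(t+b,t) is a monic polynomial of degree n−1 in t for every b ∈ F_q has cardinality exactly q^(binomial(n+1,2) − 1). -/
open Polynomial

namespace MvPolynomial

section

variable {R : Type*} [CommRing R]

theorem natDegree_aeval_shift_le (f : MvPolynomial (Fin 2) R) (b : R) :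
    (aeval ![Polynomial.X + Polynomial.C b, Polynomial.X] f : R[X]).natDegree ≤ f.totalDegree := by
  rw [aeval_def, eval₂_eq']
  refine Polynomial.natDegree_sum_le_of_forall_le _ _ fun d hd => ?_
  have h := le_totalDegree hd
  rw [Finsupp.sum_fintype _ _ (fun _ => rfl), Fin.sum_univ_two] at h
  rw [Fin.prod_univ_two]
  simp only [Matrix.cons_val_zero, Matrix.cons_val_one, ← Polynomial.C_eq_algebraMap]
  refine (Polynomial.natDegree_C_mul_le _ _).trans <| Polynomial.natDegree_mul_le.trans <|
    (add_le_add ?_ (Polynomial.natDegree_X_pow_le _)).trans h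
  compute_degree

theorem coeff_aeval_shift {f : MvPolynomial (Fin 2) R} {N : ℕ} (hf : f.totalDegree ≤ N) (b : R) :
    (aeval ![Polynomial.X + Polynomial.C b, Polynomial.X] f : R[X]).coeff N =
      (aeval ![Polynomial.X, Polynomial.X] f : R[X]).coeff N := by
  rw [aeval_def, eval₂_eq', aeval_def, eval₂_eq', Polynomial.finsetSum_coeff,
    Polynomial.finsetSum_coeff]
  refine Finset.sum_congr rfl fun d hd => ?_
  have h := (le_totalDegree hd).trans hf
  rw [Finsupp.sum_fintype _ _ (fun _ => rfl), Fin.sum_univ_two] at h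
  obtain ⟨k, rfl⟩ := Nat.exists_eq_add_of_le' h
  simp only [Fin.prod_univ_two, Matrix.cons_val_zero, Matrix.cons_val_one,
    ← Polynomial.C_eq_algebraMap, Polynomial.coeff_C_mul, ← add_assoc,
    Polynomial.coeff_mul_X_pow]
  congr 1
  rw [Polynomial.coeff_X_add_C_pow, Polynomial.coeff_X_pow]
  rcases Nat.eq_zero_or_pos k with rfl | hk
  · simp
  · rw [Nat.choose_eq_zero_of_lt (by omega), if_neg (by omega)]
    simp

end

theorem natCard_degree_le (N : ℕ) :
    Nat.card {d : Fin 2 →₀ ℕ // d.degree ≤ N} = (N + 2).choose 2 := by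
  let e : {d : Fin 2 →₀ ℕ // d.degree ≤ N} ≃
      Σ k : Fin (N + 1), Finset.HasAntidiagonal.antidiagonal (k : ℕ) :=
    { toFun := fun d => ⟨⟨d.1 0 + d.1 1, by
          have := d.2
          rw [Finsupp.degree_eq_sum, Fin.sum_univ_two] at this
          omega⟩, ⟨(d.1 0, d.1 1), by simp⟩⟩
      invFun := fun x => ⟨Finsupp.equivFunOnFinite.symm ![x.2.1.1, x.2.1.2], by
          have h := Finset.HasAntidiagonal.mem_antidiagonal.mp x.2.2
          rw [Finsupp.degree_eq_sum, Fin.sum_univ_two]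
          simp only [Finsupp.equivFunOnFinite_symm_apply_apply, Matrix.cons_val_zero,
            Matrix.cons_val_one]
          omega⟩
      left_inv := fun d => by
        ext i
        fin_cases i <;> rfl
      right_inv := fun ⟨⟨k, hk⟩, ⟨⟨a, b⟩, h⟩⟩ => by
        obtain rfl := Finset.HasAntidiagonal.mem_antidiagonal.mp h
        rfl }
  rw [Nat.card_congr e, Nat.card_eq_fintype_card, Fintype.card_sigma]
  simp only [Fintype.card_coe, Finset.Nat.card_antidiagonal]
  rw [Fin.sum_univ_eq_sum_range (fun k => k + 1) (N + 1)]
  clear e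
  induction N with
  | zero => rfl
  | succ N ih =>
    rw [Finset.sum_range_succ, ih, Nat.choose_succ_succ' (N + 2) 1, Nat.choose_one_right,
      add_comm]

theorem finrank_restrictTotalDegree (K : Type*) [Field K] (N : ℕ) :
    Module.finrank K (restrictTotalDegree (Fin 2) K N) = (N + 2).choose 2 := by
  exact (Module.finrank_eq_nat_card_basis (basisRestrictSupport K _)).trans
    (natCard_degree_le N)

end MvPolynomial

/-- A nonzero functional on a finite-dimensional space over a finite field takes the value `1`
exactly `q ^ (dim - 1)` times. -/
theorem Module.Dual.natCard_eq_one {K V : Type*} [Field K] [Finite K] [AddCommGroup V]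
    [Module K V] [FiniteDimensional K V] (φ : V →ₗ[K] K) {e : V} (he : φ e = 1) :
    Nat.card {v // φ v = 1} = Nat.card K ^ (Module.finrank K V - 1) := by
  let E : {v // φ v = 1} ≃ LinearMap.ker φ :=
    (Equiv.subRight e).subtypeEquiv fun v => by
      rw [LinearMap.mem_ker, Equiv.subRight_apply, map_sub, he, sub_eq_zero]
  have hr := LinearMap.finrank_range_add_finrank_ker φ
  have hs : LinearMap.range φ = ⊤ :=
    LinearMap.range_eq_top.mpr fun c => ⟨c • e, by simp [he]⟩
  rw [hs, finrank_top, Module.finrank_self] at hr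
  rw [Nat.card_congr E, Module.natCard_eq_pow_finrank (K := K), ← hr, Nat.add_sub_cancel_left]

/-- The family `𝓕` of bivariate polynomials `f(x,t) ∈ F_q[x,t]` of total degree `n−1` such
that `f(t+b,t)` is monic of degree `n−1` in `t` for every `b ∈ F_q` has cardinality
`q^(C(n+1,2) − 1)`. -/
theorem card_family (Fq : Type) [Field Fq] [Fintype Fq] (n : ℕ) (hn : 2 ≤ n) :
    Nat.card {f : MvPolynomial (Fin 2) Fq //
        f.totalDegree = n - 1 ∧
        ∀ b : Fq,
          (MvPolynomial.aeval ![Polynomial.X + Polynomial.C b, Polynomial.X] f :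
              Polynomial Fq).Monic ∧
          (MvPolynomial.aeval ![Polynomial.X + Polynomial.C b, Polynomial.X] f :
              Polynomial Fq).natDegree = n - 1}
      = Fintype.card Fq ^ (Nat.choose (n + 1) 2 - 1) := by
  obtain ⟨N, rfl⟩ : ∃ N, n = N + 1 := ⟨n - 1, by omega⟩
  rw [Nat.add_sub_cancel]
  let V := MvPolynomial.restrictTotalDegree (Fin 2) Fq N
  let φ : V →ₗ[Fq] Fq := Polynomial.lcoeff Fq N ∘ₗ
    (MvPolynomial.aeval ![(Polynomial.X : Fq[X]), Polynomial.X]).toLinearMap ∘ₗ V.subtype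
  have hφ (v : V) : φ v =
      (MvPolynomial.aeval ![(Polynomial.X : Fq[X]), Polynomial.X] v.1).coeff N := rfl
  have hV (f) : f ∈ V ↔ f.totalDegree ≤ N := MvPolynomial.mem_restrictTotalDegree _ _ _
  have hfin : Module.finrank Fq V = (N + 2).choose 2 :=
    MvPolynomial.finrank_restrictTotalDegree Fq N
  have he : φ ⟨MvPolynomial.X 1 ^ N, (hV _).mpr (by simp)⟩ = 1 := by
    rw [hφ]
    simp
  rw [← Nat.card_eq_fintype_card, show N + 1 + 1 = N + 2 from rfl, ← hfin,
    ← Module.Dual.natCard_eq_one φ he]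
  have key (f : MvPolynomial (Fin 2) Fq) : (f.totalDegree = N ∧ ∀ b : Fq,
      (MvPolynomial.aeval ![Polynomial.X + Polynomial.C b, Polynomial.X] f : Fq[X]).Monic ∧
      (MvPolynomial.aeval ![Polynomial.X + Polynomial.C b, Polynomial.X] f : Fq[X]).natDegree =
        N) ↔ ∃ h : f ∈ V, φ ⟨f, h⟩ = 1 := by
    constructor
    · rintro ⟨hd, hb⟩
      refine ⟨(hV f).mpr hd.le, ?_⟩
      obtain ⟨hm, hdeg⟩ := hb 0
      rw [hφ, ← MvPolynomial.coeff_aeval_shift hd.le 0, ← hdeg]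
      exact hm
    · rintro ⟨h, h1⟩
      rw [hV] at h
      have hc (b : Fq) := (MvPolynomial.coeff_aeval_shift h b).trans h1
      have hdeg (b : Fq) := Polynomial.le_natDegree_of_ne_zero (ne_of_eq_of_ne (hc b) one_ne_zero)
      have hle := MvPolynomial.natDegree_aeval_shift_le f
      refine ⟨h.antisymm ((hdeg 0).trans (hle 0)),
        fun b => ⟨?_, ((hle b).trans h).antisymm (hdeg b)⟩⟩
      exact Polynomial.monic_of_natDegree_le_of_coeff_eq_one N ((hle b).trans h) (hc b)
  exact Nat.card_congr <| (Equiv.subtypeEquivRight key).trans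
    (Equiv.subtypeSubtypeEquivSubtypeExists (· ∈ V) (φ · = 1)).symm
end

section
/- Let F_q be a finite field, n ≥ 2, b ∈ F_q, and let g ∈ F_q[t] be monic of degree n−1. Suppose c₁(x), …, c_{n−1}(x) ∈ F_q[x] satisfy deg cᵢ ≤ n−1−i for each 1 ≤ i ≤ n−1. Then there is a unique polynomial c₀(x) ∈ F_q[x] such that f(x,t) := Σ_{i=0}^{n−1} cᵢ(x)·tⁱ has total degree n−1 with f(t+b', t) monic of degree n−1 in t for every b' ∈ F_q, and f(t+b, t) = g(t); namely c₀(x) = g(x−b) − Σ_{i=1}^{n−1} cᵢ(x)·(x−b)ⁱ. -/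
open Polynomial

/-- Translating the variable does not change the coefficient at an upper bound for the degree. -/
theorem coeff_comp_X_add_C_of_natDegree_le {R : Type*} [CommRing R] (p : R[X])
    (a : R) {m : ℕ} (h : p.natDegree ≤ m) : (p.comp (X + C a)).coeff m = p.coeff m := by
  rw [← taylor_apply]
  rcases h.lt_or_eq with h | rfl
  · rw [coeff_eq_zero_of_natDegree_lt h,
      coeff_eq_zero_of_natDegree_lt (by rwa [natDegree_taylor])]
  · exact coeff_taylor_natDegree ..

theorem totalDegree_aeval_X_le {R σ : Type*} [CommRing R] [Nontrivial R] (j : σ) (p : R[X]) :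
    (aeval (MvPolynomial.X j : MvPolynomial σ R) p).totalDegree ≤ p.natDegree := by
  rw [aeval_eq_sum_range]
  refine MvPolynomial.totalDegree_finsetSum_le fun i hi => ?_
  refine (MvPolynomial.totalDegree_smul_le _ _).trans ?_
  rw [MvPolynomial.totalDegree_X_pow]
  exact Nat.lt_succ_iff.mp (Finset.mem_range.mp hi)

theorem aeval_aeval_X_zero {R : Type*} [CommRing R] (p u v : R[X]) :
    MvPolynomial.aeval ![u, v] (aeval (MvPolynomial.X 0 : MvPolynomial (Fin 2) R) p) =
      p.comp u := by
  rw [← aeval_algHom_apply, MvPolynomial.aeval_X, comp_eq_aeval]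
  rfl

/-- Let `F_q` be a finite field, `n ≥ 2`, `b ∈ F_q`, and `g ∈ F_q[t]` monic of degree `n−1`.
Given `c₁, …, c_{n−1} ∈ F_q[x]` with `deg cᵢ ≤ n−1−i`, there is a unique `c₀ ∈ F_q[x]`
such that `f(x,t) := Σ_{i=0}^{n−1} cᵢ(x) tⁱ` has total degree `n−1`, `f(t+b',t)` is monic
of degree `n−1` for every `b' ∈ F_q`, and `f(t+b,t) = g`; namely
`c₀(x) = g(x−b) − Σ_{i=1}^{n−1} cᵢ(x)(x−b)ⁱ`. -/
theorem unique_constant_coefficient (Fq : Type) [Field Fq] [Fintype Fq] (n : ℕ)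
    (hn : 2 ≤ n) (b : Fq) (g : Polynomial Fq) (hg : g.Monic) (hgdeg : g.natDegree = n - 1)
    (c : ℕ → Polynomial Fq) (hc : ∀ i, 1 ≤ i → i ≤ n - 1 → (c i).natDegree ≤ n - 1 - i) :
    ∀ c₀ : Polynomial Fq,
      ((Polynomial.aeval (MvPolynomial.X 0 : MvPolynomial (Fin 2) Fq) c₀ +
            ∑ i ∈ Finset.Ico 1 n,
              Polynomial.aeval (MvPolynomial.X 0 : MvPolynomial (Fin 2) Fq) (c i) *
                MvPolynomial.X 1 ^ i).totalDegree = n - 1 ∧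
        (∀ b' : Fq,
          (MvPolynomial.aeval ![Polynomial.X + Polynomial.C b', Polynomial.X]
              (Polynomial.aeval (MvPolynomial.X 0 : MvPolynomial (Fin 2) Fq) c₀ +
                ∑ i ∈ Finset.Ico 1 n,
                  Polynomial.aeval (MvPolynomial.X 0 : MvPolynomial (Fin 2) Fq) (c i) *
                    MvPolynomial.X 1 ^ i) : Polynomial Fq).Monic ∧
          (MvPolynomial.aeval ![Polynomial.X + Polynomial.C b', Polynomial.X]
              (Polynomial.aeval (MvPolynomial.X 0 : MvPolynomial (Fin 2) Fq) c₀ +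
                ∑ i ∈ Finset.Ico 1 n,
                  Polynomial.aeval (MvPolynomial.X 0 : MvPolynomial (Fin 2) Fq) (c i) *
                    MvPolynomial.X 1 ^ i) : Polynomial Fq).natDegree = n - 1) ∧
        (MvPolynomial.aeval ![Polynomial.X + Polynomial.C b, Polynomial.X]
            (Polynomial.aeval (MvPolynomial.X 0 : MvPolynomial (Fin 2) Fq) c₀ +
              ∑ i ∈ Finset.Ico 1 n,
                Polynomial.aeval (MvPolynomial.X 0 : MvPolynomial (Fin 2) Fq) (c i) *
                  MvPolynomial.X 1 ^ i) : Polynomial Fq) = g)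
      ↔ c₀ = g.comp (Polynomial.X - Polynomial.C b) -
          ∑ i ∈ Finset.Ico 1 n, c i * (Polynomial.X - Polynomial.C b) ^ i := by
  intro c₀
  set F : MvPolynomial (Fin 2) Fq := aeval (MvPolynomial.X 0 : MvPolynomial (Fin 2) Fq) c₀ +
    ∑ i ∈ Finset.Ico 1 n, aeval (MvPolynomial.X 0 : MvPolynomial (Fin 2) Fq) (c i) *
      MvPolynomial.X 1 ^ i with hF
  have hsub (a : Fq) : MvPolynomial.aeval ![X + C a, X] F =
      c₀.comp (X + C a) + ∑ i ∈ Finset.Ico 1 n, (c i).comp (X + C a) * X ^ i := by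
    simp only [hF, map_add, map_sum, map_mul, map_pow, aeval_aeval_X_zero, MvPolynomial.aeval_X]
    rfl
  constructor
  · rintro ⟨-, -, h⟩
    rw [← h, hsub]
    simp [comp_assoc]
  · intro h
    have hdeg : c₀.natDegree ≤ n - 1 := by
      rw [h]
      refine (natDegree_sub_le _ _).trans (max_le ?_ ?_)
      · rw [natDegree_comp, natDegree_X_sub_C, hgdeg, mul_one]
      · refine natDegree_sum_le_of_forall_le _ _ fun i hi => ?_
        obtain ⟨hi1, hi2⟩ := Finset.mem_Ico.mp hi
        have := hc i hi1 (by omega)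
        refine natDegree_mul_le.trans ?_
        rw [natDegree_pow, natDegree_X_sub_C]
        omega
    have hg_eq : MvPolynomial.aeval ![X + C b, X] F = g := by
      rw [hsub, h]
      simp [comp_assoc]
    have hle : F.totalDegree ≤ n - 1 := by
      refine (MvPolynomial.totalDegree_add _ _).trans
        (max_le ((totalDegree_aeval_X_le _ _).trans hdeg) ?_)
      refine MvPolynomial.totalDegree_finsetSum_le fun i hi => ?_
      obtain ⟨hi1, hi2⟩ := Finset.mem_Ico.mp hi
      have := hc i hi1 (by omega)
      have := totalDegree_aeval_X_le (0 : Fin 2) (c i)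
      refine (MvPolynomial.totalDegree_mul _ _).trans ?_
      rw [MvPolynomial.totalDegree_X_pow]
      omega
    have hnat {m : ℕ} (a : Fq) (hm : F.totalDegree ≤ m) :
        (MvPolynomial.aeval ![X + C a, X] F).natDegree ≤ m := by
      simpa using MvPolynomial.aeval_natDegree_le F hm ![X + C a, X] (n := 1)
        (by simp [Fin.forall_fin_two])
    have hcoeff (a : Fq) : (MvPolynomial.aeval ![X + C a, X] F).coeff (n - 1) =
        c₀.coeff (n - 1) + ∑ i ∈ Finset.Ico 1 n, (c i).coeff (n - 1 - i) := by
      rw [hsub, coeff_add, finsetSum_coeff, coeff_comp_X_add_C_of_natDegree_le _ _ hdeg]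
      congr 1
      refine Finset.sum_congr rfl fun i hi => ?_
      obtain ⟨hi1, hi2⟩ := Finset.mem_Ico.mp hi
      rw [coeff_mul_X_pow', if_pos (by omega),
        coeff_comp_X_add_C_of_natDegree_le _ _ (hc i hi1 (by omega))]
    have hone (a : Fq) : (MvPolynomial.aeval ![X + C a, X] F).coeff (n - 1) = 1 := by
      rw [hcoeff, ← hcoeff b, hg_eq, ← hgdeg]
      exact hg
    refine ⟨le_antisymm hle ?_, fun a => ⟨?_, ?_⟩, hg_eq⟩
    · rw [← hgdeg, ← hg_eq]
      exact hnat b le_rfl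
    · exact monic_of_natDegree_le_of_coeff_eq_one _ (hnat a hle) (hone a)
    · exact natDegree_eq_of_le_of_coeff_ne_zero (hnat a hle) (by rw [hone]; exact one_ne_zero)
end

section
/- Let K be an algebraically closed field of odd characteristic p and let n ≥ 2 with p | n. For every nonzero d ∈ K, the projective plane curve defined by the homogeneous polynomial G(X,T,Z) = 2Xⁿ + XZ^(n−1) − Tⁿ + dT^(n−1)Z is smooth: there is no point (x,t,z) ∈ K³ with (x,t,z) ≠ (0,0,0) at which G and all three partial derivatives ∂G/∂X, ∂G/∂T, ∂G/∂Z vanish simultaneously. -/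
open MvPolynomial

/-- **Smoothness of `2Xⁿ + XZ^(n−1) − Tⁿ + dT^(n−1)Z`.**  Let `K` be an algebraically
closed field of odd characteristic `p` and let `n ≥ 2` with `p ∣ n`.  For every nonzero
`d ∈ K`, the projective plane curve `G = 2Xⁿ + XZ^(n−1) − Tⁿ + dT^(n−1)Z = 0` is smooth:
no nonzero point of `K³` is a common zero of `G` and its three partial derivatives. -/
theorem smooth_char_dividing_n (K : Type) [Field K] [IsAlgClosed K] (n : ℕ) (hn : 2 ≤ n)
    (hodd : Odd (ringChar K)) (hp : ringChar K ∣ n) (d : K) (hd : d ≠ 0) :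
    ¬ ∃ x t z : K, ¬ (x = 0 ∧ t = 0 ∧ z = 0) ∧
      eval ![x, t, z] (C 2 * X 0 ^ n + X 0 * X 2 ^ (n - 1) - X 1 ^ n +
        C d * X 1 ^ (n - 1) * X 2 : MvPolynomial (Fin 3) K) = 0 ∧
      eval ![x, t, z] (pderiv 0 (C 2 * X 0 ^ n + X 0 * X 2 ^ (n - 1) - X 1 ^ n +
        C d * X 1 ^ (n - 1) * X 2 : MvPolynomial (Fin 3) K)) = 0 ∧
      eval ![x, t, z] (pderiv 1 (C 2 * X 0 ^ n + X 0 * X 2 ^ (n - 1) - X 1 ^ n +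
        C d * X 1 ^ (n - 1) * X 2 : MvPolynomial (Fin 3) K)) = 0 ∧
      eval ![x, t, z] (pderiv 2 (C 2 * X 0 ^ n + X 0 * X 2 ^ (n - 1) - X 1 ^ n +
        C d * X 1 ^ (n - 1) * X 2 : MvPolynomial (Fin 3) K)) = 0 := by
  have hchar_ne_one : ringChar K ≠ 1 := CharP.ringChar_ne_one
  have hchar_ne_two : ringChar K ≠ 2 := by
    intro h
    rw [h] at hodd
    exact absurd hodd (by decide)
  have hn3 : 3 ≤ n := by
    by_contra h
    obtain rfl : n = 2 := by omega
    rcases (Nat.dvd_prime Nat.prime_two).1 hp with h1 | h2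
    · exact hchar_ne_one h1
    · exact hchar_ne_two h2
  have h2 : (2 : K) ≠ 0 := Ring.two_ne_zero hchar_ne_two
  have hnK : (n : K) = 0 := (ringChar.spec K n).2 hp
  have hn0 : n ≠ 0 := by omega
  have hn1 : n - 1 ≠ 0 := by omega
  have hn2 : n - 1 - 1 ≠ 0 := by omega
  rintro ⟨x, t, z, hne, hG, hX, -, hZ⟩
  have hz : z = 0 := by
    simpa [Derivation.leibniz, Derivation.leibniz_pow, pderiv_X, Pi.single_apply, hnK, hn1]
      using hX
  subst hz
  have ht : t = 0 := by
    simpa [Derivation.leibniz, Derivation.leibniz_pow, pderiv_X, Pi.single_apply, hd, hn1, hn2]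
      using hZ
  subst ht
  have hx : x = 0 := by
    simpa [h2, hn0, hn1] using hG
  exact hne ⟨hx, rfl, rfl⟩
end
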